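/- For every integer n ≥ 1, every α ∈ (0,1), every μ' ∈ (0,1) and every C^∇ > 0 there exist ε > 0 and C̃ > 0 with the following property. Let J : D̄₊ → End(ℝ^{2n}) be α-Hölder with J(z) ∘ J(z) = −id for all z ∈ D̄₊, ‖J − J_st‖_{C^α(D̄₊)} < ε, and J(x) = J_st for all x ∈ D̄₊ ∩ ℝ. Let a : D̄₊ → End(ℝ^{2n}) be α-Hölder with ‖a‖_{C^α(D̄₊)} < C^∇, with J(z) ∘ a(z) = a(z) ∘ J(z) for all z, and with τ ∘ a(x) ∘ τ = a(x) for all x ∈ D̄₊ ∩ ℝ. Let u : D̄₊ → ℝ^{2n} be continuous and bounded, differentiable on the open half-disk D₊ with ∂u/∂x + J(z) ∂u/∂y + a(z) u = 0 there, with finite energy ∫_{D₊} ‖du‖² dA < ∞, and with u(D̄₊ ∩ ℝ) ⊂ ℝⁿ × {0}. Then u is continuously differentiable on μ'D̄₊ with α-Hölder first derivatives there, and the sum of the sup norms and α-Hölder constants of u and du on μ'D̄₊ is at most C̃ · sup_{D̄₊} |u|. (The reformulation in Step 7 of the proof of Theorem 2.3: boundary C^{1,α} estimate for holomorphic sections of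 a complex bundle with connection.) -/

import Mathlib

open MeasureTheory

/-- The standard complex structure `J_st` on `ℝ^{2n} ≅ ℂ^n`, i.e. multiplication
by `i`. -/
noncomputable def Jstd (n : ℕ) : (Fin n → ℂ) →L[ℝ] (Fin n → ℂ) :=
  Complex.I • (ContinuousLinearMap.id ℝ (Fin n → ℂ))

/-- The involution `τ` of `ℝ^{2n} ≅ ℂ^n`, i.e. coordinatewise complex
conjugation `(v,w) ↦ (v,-w)`. -/
def tauInv (n : ℕ) (v : Fin n → ℂ) : Fin n → ℂ := fun i => (starRingEnd ℂ) (v i)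

/-- The open upper half-disk `D₊`. -/
def halfDisk : Set ℂ := {z | ‖z‖ < 1 ∧ 0 < z.im}

/-- The closed upper half-disk `μD̄₊` of radius `μ`. -/
def closedHalfDisk (μ : ℝ) : Set ℂ := {z | ‖z‖ ≤ μ ∧ 0 ≤ z.im}

/-- The totally real subspace `ℝⁿ × {0} ⊂ ℝ^{2n} ≅ ℂ^n`. -/
def realSlice (n : ℕ) : Set (Fin n → ℂ) := {v | ∀ i, (v i).im = 0}

open scoped ContDiff

lemma integral_norm_complex (f : ℝ → ℝ) :
    ∫ w : ℂ, f ‖w‖ = 2 * Real.pi * ∫ r in Set.Ioi (0 : ℝ), r * f r := by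
  rw [integral_fun_norm_addHaar (volume : Measure ℂ) f]
  simp [Measure.real, Complex.finrank_real_complex]
  ring

lemma integrable_norm_complex (f : ℝ → ℝ) :
    Integrable (fun w : ℂ => f ‖w‖) ↔ IntegrableOn (fun r => r * f r) (Set.Ioi 0) := by
  rw [integrable_fun_norm_addHaar (volume : Measure ℂ)]
  simp [Complex.finrank_real_complex]

lemma radial_inside {s R : ℝ} (hs : 0 < s) (hR : 0 < R) :
    Integrable ((Metric.ball (0 : ℂ) R).indicator (fun w => ‖w‖ ^ (s - 2))) ∧
    ∫ w, (Metric.ball (0 : ℂ) R).indicator (fun w => ‖w‖ ^ (s - 2)) w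
      = 2 * Real.pi * (R ^ s / s) := by
  have e : (Metric.ball (0 : ℂ) R).indicator (fun w => ‖w‖ ^ (s - 2))
      = fun w : ℂ => ((Set.Iio R).indicator (fun r : ℝ => r ^ (s - 2))) ‖w‖ := by
    funext w
    classical simp only [Set.indicator_apply, Metric.mem_ball, dist_zero_right, Set.mem_Iio]
  have e2 : Set.EqOn (fun r : ℝ => r * (Set.Iio R).indicator (fun r : ℝ => r ^ (s - 2)) r)
      ((Set.Iio R).indicator (fun r => r ^ (s - 1))) (Set.Ioi 0) := by
    intro r hr
    have hr' : (0 : ℝ) < r := hr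
    simp only [Set.indicator_apply]
    split_ifs
    · nth_rewrite 1 [← Real.rpow_one r]
      rw [← Real.rpow_add hr']; ring_nf
    · simp
  rw [e, integrable_norm_complex, integral_norm_complex,
    integrableOn_congr_fun e2 measurableSet_Ioi, setIntegral_congr_fun measurableSet_Ioi e2,
    setIntegral_indicator measurableSet_Iio, IntegrableOn, integrable_indicator_iff measurableSet_Iio,
    IntegrableOn, Measure.restrict_restrict measurableSet_Iio, Set.Ioi_inter_Iio, Set.inter_comm,
    Set.Ioi_inter_Iio]
  have hi : IntervalIntegrable (fun r : ℝ => r ^ (s - 1)) volume 0 R :=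
    intervalIntegral.intervalIntegrable_rpow' (by linarith)
  constructor
  · exact (intervalIntegrable_iff_integrableOn_Ioo_of_le hR.le).1 hi
  · rw [← integral_Ioc_eq_integral_Ioo, ← intervalIntegral.integral_of_le hR.le,
      integral_rpow (Or.inl (by linarith))]
    simp [hs.ne']

lemma radial_outside {s R : ℝ} (hs : 0 < s) (hR : 0 < R) :
    Integrable ((Metric.ball (0 : ℂ) R)ᶜ.indicator (fun w => ‖w‖ ^ (-s - 2))) ∧
    ∫ w, (Metric.ball (0 : ℂ) R)ᶜ.indicator (fun w => ‖w‖ ^ (-s - 2)) w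
      = 2 * Real.pi * (R ^ (-s) / s) := by
  have e : (Metric.ball (0 : ℂ) R)ᶜ.indicator (fun w => ‖w‖ ^ (-s - 2))
      = fun w : ℂ => ((Set.Ici R).indicator (fun r : ℝ => r ^ (-s - 2))) ‖w‖ := by
    funext w
    classical simp only [Set.indicator_apply, Set.mem_compl_iff, Metric.mem_ball, dist_zero_right, not_lt,
      Set.mem_Ici]
  have e2 : Set.EqOn (fun r : ℝ => r * (Set.Ici R).indicator (fun r : ℝ => r ^ (-s - 2)) r)
      ((Set.Ici R).indicator (fun r => r ^ (-s - 1))) (Set.Ioi 0) := by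
    intro r hr
    have hr' : (0 : ℝ) < r := hr
    simp only [Set.indicator_apply]
    split_ifs
    · nth_rewrite 1 [← Real.rpow_one r]
      rw [← Real.rpow_add hr']; ring_nf
    · simp
  have hsub : Set.Ici R ∩ Set.Ioi 0 = Set.Ici R :=
    Set.inter_eq_left.2 fun x hx => lt_of_lt_of_le hR hx
  rw [e, integrable_norm_complex, integral_norm_complex,
    integrableOn_congr_fun e2 measurableSet_Ioi, setIntegral_congr_fun measurableSet_Ioi e2,
    setIntegral_indicator measurableSet_Ici, IntegrableOn, integrable_indicator_iff measurableSet_Ici,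
    IntegrableOn, Measure.restrict_restrict measurableSet_Ici, Set.inter_comm (Set.Ioi 0), hsub]
  constructor
  · exact (integrableOn_Ici_iff_integrableOn_Ioi).2
      (integrableOn_Ioi_rpow_of_lt (by linarith) hR)
  · rw [integral_Ici_eq_integral_Ioi, integral_Ioi_rpow_of_lt (by linarith) hR]
    have : -s - 1 + 1 = -s := by ring
    rw [this]; field_simp

/-- A majorant of the kernel `‖w‖^(α-2) / ‖t - w‖` with integral of order `‖t‖^(α-1)`. -/
lemma exists_kernel_majorant {α : ℝ} (h0 : 0 < α) (h1 : α < 1) :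
    ∃ C, 0 < C ∧ ∀ t : ℂ, t ≠ 0 → ∃ G : ℂ → ℝ, Integrable G ∧
      (∀ w, ‖w‖ ^ (α - 2) * ‖t - w‖⁻¹ ≤ G w) ∧ ∫ w, G w ≤ C * ‖t‖ ^ (α - 1) := by
  refine ⟨2 * Real.pi * (1 / α + 1 + 3 / (1 - α)) * (1/2) ^ (α - 1), by
    have : 0 < 1 - α := by linarith
    positivity, fun t ht => ?_⟩
  set ρ := ‖t‖ / 2 with hρ
  have hρ0 : 0 < ρ := by positivity
  obtain ⟨i1, j1⟩ := radial_inside h0 hρ0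
  obtain ⟨i2, j2⟩ := radial_inside one_pos hρ0
  obtain ⟨i3, j3⟩ := radial_outside (s := 1 - α) (by linarith) hρ0
  set f1 := (Metric.ball (0 : ℂ) ρ).indicator (fun w => ‖w‖ ^ (α - 2))
  set f2 := (Metric.ball (0 : ℂ) ρ).indicator (fun w => ‖w‖ ^ ((1:ℝ) - 2))
  set f3 := (Metric.ball (0 : ℂ) ρ)ᶜ.indicator (fun w => ‖w‖ ^ (-(1-α) - 2))
  have i2' : Integrable (fun w => f2 (w - t)) := i2.comp_sub_right t
  have j2' : ∫ w, f2 (w - t) = 2 * Real.pi * (ρ ^ (1:ℝ) / 1) := by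
    rw [integral_sub_right_eq_self f2 t, j2]
  have n1 : ∀ w, 0 ≤ f1 w := fun w => Set.indicator_nonneg (fun _ _ => by positivity) w
  have n2 : ∀ w, 0 ≤ f2 w := fun w => Set.indicator_nonneg (fun _ _ => by positivity) w
  have n3 : ∀ w, 0 ≤ f3 w := fun w => Set.indicator_nonneg (fun _ _ => by positivity) w
  refine ⟨fun w => ρ⁻¹ * f1 w + ρ ^ (α - 2) * f2 (w - t) + 3 * f3 w,
    ((i1.const_mul _).add (i2'.const_mul _)).add (i3.const_mul _), fun w => ?_, ?_⟩
  · beta_reduce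
    have m1 : 0 ≤ ρ⁻¹ * f1 w := mul_nonneg (by positivity) (n1 w)
    have m2 : 0 ≤ ρ ^ (α - 2) * f2 (w - t) := mul_nonneg (by positivity) (n2 _)
    have m3 : 0 ≤ 3 * f3 w := mul_nonneg (by positivity) (n3 w)
    have htri : ‖t‖ ≤ ‖t - w‖ + ‖w‖ := by simpa using norm_add_le (t - w) w
    have htri2 : ‖w‖ ≤ ‖t‖ + ‖t - w‖ := by
      simpa [norm_sub_rev] using norm_sub_le t (t - w)
    by_cases c1 : ‖w‖ < ρ
    · have : f1 w = ‖w‖ ^ (α - 2) := by simp [f1, c1]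
      rw [this] at m1 ⊢
      have hle : ‖t - w‖⁻¹ ≤ ρ⁻¹ := inv_anti₀ hρ0 (by linarith)
      have : ‖w‖ ^ (α - 2) * ‖t - w‖⁻¹ ≤ ‖w‖ ^ (α - 2) * ρ⁻¹ := by gcongr
      linarith
    · push Not at c1
      have hw0 : 0 < ‖w‖ := lt_of_lt_of_le hρ0 c1
      by_cases c2 : ‖t - w‖ < ρ
      · have : f2 (w - t) = ‖t - w‖⁻¹ := by
          have : w - t ∈ Metric.ball (0:ℂ) ρ := by simpa [norm_sub_rev] using c2
          simp only [f2, Set.indicator_of_mem this]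
          rw [norm_sub_rev]; norm_num [Real.rpow_neg_one]
        rw [this] at m2 ⊢
        have : ‖w‖ ^ (α - 2) ≤ ρ ^ (α - 2) :=
          Real.rpow_le_rpow_of_nonpos hρ0 c1 (by linarith)
        have : ‖w‖ ^ (α - 2) * ‖t - w‖⁻¹ ≤ ρ ^ (α - 2) * ‖t - w‖⁻¹ := by gcongr
        linarith
      · push Not at c2
        have e3 : f3 w = ‖w‖ ^ (α - 2) * ‖w‖⁻¹ := by
          have : w ∈ (Metric.ball (0:ℂ) ρ)ᶜ := by simpa using c1
          simp only [f3, Set.indicator_of_mem this]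
          rw [← Real.rpow_neg_one ‖w‖, ← Real.rpow_add hw0]; ring_nf
        rw [e3] at m3 ⊢
        have : ‖t - w‖⁻¹ ≤ 3 * ‖w‖⁻¹ := by
          rw [inv_eq_one_div, div_le_iff₀ (by linarith)]
          rw [mul_assoc, inv_mul_eq_div, ← mul_div_assoc, le_div_iff₀ hw0]
          linarith
        have : ‖w‖ ^ (α - 2) * ‖t - w‖⁻¹ ≤ ‖w‖ ^ (α - 2) * (3 * ‖w‖⁻¹) := by gcongr
        linarith
  · beta_reduce
    rw [integral_add (f := fun w => ρ⁻¹ * f1 w + ρ ^ (α - 2) * f2 (w - t))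
        ((i1.const_mul _).add (i2'.const_mul _)) (i3.const_mul _),
      integral_add (i1.const_mul _) (i2'.const_mul _), integral_const_mul, integral_const_mul,
      integral_const_mul, j1, j2', j3]
    have a1 : ρ⁻¹ * ρ ^ α = ρ ^ (α - 1) := by
      rw [Real.rpow_sub_one hρ0.ne']; field_simp
    have a2 : ρ ^ (α - 2) * ρ ^ (1:ℝ) = ρ ^ (α - 1) := by
      rw [← Real.rpow_add hρ0]; ring_nf
    have a3 : ρ ^ (-(1 - α)) = ρ ^ (α - 1) := by ring_nf
    have a4 : ρ ^ (α - 1) = (1/2) ^ (α - 1) * ‖t‖ ^ (α - 1) := by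
      rw [← Real.mul_rpow (by positivity) (by positivity)]; congr 1; rw [hρ]; ring
    have : 1 - α ≠ 0 := by linarith
    apply le_of_eq
    calc _ = 2 * Real.pi * ((ρ⁻¹ * ρ ^ α) / α + ρ ^ (α - 2) * ρ ^ (1:ℝ)
          + 3 * ρ ^ (-(1-α)) / (1 - α)) := by ring
      _ = _ := by rw [a1, a2, a3, a4]; ring

section CauchyTransform

variable {E : Type*} [NormedAddCommGroup E] [NormedSpace ℝ E] [NormedSpace ℂ E]
  [IsScalarTower ℝ ℂ E]

/-- Smooth compactly supported functions on the plane. -/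
structure IsTest {F : Type*} [NormedAddCommGroup F] [NormedSpace ℝ F] (f : ℂ → F) : Prop where
  smooth : ContDiff ℝ ∞ f
  supp : HasCompactSupport f

/-- The Cauchy transform on the plane. -/
noncomputable def cauchyT (f : ℂ → E) (z : ℂ) : E :=
  (Real.pi⁻¹ : ℝ) • ∫ w : ℂ, (w⁻¹ : ℂ) • f (z - w)

/-- The Wirtinger operator `∂̄`. -/
noncomputable def dbar (v : ℂ → E) (z : ℂ) : E :=
  (2⁻¹ : ℝ) • (fderiv ℝ v z 1 + Complex.I • fderiv ℝ v z Complex.I)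

lemma locallyIntegrable_inv : LocallyIntegrable (fun w : ℂ => w⁻¹) := by
  intro x
  refine ⟨Metric.ball 0 (‖x‖ + 1), Metric.isOpen_ball.mem_nhds (by simp), ?_⟩
  have h := (radial_inside (s := 1) (R := ‖x‖ + 1) one_pos (by positivity)).1
  rw [integrable_indicator_iff measurableSet_ball] at h
  refine h.mono' (by fun_prop) (Filter.Eventually.of_forall fun w => ?_)
  rw [norm_inv]; norm_num [Real.rpow_neg_one]

lemma cauchyT_eq_convolution (f : ℂ → E) : cauchyT f = (Real.pi⁻¹ : ℝ) •
    (convolution (fun w : ℂ => w⁻¹) f (ContinuousLinearMap.lsmul ℝ ℂ) volume) := by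
  funext z; simp [cauchyT, convolution_def]

lemma integrable_cauchyT {f : ℂ → E} (hf : Continuous f) (hc : HasCompactSupport f) (z : ℂ) :
    Integrable (fun w : ℂ => (w⁻¹ : ℂ) • f (z - w)) := by
  have := hc.convolutionExists_right (ContinuousLinearMap.lsmul ℝ ℂ : ℂ →L[ℝ] E →L[ℝ] E)
    locallyIntegrable_inv hf z
  simpa [ConvolutionExistsAt] using this

lemma cauchyT_contDiff {f : ℂ → E} (hf : ContDiff ℝ ∞ f) (hc : HasCompactSupport f) :
    ContDiff ℝ ∞ (cauchyT f) := by
  rw [cauchyT_eq_convolution]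
  exact (hc.contDiff_convolution_right _ locallyIntegrable_inv hf).const_smul _

lemma fderiv_cauchyT {f : ℂ → E} (hf : ContDiff ℝ ∞ f) (hc : HasCompactSupport f) (z e : ℂ) :
    fderiv ℝ (cauchyT f) z e = cauchyT (fun x => fderiv ℝ f x e) z := by
  have h1 := hc.hasFDerivAt_convolution_right
    (ContinuousLinearMap.lsmul ℝ ℂ : ℂ →L[ℝ] E →L[ℝ] E) locallyIntegrable_inv
    (hf.of_le (by exact_mod_cast le_top)) z
  have h2 := (h1.const_smul (Real.pi⁻¹ : ℝ)).fderiv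
  rw [cauchyT_eq_convolution, cauchyT_eq_convolution, h2, smul_apply,
    convolution_precompR_apply _ locallyIntegrable_inv (hc.fderiv ℝ)
      (hf.continuous_fderiv (by simp))]
  rfl

lemma IsTest.fderiv_apply {F : Type*} [NormedAddCommGroup F] [NormedSpace ℝ F] {f : ℂ → F}
    (hf : IsTest f) (e : ℂ) : IsTest (fun x => fderiv ℝ f x e) :=
  ⟨(hf.smooth.fderiv_right (m := ∞) (by simp)).clm_apply contDiff_const, hf.supp.fderiv_apply ℝ e⟩

lemma cauchyT_add {f g : ℂ → E} (hf : IsTest f) (hg : IsTest g) (z : ℂ) :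
    cauchyT (fun x => f x + g x) z = cauchyT f z + cauchyT g z := by
  simp only [cauchyT, smul_add]
  rw [integral_add (integrable_cauchyT hf.smooth.continuous hf.supp z)
    (integrable_cauchyT hg.smooth.continuous hg.supp z), smul_add]

lemma cauchyT_sub {f g : ℂ → E} (hf : IsTest f) (hg : IsTest g) (z : ℂ) :
    cauchyT (fun x => f x - g x) z = cauchyT f z - cauchyT g z := by
  simp only [cauchyT, smul_sub]
  rw [integral_sub (integrable_cauchyT hf.smooth.continuous hf.supp z)
    (integrable_cauchyT hg.smooth.continuous hg.supp z), smul_sub]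

lemma cauchyT_smul (c : ℂ) (f : ℂ → E) (z : ℂ) :
    cauchyT (fun x => c • f x) z = c • cauchyT f z := by
  simp only [cauchyT]
  simp_rw [smul_comm _ c, integral_smul, smul_comm _ c]

lemma cauchyT_real_smul (c : ℝ) (f : ℂ → E) (z : ℂ) :
    cauchyT (fun x => c • f x) z = c • cauchyT f z := by
  simp only [cauchyT]
  simp_rw [smul_comm _ c, integral_smul, smul_comm _ c]

lemma IsTest.dbar {f : ℂ → E} (hf : IsTest f) : IsTest (dbar f) := by
  have h1 := hf.fderiv_apply 1
  have h2 := hf.fderiv_apply Complex.I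
  refine ⟨(h1.smooth.add (h2.smooth.const_smul Complex.I)).const_smul (2⁻¹ : ℝ), ?_⟩
  exact (h1.supp.add (h2.supp.comp_left (g := fun x => Complex.I • x) (smul_zero _))).comp_left
    (g := fun x => (2⁻¹ : ℝ) • x) (smul_zero _)

lemma dbar_cauchyT_eq {f : ℂ → E} (hf : IsTest f) (z : ℂ) :
    dbar (cauchyT f) z = cauchyT (dbar f) z := by
  have h1 := hf.fderiv_apply 1
  have h2 := hf.fderiv_apply Complex.I
  have h3 : IsTest (fun x => Complex.I • fderiv ℝ f x Complex.I) :=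
    ⟨h2.smooth.const_smul _, h2.supp.comp_left (g := fun x => Complex.I • x) (smul_zero _)⟩
  unfold dbar
  rw [cauchyT_real_smul, cauchyT_add h1 h3, cauchyT_smul, fderiv_cauchyT hf.smooth hf.supp,
    fderiv_cauchyT hf.smooth hf.supp]

/-- Cauchy–Pompeiu formula for test functions. -/
lemma cauchyT_dbar [CompleteSpace E] {v : ℂ → E} (hv : IsTest v) (z : ℂ) :
    cauchyT (dbar v) z = v z := by
  have hd : Differentiable ℝ v := hv.smooth.differentiable (by simp)
  obtain ⟨R, hR⟩ : ∃ R : ℝ, ∀ w, R < ‖w‖ → v (z - w) = 0 ∧ fderiv ℝ v (z - w) = 0 := by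
    obtain ⟨R, hR⟩ := hv.supp.isCompact.isBounded.subset_closedBall 0
    refine ⟨R + ‖z‖, fun w hw => ?_⟩
    have hn : z - w ∉ tsupport v := fun h => by
      have h1 := hR h
      rw [mem_closedBall_zero_iff] at h1
      have := norm_sub_norm_le w z
      rw [norm_sub_rev] at this
      linarith
    exact ⟨image_eq_zero_of_notMem_tsupport hn,
      image_eq_zero_of_notMem_tsupport fun h => hn (tsupport_fderiv_subset ℝ h)⟩
  set e : ℝ → ℂ := fun θ => Real.cos θ + Real.sin θ * Complex.I with he
  have hec : Continuous e := by fun_prop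
  have hne : ∀ θ, ‖e θ‖ = 1 := fun θ => by
    have := Complex.norm_exp_ofReal_mul_I θ
    rwa [Complex.exp_mul_I, ← Complex.ofReal_cos, ← Complex.ofReal_sin] at this
  have hDc : Continuous (fderiv ℝ v) := hv.smooth.continuous_fderiv (by simp)
  set A : ℝ × ℝ → E := fun p => fderiv ℝ v (z - p.1 * e p.2) (e p.2) with hA
  set B : ℝ × ℝ → E := fun p => fderiv ℝ v (z - p.1 * e p.2) (Complex.I * e p.2) with hB
  have hAc : Continuous A := by
    refine (hDc.comp ?_).clm_apply ?_ <;> fun_prop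
  have hBc : Continuous B := by
    refine (hDc.comp ?_).clm_apply ?_ <;> fun_prop
  have hinteg : ∀ F : ℝ × ℝ → E, Continuous F → (∀ p : ℝ × ℝ, R < |p.1| → F p = 0) →
      IntegrableOn F (Set.Ioi (0:ℝ) ×ˢ Set.Ioo (-Real.pi) Real.pi) := by
    intro F hF h0
    have h1 : IntegrableOn F (Set.Icc (0:ℝ) R ×ˢ Set.Icc (-Real.pi) Real.pi) :=
      hF.continuousOn.integrableOn_compact (isCompact_Icc.prod isCompact_Icc)
    refine h1.of_forall_sdiff_eq_zero (measurableSet_Ioi.prod measurableSet_Ioo) ?_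
    rintro ⟨r, θ⟩ ⟨⟨hr, hθ⟩, h⟩
    simp only [Set.mem_Ioi] at hr
    apply h0
    by_contra hcon
    push Not at hcon
    rw [abs_of_pos hr] at hcon
    exact h ⟨⟨hr.le, hcon⟩, ⟨hθ.1.le, hθ.2.le⟩⟩
  have hnorm : ∀ p : ℝ × ℝ, ‖(p.1 : ℂ) * e p.2‖ = |p.1| := fun p => by
    rw [norm_mul, hne, mul_one, Complex.norm_real, Real.norm_eq_abs]
  have hAi := hinteg A hAc (fun p hp => by
    simp only [hA]; rw [(hR _ (by rwa [hnorm])).2]; simp)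
  have hBi := hinteg B hBc (fun p hp => by
    simp only [hB]; rw [(hR _ (by rwa [hnorm])).2]; simp)
  -- the radial part
  have intA : ∫ p in Set.Ioi (0:ℝ) ×ˢ Set.Ioo (-Real.pi) Real.pi, A p
      = (2 * Real.pi) • v z := by
    rw [Measure.volume_eq_prod] at hAi ⊢
    rw [← Measure.prod_restrict, integral_prod_symm _ (by rwa [Measure.prod_restrict])]
    have : ∀ θ : ℝ, ∫ r in Set.Ioi (0:ℝ), A (r, θ) = v z := by
      intro θ
      set φ : ℝ → E := fun r => - v (z - r * e θ) with hφ
      have hder : ∀ r : ℝ, HasDerivAt φ (A (r, θ)) r := by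
        intro r
        have h1 : HasDerivAt (fun r : ℝ => z - r * e θ) (- e θ) r := by
          simpa using ((Complex.ofRealCLM.hasDerivAt (x := r)).mul_const (e θ)).const_sub z
        have h2 := ((hd (z - r * e θ)).hasFDerivAt.comp_hasDerivAt r h1).neg
        exact h2.congr_deriv (by simp [hA])
      have hlim : Filter.Tendsto φ Filter.atTop (nhds 0) := by
        refine tendsto_const_nhds.congr' ?_
        filter_upwards [Filter.eventually_gt_atTop (max R 0)] with r hr
        have : R < ‖(r:ℂ) * e θ‖ := by
          rw [hnorm (r, θ)]
          exact lt_of_lt_of_le (lt_of_le_of_lt (le_max_left _ _) hr) (le_abs_self r)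
        simp [hφ, (hR _ this).1]
      have hcont : ContinuousWithinAt φ (Set.Ici 0) 0 :=
        (hder 0).continuousAt.continuousWithinAt
      have hi : IntegrableOn (fun r => A (r, θ)) (Set.Ioi 0) := by
        have h1 : IntegrableOn (fun r => A (r, θ)) (Set.Icc 0 R) :=
          (hAc.comp (by fun_prop)).continuousOn.integrableOn_compact isCompact_Icc
        refine h1.of_forall_sdiff_eq_zero measurableSet_Ioi ?_
        rintro r ⟨hr, h⟩
        simp only [Set.mem_Ioi] at hr
        have : R < ‖(r:ℂ) * e θ‖ := by
          rw [hnorm (r, θ), abs_of_pos hr]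
          by_contra hcon
          exact h ⟨hr.le, not_lt.1 hcon⟩
        simp [hA, (hR _ this).2]
      rw [integral_Ioi_of_hasDerivAt_of_tendsto hcont (fun r _ => hder r) hi hlim]
      simp [hφ]
    simp only [this]
    rw [setIntegral_const]
    congr 1
    rw [measureReal_def, Real.volume_Ioo, ENNReal.toReal_ofReal (by linarith [Real.pi_pos])]
    ring
  -- the angular part
  have intB : ∫ p in Set.Ioi (0:ℝ) ×ˢ Set.Ioo (-Real.pi) Real.pi, B p = 0 := by
    rw [Measure.volume_eq_prod] at hBi ⊢
    rw [setIntegral_prod _ hBi]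
    rw [setIntegral_congr_fun (g := fun _ => (0 : E)) measurableSet_Ioi ?_]
    · simp
    · intro r hr
      simp only [Set.mem_Ioi] at hr
      beta_reduce
      have hder : ∀ θ : ℝ, HasDerivAt (fun θ : ℝ => -(r⁻¹ • v (z - r * e θ))) (B (r, θ)) θ := by
        intro θ
        have h0 : HasDerivAt e (Complex.I * e θ) θ := by
          have h1 := (Real.hasDerivAt_cos θ).ofReal_comp.add
            ((Real.hasDerivAt_sin θ).ofReal_comp.mul_const Complex.I)
          refine h1.congr_deriv ?_
          simp only [he, mul_add, Complex.ofReal_neg]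
          linear_combination -(Real.sin θ : ℂ) * Complex.I_mul_I
        have h1 : HasDerivAt (fun θ : ℝ => z - r * e θ) (- (r * (Complex.I * e θ))) θ :=
          (h0.const_mul (r:ℂ)).const_sub z
        have h2 := (((hd (z - r * e θ)).hasFDerivAt.comp_hasDerivAt θ h1).const_smul r⁻¹).neg
        refine h2.congr_deriv ?_
        simp only [hB, map_neg, smul_neg, neg_neg]
        rw [← Complex.real_smul (x := r) (z := Complex.I * e θ), map_smul, smul_smul, inv_mul_cancel₀ hr.ne', one_smul]
      rw [← integral_Ioc_eq_integral_Ioo, ← intervalIntegral.integral_of_le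
        (by linarith [Real.pi_pos]), intervalIntegral.integral_eq_sub_of_hasDerivAt
        (fun θ _ => hder θ) ((hBc.comp (by fun_prop)).intervalIntegrable _ _)]
      simp [he]
  have key : ∀ p ∈ Set.Ioi (0:ℝ) ×ˢ Set.Ioo (-Real.pi) Real.pi,
      p.1 • ((Complex.polarCoord.symm p)⁻¹ • dbar v (z - Complex.polarCoord.symm p))
      = (2⁻¹ : ℝ) • (A p + Complex.I • B p) := by
    rintro ⟨r, θ⟩ ⟨hr, -⟩
    simp only [Set.mem_Ioi] at hr
    rw [Complex.polarCoord_symm_apply]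
    change r • (((r:ℂ) * e θ)⁻¹ • dbar v (z - r * e θ)) = _
    have einv : (e θ)⁻¹ = Real.cos θ - Real.sin θ * Complex.I := by
      refine inv_eq_of_mul_eq_one_right ?_
      simp only [he]
      have := Real.cos_sq_add_sin_sq θ
      have h2 : (Real.cos θ : ℂ) ^ 2 + (Real.sin θ : ℂ) ^ 2 = 1 := by exact_mod_cast this
      linear_combination h2 - (Real.sin θ : ℂ) ^ 2 * Complex.I_mul_I
    have e1 : e θ = Real.cos θ • (1:ℂ) + Real.sin θ • Complex.I := by simp [he]
    have e2 : Complex.I * e θ = Real.cos θ • Complex.I - Real.sin θ • (1:ℂ) := by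
      simp only [he, Complex.real_smul]
      linear_combination (Real.sin θ : ℂ) * Complex.I_mul_I
    simp only [hA, hB, dbar]
    rw [e2, map_sub, map_smul, map_smul]
    conv_rhs => rw [e1, map_add, map_smul, map_smul]
    rw [← e1]
    set X := fderiv ℝ v (z - r * e θ) 1
    set Y := fderiv ℝ v (z - r * e θ) Complex.I
    rw [mul_inv, mul_smul, einv]
    have hco : ∀ (a : ℝ) (x : E), a • x = (a : ℂ) • x := fun a x => by
      rw [← smul_one_smul ℂ a x, Complex.real_smul, mul_one]
    have hrr : ∀ x : E, r • ((r:ℂ)⁻¹ • x) = x := fun x => by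
      rw [hco, smul_smul, mul_inv_cancel₀ (by exact_mod_cast hr.ne'), one_smul]
    rw [hrr]
    generalize Real.cos θ = c
    generalize Real.sin θ = s
    simp only [hco, smul_add, smul_sub, smul_smul]
    have hI := Complex.I_mul_I
    match_scalars
    · ring
    · linear_combination (-(2⁻¹ : ℂ)) * (s : ℂ) * hI
  have final : ∫ w : ℂ, (w⁻¹ : ℂ) • dbar v (z - w) = Real.pi • v z := by
    rw [← Complex.integral_comp_polarCoord_symm, polarCoord_target,
      setIntegral_congr_fun (measurableSet_Ioi.prod measurableSet_Ioo) key,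
      integral_smul, integral_add (f := fun p => A p) (g := fun p => Complex.I • B p) hAi
        (hBi.smul Complex.I), integral_smul, intA, intB]
    simp [smul_smul]
  rw [cauchyT, final, smul_smul, inv_mul_cancel₀ Real.pi_ne_zero, one_smul]

lemma dbar_cauchyT [CompleteSpace E] {f : ℂ → E} (hf : IsTest f) (z : ℂ) :
    dbar (cauchyT f) z = f z := by
  rw [dbar_cauchyT_eq hf, cauchyT_dbar hf]

end CauchyTransform

section LTwo

lemma lintegral_mul_sq_le {k h : ℂ → ENNReal} (hk : Measurable k) (hh : Measurable h) :
    (∫⁻ w, k w * h w) ^ 2 ≤ (∫⁻ w, k w) * ∫⁻ w, k w * h w ^ 2 := by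
  have h1 := ENNReal.lintegral_mul_le_Lp_mul_Lq (volume.withDensity k)
    Real.HolderConjugate.two_two (f := fun _ => 1) (g := h) aemeasurable_const hh.aemeasurable
  simp only [Pi.mul_apply, one_mul, ENNReal.one_rpow] at h1
  rw [lintegral_withDensity_eq_lintegral_mul _ hk hh,
    lintegral_withDensity_eq_lintegral_mul _ hk (hh.pow_const _),
    lintegral_withDensity_eq_lintegral_mul _ hk measurable_const] at h1
  simp only [Pi.mul_apply, mul_one, ENNReal.rpow_ofNat] at h1
  calc (∫⁻ w, k w * h w) ^ 2
      ≤ ((∫⁻ w, k w) ^ (1 / 2 : ℝ) * (∫⁻ w, k w * h w ^ 2) ^ (1 / 2 : ℝ)) ^ 2 := by gcongr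
    _ = _ := by
      rw [mul_pow, ← ENNReal.rpow_natCast, ← ENNReal.rpow_natCast, ← ENNReal.rpow_mul,
        ← ENNReal.rpow_mul]
      norm_num

/-- Young's inequality for the convolution of an integrable with a square-integrable function. -/
lemma lintegral_conv_sq_le {k g : ℂ → ENNReal} (hk : Measurable k) (hg : Measurable g) :
    ∫⁻ z, (∫⁻ w, k w * g (z - w)) ^ 2 ≤ (∫⁻ w, k w) ^ 2 * ∫⁻ w, g w ^ 2 := by
  calc ∫⁻ z, (∫⁻ w, k w * g (z - w)) ^ 2
      ≤ ∫⁻ z, (∫⁻ w, k w) * ∫⁻ w, k w * g (z - w) ^ 2 :=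
        lintegral_mono fun z => lintegral_mul_sq_le hk (by fun_prop)
    _ = (∫⁻ w, k w) * ∫⁻ z, ∫⁻ w, k w * g (z - w) ^ 2 := by
        rw [lintegral_const_mul]
        exact Measurable.lintegral_prod_right' (f := fun p : ℂ × ℂ => k p.2 * g (p.1 - p.2) ^ 2)
          (by fun_prop)
    _ = (∫⁻ w, k w) * ∫⁻ w, k w * ∫⁻ z, g z ^ 2 := by
        rw [lintegral_lintegral_swap (by fun_prop)]
        congr 1
        refine lintegral_congr fun w => ?_
        rw [lintegral_const_mul _ (by fun_prop), lintegral_sub_right_eq_self (fun z => g z ^ 2)]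
    _ = _ := by rw [lintegral_mul_const _ hk]; ring

lemma eLpNorm_two_sq {F : Type*} [NormedAddCommGroup F] (f : ℂ → F) (μ : Measure ℂ) :
    eLpNorm f 2 μ ^ 2 = ∫⁻ z, ‖f z‖ₑ ^ 2 ∂μ := by
  have := eLpNorm_nnreal_pow_eq_lintegral (f := f) (μ := μ) (p := 2) (by norm_num)
  simpa using this

lemma eLpNorm_restrict_le_of_conv {F G : Type*} [NormedAddCommGroup F] [NormedAddCommGroup G]
    {f : ℂ → F} {g : ℂ → G} {k : ℂ → ENNReal} (hk : Measurable k)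
    (hg : Measurable fun z => ‖g z‖ₑ) {S : Set ℂ} (hS : MeasurableSet S)
    (h : ∀ z ∈ S, ‖f z‖ₑ ≤ ∫⁻ w, k w * ‖g (z - w)‖ₑ) :
    eLpNorm f 2 (volume.restrict S) ≤ (∫⁻ w, k w) * eLpNorm g 2 volume := by
  have h1 : eLpNorm f 2 (volume.restrict S) ^ 2 ≤ ((∫⁻ w, k w) * eLpNorm g 2 volume) ^ 2 := by
    rw [mul_pow, eLpNorm_two_sq, eLpNorm_two_sq]
    refine le_trans ?_ (lintegral_conv_sq_le hk hg)
    refine le_trans (setLIntegral_mono' hS fun z hz => ?_) (setLIntegral_le_lintegral S _)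
    gcongr
    exact h z hz
  exact (ENNReal.pow_le_pow_left_iff two_ne_zero).1 h1

lemma IsTest.integrable {F : Type*} [NormedAddCommGroup F] [NormedSpace ℝ F] {f : ℂ → F}
    (hf : IsTest f) : Integrable f :=
  hf.smooth.continuous.integrable_of_hasCompactSupport hf.supp

lemma integral_jacobian_eq_zero {a b : ℂ → ℝ} (ha : IsTest a) (hb : IsTest b) :
    ∫ z, (fderiv ℝ a z 1 * fderiv ℝ b z Complex.I - fderiv ℝ a z Complex.I * fderiv ℝ b z 1)
      = 0 := by
  have ha1 := ha.fderiv_apply 1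
  have haI := ha.fderiv_apply Complex.I
  have hb1 := hb.fderiv_apply 1
  have hbI := hb.fderiv_apply Complex.I
  have hmul : ∀ {p q : ℂ → ℝ}, IsTest p → IsTest q → Integrable fun z => p z * q z :=
    fun hp hq => IsTest.integrable ⟨hp.smooth.mul hq.smooth, hp.supp.mul_right⟩
  have dif : ∀ {p : ℂ → ℝ}, IsTest p → Differentiable ℝ p := fun hp =>
    hp.smooth.differentiable (by simp)
  have e1 := integral_mul_fderiv_eq_neg_fderiv_mul_of_integrable (μ := volume) (v := (1:ℂ))
    (f := a) (g := fun z => fderiv ℝ b z Complex.I) (hmul ha1 hbI)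
    (hmul ha (hbI.fderiv_apply 1)) (hmul ha hbI) (fun x _ => dif ha x) (fun x _ => dif hbI x)
  have e2 := integral_mul_fderiv_eq_neg_fderiv_mul_of_integrable (μ := volume) (v := Complex.I)
    (f := a) (g := fun z => fderiv ℝ b z 1) (hmul haI hb1)
    (hmul ha (hb1.fderiv_apply Complex.I)) (hmul ha hb1) (fun x _ => dif ha x) (fun x _ => dif hb1 x)
  rw [integral_sub (hmul ha1 hbI) (hmul haI hb1)]
  have hsymm : ∀ z, fderiv ℝ (fun z => fderiv ℝ b z Complex.I) z 1
      = fderiv ℝ (fun z => fderiv ℝ b z 1) z Complex.I := by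
    intro z
    have hD : DifferentiableAt ℝ (fderiv ℝ b) z :=
      ((hb.smooth.fderiv_right (m := ∞) (by simp)).differentiable (by simp)) z
    have hs := (hb.smooth.contDiffAt (x := z)).isSymmSndFDerivAt
      (by simp only [minSmoothness_of_isRCLikeNormedField]; exact WithTop.coe_le_coe.2 (le_top : (2 : ℕ∞) ≤ ⊤))
    rw [fderiv_clm_apply hD (by fun_prop), fderiv_clm_apply hD (by fun_prop)]
    simpa using hs.eq 1 Complex.I
  simp only [hsymm] at e1
  linarith

lemma IsTest.comp_clm {F G : Type*} [NormedAddCommGroup F] [NormedSpace ℝ F]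
    [NormedAddCommGroup G] [NormedSpace ℝ G] {f : ℂ → F} (hf : IsTest f) (L : F →L[ℝ] G) :
    IsTest (fun z => L (f z)) :=
  ⟨L.contDiff.comp hf.smooth, hf.supp.comp_left (map_zero L)⟩

lemma IsTest.fderiv_clm {F G : Type*} [NormedAddCommGroup F] [NormedSpace ℝ F]
    [NormedAddCommGroup G] [NormedSpace ℝ G] {f : ℂ → F} (hf : IsTest f) (L : F →L[ℝ] G)
    (z e : ℂ) : fderiv ℝ (fun z => L (f z)) z e = L (fderiv ℝ f z e) := by
  have hd := (hf.smooth.differentiable (by simp)) z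
  have := (L.hasFDerivAt.comp z hd.hasFDerivAt).fderiv
  change fderiv ℝ (L ∘ f) z e = _
  rw [this]; rfl

lemma eLpNorm_fderiv_le_dbar_scalar {φ : ℂ → ℂ} (hφ : IsTest φ) :
    eLpNorm (fun z => fderiv ℝ φ z Complex.I) 2 volume ≤ 2 * eLpNorm (dbar φ) 2 volume := by
  have hsq : ∀ {p : ℂ → ℂ}, IsTest p → Integrable (fun z => ‖p z‖ ^ 2) := fun {p} hp => by
    refine Continuous.integrable_of_hasCompactSupport (hp.smooth.continuous.norm.pow 2) ?_
    exact hp.supp.comp_left (g := fun x : ℂ => ‖x‖ ^ 2) (by simp)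
  have hx := hφ.fderiv_apply 1
  have hy := hφ.fderiv_apply Complex.I
  have hd := hφ.dbar
  have hre := hφ.comp_clm Complex.reCLM
  have him := hφ.comp_clm Complex.imCLM
  have hjac := integral_jacobian_eq_zero hre him
  simp only [hφ.fderiv_clm Complex.reCLM, hφ.fderiv_clm Complex.imCLM] at hjac
  simp only [Complex.reCLM_apply, Complex.imCLM_apply] at hjac
  have hpt : ∀ z, ‖fderiv ℝ φ z Complex.I‖ ^ 2 ≤ 4 * ‖dbar φ z‖ ^ 2 +
      2 * ((fderiv ℝ φ z 1).re * (fderiv ℝ φ z Complex.I).im -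
        (fderiv ℝ φ z Complex.I).re * (fderiv ℝ φ z 1).im) := by
    intro z
    rw [dbar]
    set X := fderiv ℝ φ z 1
    set Y := fderiv ℝ φ z Complex.I
    rw [norm_smul, mul_pow, Complex.sq_norm, Complex.sq_norm, Complex.normSq_apply,
      Complex.normSq_apply]
    simp
    nlinarith [sq_nonneg X.re, sq_nonneg X.im]
  have hjI : Integrable fun z => (fderiv ℝ φ z 1).re * (fderiv ℝ φ z Complex.I).im -
        (fderiv ℝ φ z Complex.I).re * (fderiv ℝ φ z 1).im := by
    have a1 := hx.comp_clm Complex.reCLM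
    have a2 := hx.comp_clm Complex.imCLM
    have a3 := hy.comp_clm Complex.reCLM
    have a4 := hy.comp_clm Complex.imCLM
    exact (IsTest.integrable ⟨a1.smooth.mul a4.smooth, a1.supp.mul_right⟩).sub
      (IsTest.integrable ⟨a3.smooth.mul a2.smooth, a3.supp.mul_right⟩)
  have hmain : ∫ z, ‖fderiv ℝ φ z Complex.I‖ ^ 2 ≤ ∫ z, 4 * ‖dbar φ z‖ ^ 2 := by
    calc _ ≤ ∫ z, (4 * ‖dbar φ z‖ ^ 2 +
          2 * ((fderiv ℝ φ z 1).re * (fderiv ℝ φ z Complex.I).im -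
          (fderiv ℝ φ z Complex.I).re * (fderiv ℝ φ z 1).im)) :=
          integral_mono (hsq hy) (((hsq hd).const_mul 4).add (hjI.const_mul 2)) hpt
      _ = _ := by
          rw [integral_add ((hsq hd).const_mul 4) (hjI.const_mul 2),
            integral_const_mul 2, hjac]
          ring
  have hto : ∀ {p : ℂ → ℂ}, IsTest p →
      eLpNorm p 2 volume ^ 2 = ENNReal.ofReal (∫ z, ‖p z‖ ^ 2) := fun {p} hp => by
    rw [eLpNorm_two_sq, ofReal_integral_eq_lintegral_ofReal (hsq hp)
      (Filter.Eventually.of_forall fun z => by positivity)]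
    refine lintegral_congr fun z => ?_
    rw [ENNReal.ofReal_pow (norm_nonneg _), ofReal_norm]
  refine (ENNReal.pow_le_pow_left_iff two_ne_zero).1 ?_
  rw [mul_pow, hto hy, hto hd]
  calc _ ≤ ENNReal.ofReal (∫ z, 4 * ‖dbar φ z‖ ^ 2) := ENNReal.ofReal_le_ofReal hmain
    _ = _ := by
      rw [integral_const_mul, ENNReal.ofReal_mul (by norm_num)]
      norm_num

lemma eLpNorm_fderiv_le_dbar {n : ℕ} {φ : ℂ → Fin n → ℂ} (hφ : IsTest φ) :
    eLpNorm (fun z => fderiv ℝ φ z Complex.I) 2 volume ≤ 2 * n * eLpNorm (dbar φ) 2 volume := by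
  have hi : ∀ i, IsTest fun z => φ z i := fun i => hφ.comp_clm (ContinuousLinearMap.proj i)
  have hfd : ∀ i z e, fderiv ℝ (fun z => φ z i) z e = fderiv ℝ φ z e i := fun i z e =>
    hφ.fderiv_clm (ContinuousLinearMap.proj i) z e
  calc eLpNorm (fun z => fderiv ℝ φ z Complex.I) 2 volume
      ≤ eLpNorm (∑ i, fun z => ‖fderiv ℝ (fun z => φ z i) z Complex.I‖) 2 volume := by
        refine eLpNorm_mono fun z => ?_
        rw [Finset.sum_apply, Real.norm_of_nonneg (Finset.sum_nonneg fun i _ => norm_nonneg _)]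
        refine (pi_norm_le_iff_of_nonneg (Finset.sum_nonneg fun i _ => norm_nonneg _)).2
          fun i => ?_
        rw [← hfd]
        exact Finset.single_le_sum (f := fun i => ‖fderiv ℝ (fun z => φ z i) z Complex.I‖)
          (fun i _ => norm_nonneg _) (Finset.mem_univ i)
    _ ≤ ∑ i, eLpNorm (fun z => ‖fderiv ℝ (fun z => φ z i) z Complex.I‖) 2 volume :=
        eLpNorm_sum_le (fun i _ =>
          ((hi i).fderiv_apply Complex.I).smooth.continuous.norm.aestronglyMeasurable)
          (by norm_num)
    _ ≤ ∑ i : Fin n, 2 * eLpNorm (dbar φ) 2 volume := by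
        refine Finset.sum_le_sum fun i _ => ?_
        rw [eLpNorm_norm]
        refine (eLpNorm_fderiv_le_dbar_scalar (hi i)).trans ?_
        gcongr
        refine eLpNorm_mono fun z => ?_
        have : dbar (fun z => φ z i) z = dbar φ z i := by simp [dbar, hfd]
        rw [this]
        exact norm_le_pi_norm _ i
    _ = _ := by simp; ring

lemma enorm_cauchyT_le {n : ℕ} (f : ℂ → Fin n → ℂ) (z : ℂ) :
    ‖cauchyT f z‖ₑ ≤ ∫⁻ w : ℂ, ‖w⁻¹‖ₑ * ‖f (z - w)‖ₑ := by
  rw [cauchyT, enorm_smul]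
  have h1 : ‖(Real.pi⁻¹ : ℝ)‖ₑ ≤ 1 := by
    rw [← ofReal_norm, norm_inv, Real.norm_of_nonneg Real.pi_pos.le]
    refine ENNReal.ofReal_le_one.2 (inv_le_one_of_one_le₀ ?_)
    linarith [Real.pi_gt_three]
  calc _ ≤ 1 * ∫⁻ w : ℂ, ‖(w⁻¹ : ℂ) • f (z - w)‖ₑ := by
        gcongr
        exact enorm_integral_le_lintegral_enorm _
    _ = _ := by simp only [one_mul, enorm_smul]

lemma eLpNorm_cauchyT_le {n : ℕ} {f : ℂ → Fin n → ℂ} (hf : IsTest f)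
    (h3 : ∀ z, 3 < ‖z‖ → f z = 0) :
    eLpNorm (cauchyT f) 2 (volume.restrict (Metric.closedBall 0 4)) ≤
      ENNReal.ofReal (16 * Real.pi) * eLpNorm f 2 volume := by
  obtain ⟨hi, hv⟩ := radial_inside (s := 1) (R := 8) one_pos (by norm_num)
  set k : ℂ → ENNReal := (Metric.ball 0 8).indicator fun w => ‖w⁻¹‖ₑ with hk
  have hkm : Measurable k := Measurable.indicator (by fun_prop) measurableSet_ball
  have hkint : ∫⁻ w, k w = ENNReal.ofReal (16 * Real.pi) := by
    have : (16 * Real.pi) = 2 * Real.pi * ((8:ℝ) ^ (1:ℝ) / 1) := by norm_num; ring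
    rw [this, ← hv, ofReal_integral_eq_lintegral_ofReal hi]
    · refine lintegral_congr fun w => ?_
      by_cases hw : w ∈ Metric.ball (0:ℂ) 8
      · rw [hk, Set.indicator_of_mem hw, Set.indicator_of_mem hw, ← ofReal_norm, norm_inv]
        norm_num [Real.rpow_neg_one]
      · rw [hk, Set.indicator_of_notMem hw, Set.indicator_of_notMem hw, ENNReal.ofReal_zero]
    · exact Filter.Eventually.of_forall fun w => Set.indicator_nonneg (fun _ _ => by positivity) w
  rw [← hkint]
  refine eLpNorm_restrict_le_of_conv hkm hf.smooth.continuous.measurable.enorm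
    measurableSet_closedBall fun z hz => (enorm_cauchyT_le f z).trans (lintegral_mono fun w => ?_)
  by_cases hw : w ∈ Metric.ball (0:ℂ) 8
  · rw [hk, Set.indicator_of_mem hw]
  · have : f (z - w) = 0 := by
      apply h3
      have := norm_sub_norm_le w z
      simp at hw hz
      rw [norm_sub_rev] at this
      linarith
    simp [this]

lemma dbar_smul {n : ℕ} {η : ℂ → ℝ} {v : ℂ → Fin n → ℂ} {z : ℂ} (hη : DifferentiableAt ℝ η z)
    (hv : DifferentiableAt ℝ v z) :
    dbar (fun z => η z • v z) z = η z • dbar v z +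
      (2⁻¹ : ℝ) • (fderiv ℝ η z 1 • v z + Complex.I • fderiv ℝ η z Complex.I • v z) := by
  rw [dbar, dbar, fderiv_fun_smul hη hv]
  simp only [add_apply, smul_apply, ContinuousLinearMap.smulRight_apply, smul_add]
  rw [smul_comm Complex.I (η z), smul_comm (2⁻¹ : ℝ) (η z), smul_comm (2⁻¹ : ℝ) (η z)]
  abel

lemma exists_eLpNorm_fderiv_cauchyT_le (n : ℕ) : ∃ C : ℝ, 0 < C ∧ ∀ f : ℂ → Fin n → ℂ,
    IsTest f → (∀ z, 3 < ‖z‖ → f z = 0) →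
    eLpNorm (fun z => fderiv ℝ (cauchyT f) z Complex.I) 2
      (volume.restrict (Metric.closedBall 0 3)) ≤ ENNReal.ofReal C * eLpNorm f 2 volume := by
  let b : ContDiffBump (0:ℂ) := ⟨7/2, 4, by norm_num, by norm_num⟩
  have hb : IsTest (b : ℂ → ℝ) := ⟨b.contDiff, b.hasCompactSupport⟩
  obtain ⟨K, hK⟩ := hb.supp.fderiv ℝ |>.exists_bound_of_continuous
    (hb.smooth.continuous_fderiv (by simp))
  have hK0 : 0 ≤ K := (norm_nonneg _).trans (hK 0)
  refine ⟨2 * (n + 1) * (1 + K * (16 * Real.pi)), by positivity, fun f hf h3 => ?_⟩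
  have hT := cauchyT_contDiff hf.smooth hf.supp
  have hTd := hT.differentiable (by simp)
  set φ : ℂ → Fin n → ℂ := fun z => b z • cauchyT f z with hφ
  have hφt : IsTest φ := ⟨b.contDiff.smul hT, hb.supp.smul_right⟩
  have h1 : eLpNorm (fun z => fderiv ℝ (cauchyT f) z Complex.I) 2
      (volume.restrict (Metric.closedBall 0 3)) ≤
      eLpNorm (fun z => fderiv ℝ φ z Complex.I) 2 volume := by
    refine le_trans (le_of_eq (eLpNorm_congr_ae ?_)) (eLpNorm_mono_measure _ Measure.restrict_le_self)
    refine ae_restrict_of_forall_mem measurableSet_closedBall fun z hz => ?_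
    have : φ =ᶠ[nhds z] cauchyT f := by
      have hz' : z ∈ Metric.ball (0:ℂ) (7/2) := by
        simp at hz ⊢; linarith
      filter_upwards [Metric.isOpen_ball.mem_nhds hz'] with w hw
      simp [hφ, b.one_of_mem_closedBall (Metric.ball_subset_closedBall hw)]
    beta_reduce
    rw [this.fderiv_eq]
  have h2 : eLpNorm (dbar φ) 2 volume ≤
      eLpNorm f 2 volume + ENNReal.ofReal K * (ENNReal.ofReal (16 * Real.pi) * eLpNorm f 2 volume) := by
    set S : Set ℂ := Metric.closedBall 0 4
    have e1 : eLpNorm (dbar φ) 2 volume ≤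
        eLpNorm (fun z => ‖f z‖ + S.indicator (fun z => K * ‖cauchyT f z‖) z) 2 volume := by
      refine eLpNorm_mono fun z => ?_
      have hpos : 0 ≤ S.indicator (fun z => K * ‖cauchyT f z‖) z :=
        Set.indicator_nonneg (fun _ _ => by positivity) z
      rw [Real.norm_of_nonneg (by positivity), dbar_smul (hb.smooth.differentiable (by simp) z)
        (hTd z), dbar_cauchyT hf]
      refine (norm_add_le _ _).trans (add_le_add ?_ ?_)
      · rw [norm_smul, Real.norm_of_nonneg b.nonneg]
        exact mul_le_of_le_one_left (norm_nonneg _) b.le_one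
      · by_cases hz : z ∈ S
        · rw [Set.indicator_of_mem hz, norm_smul]
          have hle : ∀ e : ℂ, ‖e‖ = 1 → ‖fderiv ℝ b z e‖ ≤ K := fun e he => by
            have := (fderiv ℝ b z).le_opNorm e
            rw [he, mul_one] at this
            exact this.trans (hK z)
          have n1 := hle 1 (by simp)
          have n2 := hle Complex.I (by simp)
          calc _ ≤ ‖(2⁻¹:ℝ)‖ * (K * ‖cauchyT f z‖ + K * ‖cauchyT f z‖) := by
                gcongr
                refine (norm_add_le _ _).trans (add_le_add ?_ ?_)
                · rw [norm_smul]; gcongr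
                · rw [norm_smul, norm_smul, Complex.norm_I, one_mul]; gcongr
            _ = _ := by norm_num; ring
        · rw [Set.indicator_of_notMem hz]
          have : fderiv ℝ b z = 0 := by
            refine image_eq_zero_of_notMem_tsupport fun h => hz ?_
            have := tsupport_fderiv_subset ℝ h
            rwa [b.tsupport_eq] at this
          simp [this]
    have e2 : eLpNorm (S.indicator fun z => K * ‖cauchyT f z‖) 2 volume ≤
        ENNReal.ofReal K * (ENNReal.ofReal (16 * Real.pi) * eLpNorm f 2 volume) := by
      rw [eLpNorm_indicator_eq_eLpNorm_restrict measurableSet_closedBall]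
      calc _ = ENNReal.ofReal K * eLpNorm (cauchyT f) 2 (volume.restrict S) := by
            have := eLpNorm_const_smul K (fun z => ‖cauchyT f z‖) 2 (volume.restrict S)
            rw [eLpNorm_norm] at this
            rw [← Real.enorm_of_nonneg hK0]
            exact this
        _ ≤ _ := by gcongr; exact eLpNorm_cauchyT_le hf h3
    refine e1.trans ((eLpNorm_add_le hf.smooth.continuous.norm.aestronglyMeasurable
      ?_ (by norm_num)).trans (add_le_add (by rw [eLpNorm_norm]) e2))
    exact (hT.continuous.norm.const_mul K).aestronglyMeasurable.indicator measurableSet_closedBall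
  refine h1.trans ((eLpNorm_fderiv_le_dbar hφt).trans ?_)
  calc _ ≤ 2 * (n + 1 : ENNReal) * (eLpNorm f 2 volume + ENNReal.ofReal K *
        (ENNReal.ofReal (16 * Real.pi) * eLpNorm f 2 volume)) := by gcongr; exact le_self_add
    _ = _ := by
      have e1 : ENNReal.ofReal (2 * (n + 1) * (1 + K * (16 * Real.pi))) =
          2 * (n + 1) * (1 + ENNReal.ofReal K * ENNReal.ofReal (16 * Real.pi)) := by
        rw [ENNReal.ofReal_mul (by positivity), ENNReal.ofReal_add one_pos.le (by positivity),
          ENNReal.ofReal_mul hK0, ENNReal.ofReal_mul (by norm_num),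
          ENNReal.ofReal_add (by positivity) one_pos.le, ENNReal.ofReal_natCast]
        simp
      rw [e1]
      ring

end LTwo

section Taylor

lemma hasFDerivAt_of_taylor {F : Type*} [NormedAddCommGroup F] [NormedSpace ℝ F] {α ρ K : ℝ}
    (h0 : 0 < α) (hρ : 0 < ρ) {v : ℂ → F} {D : ℂ →L[ℝ] F} {z : ℂ}
    (h : ∀ t, ‖t‖ ≤ ρ → ‖v (z + t) - v z - D t‖ ≤ K * ‖t‖ ^ (1 + α)) : HasFDerivAt v D z := by
  rw [hasFDerivAt_iff_isLittleO_nhds_zero, Asymptotics.isLittleO_iff]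
  intro c hc
  have ht : Filter.Tendsto (fun t : ℂ => K * ‖t‖ ^ α) (nhds 0) (nhds 0) := by
    have : ContinuousAt (fun t : ℂ => K * ‖t‖ ^ α) 0 := by
      refine continuousAt_const.mul (ContinuousAt.rpow_const continuous_norm.continuousAt ?_)
      exact Or.inr h0.le
    simpa [ContinuousAt, Real.zero_rpow h0.ne'] using this
  filter_upwards [ht.eventually (gt_mem_nhds hc), Metric.closedBall_mem_nhds (0:ℂ) hρ] with t h1 h2
  rw [mem_closedBall_zero_iff] at h2
  refine (h t h2).trans ?_
  rcases eq_or_ne t 0 with rfl | hne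
  · simp [Real.zero_rpow (by linarith : (1 + α) ≠ 0)]
  · rw [Real.rpow_add (norm_pos_iff.2 hne), Real.rpow_one]
    nlinarith [norm_nonneg t]

variable {E : Type*} [NormedAddCommGroup E] [NormedSpace ℝ E] [NormedSpace ℂ E]
  [IsScalarTower ℝ ℂ E]

lemma cauchyT_eq_integral_sub (f : ℂ → E) (z : ℂ) :
    cauchyT f z = (Real.pi⁻¹ : ℝ) • ∫ w : ℂ, ((z - w)⁻¹ : ℂ) • f w := by
  rw [cauchyT, ← integral_sub_left_eq_self (fun w : ℂ => (w⁻¹ : ℂ) • f (z - w)) volume z]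
  simp

lemma integrable_sub_inv_smul {f : ℂ → E} (hf : IsTest f) (z : ℂ) :
    Integrable fun w : ℂ => ((z - w)⁻¹ : ℂ) • f w := by
  have := (integrable_cauchyT hf.smooth.continuous hf.supp z).comp_sub_left z
  simpa using this

lemma norm_taylor_kernel_le {t w : ℂ} (hw : w ≠ 0) (ht : w ≠ t) :
    ‖(t - w)⁻¹ + w⁻¹ + t * (w ^ 2)⁻¹‖ = ‖t‖ ^ 2 * (‖w‖ ^ (-2 : ℝ) * ‖t - w‖⁻¹) := by
  have h1 : t - w ≠ 0 := sub_ne_zero.2 ht.symm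
  have : (t - w)⁻¹ + w⁻¹ + t * (w ^ 2)⁻¹ = t ^ 2 * ((w ^ 2)⁻¹ * (t - w)⁻¹) := by
    field_simp; ring
  rw [this, norm_mul, norm_mul, norm_inv, norm_inv, norm_pow, norm_pow,
    Real.rpow_neg (norm_nonneg _)]
  norm_num

/-- Taylor expansion of the Cauchy transform at a point where the density vanishes. -/
lemma exists_taylor_cauchyT_of_eq_zero (E : Type*) [NormedAddCommGroup E] [NormedSpace ℝ E]
    [NormedSpace ℂ E] [IsScalarTower ℝ ℂ E] {α : ℝ} (h0 : 0 < α) (h1 : α < 1) :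
    ∃ C : ℝ, 0 < C ∧ ∀ g : ℂ → E, IsTest g → ∀ H : ℝ, 0 ≤ H →
      (∀ w, ‖w‖ ≤ 1 / 2 → ‖g w‖ ≤ H * ‖w‖ ^ α) →
      ∃ L : E, ‖L‖ ≤ C * (H + ∫ w, ‖g w‖) ∧ ∀ t : ℂ, ‖t‖ ≤ 1 / 4 →
        ‖cauchyT g t - cauchyT g 0 - t • L‖ ≤ C * (H + ∫ w, ‖g w‖) * ‖t‖ ^ (1 + α) := by
  obtain ⟨C0, hC0, hker⟩ := exists_kernel_majorant h0 h1
  obtain ⟨hri, hrv⟩ := radial_inside (s := α) (R := 1) h0 one_pos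
  set C1 := 2 * Real.pi * ((1:ℝ) ^ α / α) with hC1
  have hC1p : 0 < C1 := by positivity
  refine ⟨C0 + C1 + 16, by positivity, fun g hg H hH hbd => ?_⟩
  have hgi := hg.integrable.norm
  have hgn : 0 ≤ ∫ w, ‖g w‖ := integral_nonneg fun _ => norm_nonneg _
  have hpi : Real.pi⁻¹ ≤ 1 := inv_le_one_of_one_le₀ (by linarith [Real.pi_gt_three])
  have hpi0 : 0 ≤ Real.pi⁻¹ := by positivity
  have bd3 : ∀ w, ‖((w ^ 2)⁻¹ : ℂ) • g w‖ ≤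
      H * (Metric.ball 0 1).indicator (fun w : ℂ => ‖w‖ ^ (α - 2)) w + 4 * ‖g w‖ := by
    intro w
    rcases eq_or_ne w 0 with rfl | hw
    · have : 0 ≤ (Metric.ball 0 1).indicator (fun w : ℂ => ‖w‖ ^ (α - 2)) 0 :=
        Set.indicator_nonneg (fun _ _ => by positivity) _
      simp only [ne_eq, OfNat.ofNat_ne_zero, not_false_eq_true, zero_pow, inv_zero, zero_smul,
        norm_zero]
      positivity
    have hwp : 0 < ‖w‖ := norm_pos_iff.2 hw
    rw [norm_smul, norm_inv, norm_pow]
    by_cases h : ‖w‖ ≤ 1 / 2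
    · rw [Set.indicator_of_mem (by simp; linarith)]
      have : (‖w‖ ^ 2)⁻¹ * (H * ‖w‖ ^ α) = H * ‖w‖ ^ (α - 2) := by
        rw [Real.rpow_sub hwp]; norm_num; ring
      calc _ ≤ (‖w‖ ^ 2)⁻¹ * (H * ‖w‖ ^ α) := by gcongr; exact hbd w h
        _ ≤ _ := by rw [this]; linarith [norm_nonneg (g w)]
    · push Not at h
      have hle : (‖w‖ ^ 2)⁻¹ ≤ 4 := by
        rw [inv_le_comm₀ (by positivity) (by norm_num)]; nlinarith
      have : 0 ≤ (Metric.ball 0 1).indicator (fun w : ℂ => ‖w‖ ^ (α - 2)) w :=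
        Set.indicator_nonneg (fun _ _ => by positivity) _
      have := mul_nonneg hH this
      nlinarith [mul_le_mul_of_nonneg_right hle (norm_nonneg (g w))]
  have hbi : Integrable fun w => H * (Metric.ball 0 1).indicator (fun w : ℂ => ‖w‖ ^ (α - 2)) w
      + 4 * ‖g w‖ := (hri.const_mul H).add (hgi.const_mul 4)
  have hi3 : Integrable fun w : ℂ => ((w ^ 2)⁻¹ : ℂ) • g w := by
    refine hbi.mono' ?_ (Filter.Eventually.of_forall bd3)
    exact (by fun_prop : Measurable fun w : ℂ => ((w ^ 2)⁻¹ : ℂ)).aestronglyMeasurable.smul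
      hg.smooth.continuous.aestronglyMeasurable
  refine ⟨-((Real.pi⁻¹ : ℝ) • ∫ w : ℂ, ((w ^ 2)⁻¹ : ℂ) • g w), ?_, fun t ht => ?_⟩
  · rw [norm_neg, norm_smul, Real.norm_of_nonneg hpi0]
    calc _ ≤ 1 * ∫ w, (H * (Metric.ball 0 1).indicator (fun w : ℂ => ‖w‖ ^ (α - 2)) w
            + 4 * ‖g w‖) := by
          gcongr
          exact norm_integral_le_of_norm_le hbi (Filter.Eventually.of_forall bd3)
      _ = C1 * H + 4 * ∫ w, ‖g w‖ := by
          rw [integral_add (hri.const_mul H) (hgi.const_mul 4), integral_const_mul,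
            integral_const_mul, hrv]
          ring
      _ ≤ _ := by nlinarith [mul_nonneg hC0.le hH, mul_nonneg hC0.le hgn, mul_nonneg hC1p.le hgn]
  · rcases eq_or_ne t 0 with rfl | htne
    · simp [Real.zero_rpow (by linarith : (1 + α) ≠ 0)]
    have htp : 0 < ‖t‖ := norm_pos_iff.2 htne
    obtain ⟨G, hGi, hGb, hGv⟩ := hker t htne
    have hG0 : ∀ w, 0 ≤ G w := fun w => le_trans (by positivity) (hGb w)
    have hid : cauchyT g t - cauchyT g 0 - t • -((Real.pi⁻¹ : ℝ) • ∫ w : ℂ, ((w ^ 2)⁻¹ : ℂ) • g w)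
        = (Real.pi⁻¹ : ℝ) • ∫ w : ℂ, ((t - w)⁻¹ + w⁻¹ + t * (w ^ 2)⁻¹ : ℂ) • g w := by
      have i1 := integrable_sub_inv_smul hg t
      have i2 := integrable_sub_inv_smul hg 0
      rw [cauchyT_eq_integral_sub, cauchyT_eq_integral_sub]
      have : ∀ w : ℂ, ((t - w)⁻¹ + w⁻¹ + t * (w ^ 2)⁻¹ : ℂ) • g w =
          ((t - w)⁻¹ : ℂ) • g w - ((0 - w)⁻¹ : ℂ) • g w + t • ((w ^ 2)⁻¹ : ℂ) • g w := by
        intro w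
        rw [add_smul, add_smul, mul_smul, zero_sub, inv_neg, neg_smul, sub_neg_eq_add]
      simp_rw [this]
      rw [integral_add (f := fun w : ℂ => ((t - w)⁻¹ : ℂ) • g w - ((0 - w)⁻¹ : ℂ) • g w)
        (g := fun w : ℂ => t • ((w ^ 2)⁻¹ : ℂ) • g w) (i1.sub i2) (hi3.smul t), integral_sub i1 i2, integral_smul, smul_add,
        smul_sub, smul_neg, smul_comm t, sub_neg_eq_add]
    rw [hid, norm_smul, Real.norm_of_nonneg hpi0]
    have hbi2 : Integrable fun w => ‖t‖ ^ 2 * (H * G w + 16 * ‖g w‖) :=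
      ((hGi.const_mul H).add (hgi.const_mul 16)).const_mul _
    have hbd2 : ∀ᵐ w : ℂ, ‖((t - w)⁻¹ + w⁻¹ + t * (w ^ 2)⁻¹ : ℂ) • g w‖ ≤
        ‖t‖ ^ 2 * (H * G w + 16 * ‖g w‖) := by
      have e1 : ∀ᵐ w : ℂ, w ≠ 0 := by simp [ae_iff]
      have e2 : ∀ᵐ w : ℂ, w ≠ t := by simp [ae_iff]
      filter_upwards [e1, e2] with w hw hwt
      have hwp : 0 < ‖w‖ := norm_pos_iff.2 hw
      rw [norm_smul, norm_taylor_kernel_le hw hwt, mul_assoc]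
      gcongr
      by_cases h : ‖w‖ ≤ 1 / 2
      · calc ‖w‖ ^ (-2:ℝ) * ‖t - w‖⁻¹ * ‖g w‖
            ≤ ‖w‖ ^ (-2:ℝ) * ‖t - w‖⁻¹ * (H * ‖w‖ ^ α) := by gcongr; exact hbd w h
          _ = H * (‖w‖ ^ (α - 2) * ‖t - w‖⁻¹) := by
              rw [show α - 2 = -2 + α by ring, Real.rpow_add hwp]; ring
          _ ≤ H * G w := by gcongr; exact hGb w
          _ ≤ _ := by linarith [norm_nonneg (g w)]
      · push Not at h
        have hle1 : ‖w‖ ^ (-2:ℝ) ≤ 4 := by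
          rw [Real.rpow_neg hwp.le, inv_le_comm₀ (by positivity) (by norm_num)]
          norm_num; nlinarith
        have hle2 : ‖t - w‖⁻¹ ≤ 4 := by
          have := norm_sub_norm_le w t
          rw [norm_sub_rev] at this
          rw [inv_le_comm₀ (by linarith) (by norm_num)]; linarith
        calc ‖w‖ ^ (-2:ℝ) * ‖t - w‖⁻¹ * ‖g w‖ ≤ 4 * 4 * ‖g w‖ := by gcongr
          _ ≤ _ := by linarith [mul_nonneg hH (hG0 w)]
    calc _ ≤ 1 * ∫ w, ‖t‖ ^ 2 * (H * G w + 16 * ‖g w‖) := by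
          gcongr
          exact norm_integral_le_of_norm_le hbi2 hbd2
      _ = ‖t‖ ^ 2 * (H * (∫ w, G w) + 16 * ∫ w, ‖g w‖) := by
          rw [one_mul, integral_const_mul, integral_add (hGi.const_mul H) (hgi.const_mul 16),
            integral_const_mul, integral_const_mul]
      _ ≤ ‖t‖ ^ 2 * (H * (C0 * ‖t‖ ^ (α - 1)) + 16 * ((∫ w, ‖g w‖) * ‖t‖ ^ (α - 1))) := by
          gcongr
          exact le_mul_of_one_le_right hgn
            (Real.one_le_rpow_of_pos_of_le_one_of_nonpos htp (by linarith) (by linarith))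
      _ = (C0 * H + 16 * ∫ w, ‖g w‖) * ‖t‖ ^ (1 + α) := by
          have : ‖t‖ ^ (1 + α) = ‖t‖ ^ 2 * ‖t‖ ^ (α - 1) := by
            rw [← Real.rpow_natCast, ← Real.rpow_add htp]; norm_num; ring_nf
          rw [this]; ring
      _ ≤ _ := by
          gcongr
          nlinarith [mul_nonneg hC0.le hH, mul_nonneg hC0.le hgn, mul_nonneg hC1p.le hgn,
            mul_nonneg hC1p.le hH]

lemma norm_cauchyT_le (f : ℂ → E) (hfi : Integrable f) {z : ℂ} {B : ℝ}
    (hB : ∀ w, ‖w‖ ≤ 1 → ‖f (z + w)‖ ≤ B) :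
    ‖cauchyT f z‖ ≤ 2 * Real.pi * B + ∫ w, ‖f w‖ := by
  have hB0 : 0 ≤ B := (norm_nonneg _).trans (hB 0 (by simp))
  obtain ⟨hri, hrv⟩ := radial_inside (s := 1) (R := 1) one_pos one_pos
  have hpi : Real.pi⁻¹ ≤ 1 := inv_le_one_of_one_le₀ (by linarith [Real.pi_gt_three])
  have hpi0 : 0 ≤ Real.pi⁻¹ := by positivity
  have hfi2 : Integrable fun w => ‖f (z - w)‖ := (hfi.comp_sub_left z).norm
  have hbi := (hri.const_mul B).add hfi2
  rw [cauchyT, norm_smul, Real.norm_of_nonneg hpi0]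
  calc _ ≤ 1 * ∫ w, (B * (Metric.ball 0 1).indicator (fun w : ℂ => ‖w‖ ^ ((1:ℝ) - 2)) w
          + ‖f (z - w)‖) := by
        gcongr
        refine norm_integral_le_of_norm_le hbi (Filter.Eventually.of_forall fun w => ?_)
        rw [norm_smul, norm_inv]
        by_cases h : ‖w‖ < 1
        · rw [Set.indicator_of_mem (by simpa using h)]
          have e : ‖w‖ ^ ((1:ℝ) - 2) = ‖w‖⁻¹ := by norm_num [Real.rpow_neg_one]
          rw [e, mul_comm]
          have := hB (-w) (by rw [norm_neg]; exact h.le)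
          rw [← sub_eq_add_neg] at this
          have := mul_le_mul_of_nonneg_right this (inv_nonneg.2 (norm_nonneg w))
          linarith [norm_nonneg (f (z - w))]
        · rw [Set.indicator_of_notMem (by simpa using h)]
          push Not at h
          have := mul_le_mul_of_nonneg_right (inv_le_one_of_one_le₀ h) (norm_nonneg (f (z - w)))
          linarith
    _ = _ := by
        rw [one_mul, integral_add (hri.const_mul B) hfi2, integral_const_mul, hrv,
          integral_sub_left_eq_self (fun w => ‖f w‖)]
        norm_num; ring

/-- A compactly supported primitive of the constant one near the origin, for `∂̄`. -/
lemma exists_local_conj : ∃ η : ℂ → ℂ, IsTest η ∧ ∀ w, ‖w‖ ≤ 1 / 2 →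
    η w = (starRingEnd ℂ) w ∧ dbar η w = 1 := by
  let b : ContDiffBump (0:ℂ) := ⟨3 / 4, 1, by norm_num, by norm_num⟩
  have hconj : ContDiff ℝ ∞ (fun w : ℂ => (starRingEnd ℂ) w) := Complex.conjCLE.contDiff
  refine ⟨fun w => b w • (starRingEnd ℂ) w, ⟨b.contDiff.smul hconj,
    b.hasCompactSupport.smul_right⟩, fun w hw => ?_⟩
  have hmem : w ∈ Metric.ball (0:ℂ) (3 / 4) := by simp; linarith
  have hev : (fun w => b w • (starRingEnd ℂ) w) =ᶠ[nhds w] fun w => Complex.conjCLE w := by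
    filter_upwards [Metric.isOpen_ball.mem_nhds hmem] with x hx
    simp [b.one_of_mem_closedBall (Metric.ball_subset_closedBall hx)]
  refine ⟨hev.self_of_nhds, ?_⟩
  rw [dbar, hev.fderiv_eq, (Complex.conjCLE.hasFDerivAt (x := w)).fderiv]
  simp
  norm_num

lemma exists_taylor_cauchyT_unit (E : Type*) [NormedAddCommGroup E] [NormedSpace ℝ E]
    [NormedSpace ℂ E] [IsScalarTower ℝ ℂ E] [CompleteSpace E] {α : ℝ} (h0 : 0 < α) (h1 : α < 1) :
    ∃ C : ℝ, 0 < C ∧ ∀ f : ℂ → E, IsTest f → ∀ H : ℝ,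
      (∀ w, ‖w‖ ≤ 1 → ‖f w - f 0‖ ≤ H * ‖w‖ ^ α) →
      ‖cauchyT f 0‖ ≤ C * (H + ‖f 0‖ + ∫ w, ‖f w‖) ∧
      ‖fderiv ℝ (cauchyT f) 0‖ ≤ C * (H + ‖f 0‖ + ∫ w, ‖f w‖) ∧
      ∀ t : ℂ, ‖t‖ ≤ 1 / 4 →
        ‖cauchyT f t - cauchyT f 0 - fderiv ℝ (cauchyT f) 0 t‖ ≤
          C * (H + ‖f 0‖ + ∫ w, ‖f w‖) * ‖t‖ ^ (1 + α) := by
  obtain ⟨C, hC, hT⟩ := exists_taylor_cauchyT_of_eq_zero E h0 h1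
  obtain ⟨η, hη, hηl⟩ := exists_local_conj
  set K := ∫ w, ‖dbar η w‖ with hK
  have hK0 : 0 ≤ K := integral_nonneg fun _ => norm_nonneg _
  refine ⟨(C + 1) * (K + 1) + 8, by positivity, fun f hf H hH => ?_⟩
  have hH0 : 0 ≤ H := by simpa using (norm_nonneg _).trans (hH 1 (by simp))
  have hfn : 0 ≤ ∫ w, ‖f w‖ := integral_nonneg fun _ => norm_nonneg _
  have hf0 := norm_nonneg (f 0)
  set S := H + ‖f 0‖ + ∫ w, ‖f w‖ with hS
  have hS0 : 0 ≤ S := by positivity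
  set V : ℂ → E := fun w => η w • f 0 with hV
  have hVt : IsTest V := ⟨hη.smooth.smul contDiff_const, hη.supp.smul_right⟩
  have hVd : ∀ w, dbar V w = dbar η w • f 0 := by
    intro w
    have hd := hη.smooth.differentiable (by simp) w
    rw [dbar, dbar, hV, fderiv_smul_const hd]
    simp only [ContinuousLinearMap.smulRight_apply, smul_assoc, add_smul]
  have hVdt : IsTest (dbar V) := hVt.dbar
  set g : ℂ → E := fun w => f w - dbar V w with hg
  have hgt : IsTest g := ⟨hf.smooth.sub hVdt.smooth, hf.supp.sub hVdt.supp⟩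
  have hTf : ∀ z, cauchyT f z = cauchyT g z + η z • f 0 := by
    intro z
    rw [hg, cauchyT_sub hf hVdt, cauchyT_dbar hVt]
    simp [hV]
  have hgb : ∀ w, ‖w‖ ≤ 1 / 2 → ‖g w‖ ≤ H * ‖w‖ ^ α := by
    intro w hw
    simp only [hg, hVd, (hηl w hw).2, one_smul]
    exact hH w (by linarith)
  have hgi : ∫ w, ‖g w‖ ≤ (∫ w, ‖f w‖) + K * ‖f 0‖ := by
    rw [hK, ← integral_mul_const, ← integral_add hf.integrable.norm
      (hη.dbar.integrable.norm.mul_const _)]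
    refine integral_mono hgt.integrable.norm
      (hf.integrable.norm.add (hη.dbar.integrable.norm.mul_const _)) fun w => ?_
    simp only [hg, hVd]
    refine (norm_sub_le _ _).trans ?_
    rw [norm_smul]
  have hSg : H + ∫ w, ‖g w‖ ≤ (K + 1) * S := by
    rw [hS]; nlinarith [mul_nonneg hK0 hH0, mul_nonneg hK0 hfn]
  obtain ⟨L, hL, hLt⟩ := hT g hgt H hH0 hgb
  set D : ℂ →L[ℝ] E := (ContinuousLinearMap.toSpanSingleton ℂ L).restrictScalars ℝ +
    ((ContinuousLinearMap.toSpanSingleton ℂ (f 0)).restrictScalars ℝ).comp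
      Complex.conjCLE.toContinuousLinearMap with hD
  have hDa : ∀ t, D t = t • L + (starRingEnd ℂ) t • f 0 := fun t => by simp [hD]
  have hη0 : η 0 = 0 := by simpa using (hηl 0 (by norm_num)).1
  have hTay : ∀ t : ℂ, ‖t‖ ≤ 1 / 4 → ‖cauchyT f (0 + t) - cauchyT f 0 - D t‖ ≤
      ((C + 1) * (K + 1) + 8) * S * ‖t‖ ^ (1 + α) := by
    intro t ht
    rw [zero_add, hTf, hTf, hDa, (hηl t (by linarith)).1, hη0, zero_smul, add_zero]
    have : cauchyT g t + (starRingEnd ℂ) t • f 0 - cauchyT g 0 -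
        (t • L + (starRingEnd ℂ) t • f 0) = cauchyT g t - cauchyT g 0 - t • L := by abel
    rw [this]
    refine (hLt t ht).trans ?_
    refine mul_le_mul_of_nonneg_right ?_ (by positivity)
    calc C * (H + ∫ w, ‖g w‖) ≤ C * ((K + 1) * S) := by gcongr
      _ ≤ _ := by nlinarith [mul_nonneg hK0 hS0]
  have hfd : fderiv ℝ (cauchyT f) 0 = D :=
    (hasFDerivAt_of_taylor h0 (by norm_num) hTay).fderiv
  refine ⟨?_, ?_, fun t ht => ?_⟩
  · refine (norm_cauchyT_le f hf.integrable (B := H + ‖f 0‖) fun w hw => ?_).trans ?_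
    · rw [zero_add]
      have := norm_sub_norm_le (f w) (f 0)
      have h2 : H * ‖w‖ ^ α ≤ H * 1 := by
        gcongr; exact Real.rpow_le_one (norm_nonneg _) hw h0.le
      linarith [hH w hw]
    · have : 2 * Real.pi * (H + ‖f 0‖) ≤ 8 * (H + ‖f 0‖) := by
        gcongr; linarith [Real.pi_lt_four]
      have h3 : 0 ≤ (C + 1) * (K + 1) * S := by positivity
      rw [hS] at h3 ⊢
      nlinarith
  · rw [hfd]
    refine ContinuousLinearMap.opNorm_le_bound _ (by positivity) fun t => ?_
    rw [hDa]
    refine (norm_add_le _ _).trans ?_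
    rw [norm_smul, norm_smul, RCLike.norm_conj, mul_comm _ ‖t‖, ← mul_add]
    gcongr
    calc ‖L‖ + ‖f 0‖ ≤ C * ((K + 1) * S) + S := by
          refine add_le_add (hL.trans (by gcongr)) (by rw [hS]; linarith)
      _ ≤ _ := by nlinarith [mul_nonneg hK0 hS0]
  · rw [hfd]
    simpa using hTay t ht

lemma cauchyT_comp_affine (f : ℂ → E) (z₀ : ℂ) {ρ : ℝ} (hρ : 0 < ρ) (t : ℂ) :
    cauchyT (fun w => f (z₀ + ρ * w)) t = ρ⁻¹ • cauchyT f (z₀ + ρ * t) := by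
  have hco : ∀ (x : ℂ), ρ • x = (ρ : ℂ) * x := fun x => Complex.real_smul
  have hρ' : (ρ : ℂ) ≠ 0 := by exact_mod_cast hρ.ne'
  rw [cauchyT, cauchyT, smul_comm ρ⁻¹]
  congr 1
  have := Measure.integral_comp_smul (μ := volume)
    (fun w : ℂ => (w⁻¹ : ℂ) • f (z₀ + ρ * t - w)) ρ
  rw [Complex.finrank_real_complex, abs_of_pos (by positivity)] at this
  have h2 : ρ⁻¹ • ∫ w : ℂ, (w⁻¹ : ℂ) • f (z₀ + ρ * t - w) =
      ρ • ∫ w : ℂ, ((ρ • w)⁻¹ : ℂ) • f (z₀ + ρ * t - ρ • w) := by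
    rw [this, smul_smul]
    congr 1
    field_simp
  rw [h2, ← integral_smul]
  refine integral_congr_ae (Filter.Eventually.of_forall fun w => ?_)
  beta_reduce
  rw [hco, ← smul_assoc ρ, hco, mul_inv, mul_inv_cancel_left₀ hρ', mul_sub, add_sub_assoc]

lemma IsTest.comp_affine {F : Type*} [NormedAddCommGroup F] [NormedSpace ℝ F] {f : ℂ → F}
    (hf : IsTest f) (z₀ : ℂ) {ρ : ℝ} (hρ : 0 < ρ) : IsTest fun w : ℂ => f (z₀ + ρ * w) := by
  have hρ' : (ρ : ℂ) ≠ 0 := by exact_mod_cast hρ.ne'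
  refine ⟨hf.smooth.comp (contDiff_const.add (contDiff_const.mul contDiff_id)), ?_⟩
  exact hf.supp.comp_homeomorph ((Homeomorph.mulLeft₀ (ρ : ℂ) hρ').trans (Homeomorph.addLeft z₀))

/-- Size and first-order Taylor expansion of the Cauchy transform, at scale `ρ`. -/
lemma exists_taylor_cauchyT (E : Type*) [NormedAddCommGroup E] [NormedSpace ℝ E]
    [NormedSpace ℂ E] [IsScalarTower ℝ ℂ E] [CompleteSpace E] {α : ℝ} (h0 : 0 < α) (h1 : α < 1) :
    ∃ C : ℝ, 0 < C ∧ ∀ f : ℂ → E, IsTest f → ∀ (z : ℂ) (ρ H : ℝ), 0 < ρ →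
      (∀ s, ‖s‖ ≤ ρ → ‖f (z + s) - f z‖ ≤ H * (‖s‖ / ρ) ^ α) →
      ‖cauchyT f z‖ ≤ ρ * (C * (H + ‖f z‖ + (ρ ^ 2)⁻¹ * ∫ w, ‖f w‖)) ∧
      ‖fderiv ℝ (cauchyT f) z‖ ≤ C * (H + ‖f z‖ + (ρ ^ 2)⁻¹ * ∫ w, ‖f w‖) ∧
      ∀ s : ℂ, ‖s‖ ≤ ρ / 4 →
        ‖cauchyT f (z + s) - cauchyT f z - fderiv ℝ (cauchyT f) z s‖ ≤
          C * (H + ‖f z‖ + (ρ ^ 2)⁻¹ * ∫ w, ‖f w‖) * ‖s‖ * (‖s‖ / ρ) ^ α := by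
  obtain ⟨C, hC, hT⟩ := exists_taylor_cauchyT_unit E h0 h1
  refine ⟨C, hC, fun f hf z ρ H hρ hH => ?_⟩
  have hρ' : (ρ : ℂ) ≠ 0 := by exact_mod_cast hρ.ne'
  have hnρ : ‖(ρ : ℂ)‖ = ρ := by rw [Complex.norm_real, Real.norm_of_nonneg hρ.le]
  have key := hT _ (hf.comp_affine z hρ) H (fun w hw => by
    have := hH (ρ * w) (by rw [norm_mul, hnρ]; nlinarith)
    rw [norm_mul, hnρ, mul_div_cancel_left₀ _ hρ.ne'] at this
    simpa using this)
  have hinteg : ∫ w : ℂ, ‖f (z + ρ * w)‖ = (ρ ^ 2)⁻¹ * ∫ w, ‖f w‖ := by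
    have := Measure.integral_comp_smul (μ := volume) (fun w : ℂ => ‖f (z + w)‖) ρ
    rw [Complex.finrank_real_complex, abs_of_pos (by positivity),
      integral_add_left_eq_self (fun w => ‖f w‖)] at this
    simpa using this
  have hTd : Differentiable ℝ (cauchyT f) :=
    (cauchyT_contDiff hf.smooth hf.supp).differentiable (by simp)
  have hfun : cauchyT (fun w : ℂ => f (z + ρ * w)) = fun t => ρ⁻¹ • cauchyT f (z + ρ * t) :=
    funext fun t => cauchyT_comp_affine f z hρ t
  have hfd : fderiv ℝ (cauchyT fun w : ℂ => f (z + ρ * w)) 0 = fderiv ℝ (cauchyT f) z := by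
    rw [hfun]
    have hg : HasFDerivAt (fun t : ℂ => z + ρ * t) (ρ • ContinuousLinearMap.id ℝ ℂ) 0 := by
      have := ((ContinuousLinearMap.id ℝ ℂ).hasFDerivAt (x := 0)).const_smul ρ |>.const_add z
      simpa using this
    have hz : HasFDerivAt (cauchyT f) (fderiv ℝ (cauchyT f) z) (z + ρ * 0) := by
      simpa using (hTd z).hasFDerivAt
    have := ((hz.comp (0:ℂ) hg).const_smul ρ⁻¹).fderiv
    change fderiv ℝ (ρ⁻¹ • (cauchyT f ∘ fun t : ℂ => z + ρ * t)) 0 = _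
    rw [this]
    ext
    simp [smul_smul, inv_mul_cancel₀ hρ.ne']
  simp only [hfd, hinteg, mul_zero, add_zero] at key
  simp only [hfun, mul_zero, add_zero] at key
  obtain ⟨k1, k2, k3⟩ := key
  have hri : 0 < ρ⁻¹ := by positivity
  refine ⟨?_, k2, fun s hs => ?_⟩
  · rw [norm_smul, Real.norm_of_nonneg hri.le, inv_mul_le_iff₀ hρ] at k1
    exact k1
  · have := k3 (s / ρ) (by rw [norm_div, hnρ, div_le_iff₀ hρ]; linarith)
    rw [mul_div_cancel₀ _ hρ'] at this
    have e : fderiv ℝ (cauchyT f) z (s / ρ) = ρ⁻¹ • fderiv ℝ (cauchyT f) z s := by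
      rw [← map_smul, Complex.real_smul, Complex.ofReal_inv, div_eq_inv_mul]
    rw [e, ← smul_sub, ← smul_sub, norm_smul, Real.norm_of_nonneg hri.le, inv_mul_le_iff₀ hρ,
      norm_div, hnρ] at this
    refine this.trans (le_of_eq ?_)
    rcases eq_or_ne s 0 with rfl | hne
    · simp [Real.zero_rpow (by linarith : (1 + α) ≠ 0)]
    · have hsp : 0 < ‖s‖ / ρ := div_pos (norm_pos_iff.2 hne) hρ
      rw [Real.rpow_add hsp, Real.rpow_one]
      field_simp

end Taylor

section WeightedHolder

/-- Interior Hölder bound on the unit disk, weighted by the distance to the boundary. -/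
def InnerBd {F : Type*} [NormedAddCommGroup F] (α : ℝ) (f : ℂ → F) (B : ℝ) : Prop :=
  ∀ z, ‖z‖ < 1 → (1 - ‖z‖) ^ 2 * ‖f z‖ ≤ B ∧ ∀ s, ‖s‖ ≤ (1 - ‖z‖) / 2 →
    (1 - ‖z‖) ^ 2 * ‖f (z + s) - f z‖ ≤ B * (‖s‖ / (1 - ‖z‖)) ^ α

variable {F : Type*} [NormedAddCommGroup F] {α : ℝ}

lemma InnerBd.nonneg {f : ℂ → F} {B : ℝ} (h : InnerBd α f B) : 0 ≤ B :=
  le_trans (by positivity) (h 0 (by simp)).1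

lemma InnerBd.mono {f : ℂ → F} {B B' : ℝ} (h : InnerBd α f B) (hB : B ≤ B') : InnerBd α f B' :=
  fun z hz => ⟨(h z hz).1.trans hB, fun s hs => ((h z hz).2 s hs).trans (by
    gcongr)⟩

lemma InnerBd.add {f g : ℂ → F} {B B' : ℝ} (hf : InnerBd α f B) (hg : InnerBd α g B') :
    InnerBd α (fun z => f z + g z) (B + B') := by
  intro z hz
  refine ⟨?_, fun s hs => ?_⟩
  · have := mul_le_mul_of_nonneg_left (norm_add_le (f z) (g z)) (sq_nonneg (1 - ‖z‖))
    linarith [(hf z hz).1, (hg z hz).1]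
  · have e : f (z + s) + g (z + s) - (f z + g z) = (f (z + s) - f z) + (g (z + s) - g z) := by abel
    have := mul_le_mul_of_nonneg_left (norm_add_le (f (z + s) - f z) (g (z + s) - g z))
      (sq_nonneg (1 - ‖z‖))
    beta_reduce
    rw [e]
    linarith [(hf z hz).2 s hs, (hg z hz).2 s hs]

lemma innerBd_of_eq_zero {f : ℂ → F} (h : ∀ z, ‖z‖ < 1 → f z = 0) {B : ℝ} (hB : 0 ≤ B) :
    InnerBd α f B := by
  intro z hz
  have hp : 0 < 1 - ‖z‖ := by linarith
  refine ⟨by rw [h z hz]; simpa using hB, fun s hs => ?_⟩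
  rw [h z hz, h (z + s) (by linarith [norm_add_le z s])]
  simp only [sub_self, norm_zero, mul_zero]
  positivity

lemma InnerBd.clm_apply {G : Type*} [NormedAddCommGroup G] [NormedSpace ℝ G] {f : ℂ → (ℂ →L[ℝ] G)}
    {B : ℝ} (h : InnerBd α f B) {e : ℂ} (he : ‖e‖ = 1) : InnerBd α (fun z => f z e) B := by
  have hle : ∀ L : ℂ →L[ℝ] G, ‖L e‖ ≤ ‖L‖ := fun L => by simpa [he] using L.le_opNorm e
  refine fun z hz => ⟨le_trans (by gcongr; exact hle _) (h z hz).1, fun s hs => ?_⟩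
  refine le_trans ?_ ((h z hz).2 s hs)
  gcongr
  exact hle (f (z + s) - f z)

lemma InnerBd.mul {E G : Type*} [NormedAddCommGroup E] [NormedSpace ℝ E] [NormedAddCommGroup G]
    [NormedSpace ℝ G] (h0 : 0 < α) {f : ℂ → E} {B κ : ℝ} {Q : ℂ → (E →L[ℝ] G)}
    (hQ : ∀ z, ‖Q z‖ ≤ κ) (hQα : ∀ z z', ‖Q z - Q z'‖ ≤ κ * ‖z - z'‖ ^ α) (h : InnerBd α f B) :
    InnerBd α (fun z => Q z (f z)) (2 * κ * B) := by
  intro z hz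
  have hκ : 0 ≤ κ := (norm_nonneg _).trans (hQ 0)
  have hB := h.nonneg
  obtain ⟨h1, h2⟩ := h z hz
  have hp : 0 < 1 - ‖z‖ := by linarith
  set d := 1 - ‖z‖ with hd
  have hd1 : d ≤ 1 := by linarith [norm_nonneg z]
  have hmul : ∀ (L : E →L[ℝ] G) (x : E) (a b : ℝ), ‖L‖ ≤ a → d ^ 2 * ‖x‖ ≤ b → 0 ≤ a →
      d ^ 2 * ‖L x‖ ≤ a * b := fun L x a b ha hb ha0 => by
    calc d ^ 2 * ‖L x‖ ≤ d ^ 2 * (‖L‖ * ‖x‖) := by gcongr; exact L.le_opNorm x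
      _ = ‖L‖ * (d ^ 2 * ‖x‖) := by ring
      _ ≤ _ := by gcongr
  refine ⟨?_, fun s hs => ?_⟩
  · refine (hmul _ _ _ _ (hQ z) h1 hκ).trans ?_
    nlinarith [mul_nonneg hκ hB]
  · have e : Q (z + s) (f (z + s)) - Q z (f z) =
        Q (z + s) (f (z + s) - f z) + (Q (z + s) - Q z) (f z) := by simp
    beta_reduce
    rw [e]
    have a1 := hmul _ _ _ _ (hQ (z + s)) (h2 s hs) hκ
    have a2 := hmul (Q (z + s) - Q z) (f z) _ _ (hQα (z + s) z) h1 (by positivity)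
    rw [add_sub_cancel_left] at a2
    have a3 : ‖s‖ ^ α ≤ (‖s‖ / d) ^ α := by
      gcongr
      rw [le_div_iff₀ hp]; nlinarith [norm_nonneg s]
    have a4 := mul_le_mul_of_nonneg_left a3 (mul_nonneg hκ hB)
    have a5 := mul_le_mul_of_nonneg_left (norm_add_le (Q (z + s) (f (z + s) - f z))
      ((Q (z + s) - Q z) (f z))) (sq_nonneg d)
    nlinarith

lemma innerBd_of_near (h0 : 0 < α) (h1 : α < 1) {f : ℂ → F} {A : ℝ}
    (hs : ∀ z, ‖z‖ < 1 → (1 - ‖z‖) ^ 2 * ‖f z‖ ≤ A)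
    (hn : ∀ z, ‖z‖ < 1 → ∀ s, ‖s‖ ≤ (1 - ‖z‖) / 48 →
      (1 - ‖z‖) ^ 2 * ‖f (z + s) - f z‖ ≤ A * (‖s‖ / (1 - ‖z‖)) ^ α) :
    InnerBd α f (240 * A) := by
  have hA : 0 ≤ A := le_trans (by positivity) (hs 0 (by simp))
  intro z hz
  have hp : 0 < 1 - ‖z‖ := by linarith
  refine ⟨by linarith [hs z hz], fun s hsd => ?_⟩
  by_cases hle : ‖s‖ ≤ (1 - ‖z‖) / 48
  · refine (hn z hz s hle).trans ?_
    gcongr; linarith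
  · push Not at hle
    have hzs : ‖z + s‖ ≤ ‖z‖ + ‖s‖ := norm_add_le z s
    have b1 := hs z hz
    have b2 := hs (z + s) (by linarith)
    have b3 : (1 - ‖z‖) ^ 2 ≤ 4 * (1 - ‖z + s‖) ^ 2 := by nlinarith
    have b4 : (1 - ‖z‖) ^ 2 * ‖f (z + s)‖ ≤ 4 * A := by
      have := mul_le_mul_of_nonneg_right b3 (norm_nonneg (f (z + s)))
      linarith
    have b5 := mul_le_mul_of_nonneg_left (norm_sub_le (f (z + s)) (f z)) (sq_nonneg (1 - ‖z‖))
    have b6 : (1:ℝ) / 48 ≤ (‖s‖ / (1 - ‖z‖)) ^ α := by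
      have hx : 1 / 48 ≤ ‖s‖ / (1 - ‖z‖) := by
        rw [le_div_iff₀ hp]; linarith
      have hx1 : ‖s‖ / (1 - ‖z‖) ≤ 1 := by rw [div_le_one hp]; linarith
      exact hx.trans (Real.self_le_rpow_of_le_one (by linarith) hx1 h1.le)
    nlinarith

end WeightedHolder

section CauchyInner

variable {E : Type*} [NormedAddCommGroup E] [NormedSpace ℝ E]

/-- First-order Taylor bound at interior points of the unit disk. -/
def InnerTaylor (α : ℝ) (v : ℂ → E) (D : ℂ → (ℂ →L[ℝ] E)) (B : ℝ) : Prop :=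
  ∀ z, ‖z‖ < 1 → ∀ s, ‖s‖ ≤ (1 - ‖z‖) / 8 →
    (1 - ‖z‖) ^ 2 * ‖v (z + s) - v z - D z s‖ ≤ B * ‖s‖ * (‖s‖ / (1 - ‖z‖)) ^ α

lemma innerBd_deriv_of_taylor {α : ℝ} (h0 : 0 < α) (h1 : α < 1) {v : ℂ → E}
    {D : ℂ → (ℂ →L[ℝ] E)} {B : ℝ} (hD : ∀ z, ‖z‖ < 1 → (1 - ‖z‖) ^ 2 * ‖D z‖ ≤ B)
    (hT : InnerTaylor α v D B) : InnerBd α D (240 * (13 * B)) := by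
  have hB : 0 ≤ B := le_trans (by positivity) (hD 0 (by simp))
  refine innerBd_of_near h0 h1 (fun z hz => (hD z hz).trans (by linarith)) fun z hz s hs => ?_
  have hp : 0 < 1 - ‖z‖ := by linarith
  have hzs : ‖z + s‖ ≤ ‖z‖ + ‖s‖ := norm_add_le z s
  rcases eq_or_ne s 0 with rfl | hne
  · simp only [add_zero, sub_self, norm_zero, mul_zero]; positivity
  have hr : 0 < ‖s‖ := norm_pos_iff.2 hne
  set r := ‖s‖ with hr_def
  set d := 1 - ‖z‖ with hd_def
  set q := (r / d) ^ α with hq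
  have hq0 : 0 ≤ q := by positivity
  have hdd : d / 2 ≤ 1 - ‖z + s‖ := by linarith
  have two : ∀ x : ℝ, 0 ≤ x → (2 * x) ^ α ≤ 2 * x ^ α := fun x hx => by
    rw [Real.mul_rpow (by norm_num) hx]
    gcongr
    exact Real.rpow_le_self_of_one_le (by norm_num) h1.le
  have key : ∀ x : ℂ, ‖x‖ = 1 → ‖(D (z + s) - D z) x‖ ≤ 13 * B * q / d ^ 2 := by
    intro x hx
    set e : ℂ := r • x with he
    have hen : ‖e‖ = r := by rw [he, norm_smul, hx, mul_one, Real.norm_of_nonneg hr.le]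
    have hse : ‖s + e‖ ≤ 2 * r := (norm_add_le s e).trans (by rw [hen]; linarith)
    have R1 := hT z hz (s + e) (by linarith)
    have R2 := hT z hz s (by linarith)
    have R3 := hT (z + s) (by linarith) e (by rw [hen]; linarith)
    rw [hen] at R3
    have R1' : d ^ 2 * ‖v (z + (s + e)) - v z - D z (s + e)‖ ≤ 4 * B * r * q := by
      refine R1.trans ?_
      calc B * ‖s + e‖ * (‖s + e‖ / d) ^ α ≤ B * (2 * r) * (2 * (r / d)) ^ α := by
            gcongr
            rw [mul_div_assoc']; gcongr
        _ ≤ B * (2 * r) * (2 * q) := by gcongr; exact two _ (by positivity)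
        _ = _ := by ring
    have R3' : d ^ 2 * ‖v (z + s + e) - v (z + s) - D (z + s) e‖ ≤ 8 * B * r * q := by
      have : d ^ 2 ≤ 4 * (1 - ‖z + s‖) ^ 2 := by nlinarith
      calc _ ≤ 4 * (1 - ‖z + s‖) ^ 2 * ‖v (z + s + e) - v (z + s) - D (z + s) e‖ := by gcongr
        _ ≤ 4 * (B * r * (r / (1 - ‖z + s‖)) ^ α) := by linarith
        _ ≤ 4 * (B * r * (2 * (r / d)) ^ α) := by
            have : r / (1 - ‖z + s‖) ≤ 2 * (r / d) := by
              have : r / (1 - ‖z + s‖) ≤ r / (d / 2) := by gcongr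
              refine this.trans (le_of_eq ?_); field_simp
            have h3 : 0 ≤ r / (1 - ‖z + s‖) := div_nonneg hr.le (by linarith)
            gcongr
        _ ≤ 4 * (B * r * (2 * q)) := by gcongr; exact two _ (by positivity)
        _ = _ := by ring
    have hid : (D (z + s) - D z) e = (v (z + (s + e)) - v z - D z (s + e)) -
        (v (z + s) - v z - D z s) - (v (z + s + e) - v (z + s) - D (z + s) e) := by
      rw [map_add, sub_apply, add_assoc]; abel
    have hn : d ^ 2 * ‖(D (z + s) - D z) e‖ ≤ 13 * B * r * q := by
      rw [hid]
      have := (norm_sub_le (v (z + (s + e)) - v z - D z (s + e) - (v (z + s) - v z - D z s))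
        (v (z + s + e) - v (z + s) - D (z + s) e)).trans
        (add_le_add_left (norm_sub_le _ _) _)
      have := mul_le_mul_of_nonneg_left this (sq_nonneg d)
      nlinarith
    rw [he, map_smul, norm_smul, Real.norm_of_nonneg hr.le] at hn
    rw [le_div_iff₀ (by positivity)]
    refine le_of_mul_le_mul_left ?_ hr
    linarith
  have := ContinuousLinearMap.opNorm_le_of_unit_norm (by positivity) key
  rw [le_div_iff₀ (by positivity)] at this
  linarith

lemma innerBd_of_taylor {α : ℝ} (h0 : 0 < α) (h1 : α < 1) {v : ℂ → E}
    {D : ℂ → (ℂ →L[ℝ] E)} {B : ℝ} (hv : ∀ z, ‖z‖ < 1 → (1 - ‖z‖) ^ 2 * ‖v z‖ ≤ B)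
    (hD : ∀ z, ‖z‖ < 1 → (1 - ‖z‖) ^ 2 * ‖D z‖ ≤ B)
    (hT : InnerTaylor α v D B) : InnerBd α v (240 * (13 * B)) := by
  have hB : 0 ≤ B := le_trans (by positivity) (hD 0 (by simp))
  refine innerBd_of_near h0 h1 (fun z hz => (hv z hz).trans (by linarith)) fun z hz s hs => ?_
  have hp : 0 < 1 - ‖z‖ := by linarith
  have hd1 : 1 - ‖z‖ ≤ 1 := by linarith [norm_nonneg z]
  have t := hT z hz s (by linarith)
  have a := mul_le_mul_of_nonneg_right (hD z hz) (norm_nonneg s)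
  have b := mul_le_mul_of_nonneg_left ((D z).le_opNorm s) (sq_nonneg (1 - ‖z‖))
  have hq1 : ‖s‖ / (1 - ‖z‖) ≤ 1 := by rw [div_le_one hp]; linarith
  have c : ‖s‖ ≤ (‖s‖ / (1 - ‖z‖)) ^ α := by
    refine le_trans ?_ (Real.self_le_rpow_of_le_one (by positivity) hq1 h1.le)
    rw [le_div_iff₀ hp]; nlinarith [norm_nonneg s]
  set q := (‖s‖ / (1 - ‖z‖)) ^ α with hq
  have hq0 : 0 ≤ q := by positivity
  have e : v (z + s) - v z = (v (z + s) - v z - D z s) + D z s := by abel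
  have f := mul_le_mul_of_nonneg_left (norm_add_le (v (z + s) - v z - D z s) (D z s))
    (sq_nonneg (1 - ‖z‖))
  rw [← e] at f
  have g : ‖s‖ * q ≤ q := mul_le_of_le_one_left hq0 (by linarith)
  nlinarith [mul_le_mul_of_nonneg_left g hB, mul_le_mul_of_nonneg_left c hB, mul_nonneg hB hq0]

lemma exists_innerBd_cauchyT (E : Type*) [NormedAddCommGroup E] [NormedSpace ℝ E]
    [NormedSpace ℂ E] [IsScalarTower ℝ ℂ E] [CompleteSpace E] {α : ℝ} (h0 : 0 < α) (h1 : α < 1) :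
    ∃ C : ℝ, 0 < C ∧ ∀ f : ℂ → E, IsTest f → ∀ B, InnerBd α f B → (∫ w, ‖f w‖) ≤ B →
      InnerBd α (cauchyT f) (C * B) ∧ InnerBd α (fderiv ℝ (cauchyT f)) (C * B) ∧
      InnerTaylor α (cauchyT f) (fderiv ℝ (cauchyT f)) (C * B) := by
  obtain ⟨C, hC, hT⟩ := exists_taylor_cauchyT E h0 h1
  refine ⟨240 * (13 * (12 * C)), by positivity, fun f hf B hB hBi => ?_⟩
  have hB0 := hB.nonneg
  have main : ∀ z : ℂ, ‖z‖ < 1 → (1 - ‖z‖) ^ 2 * ‖cauchyT f z‖ ≤ 12 * C * B ∧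
      (1 - ‖z‖) ^ 2 * ‖fderiv ℝ (cauchyT f) z‖ ≤ 12 * C * B ∧ ∀ s, ‖s‖ ≤ (1 - ‖z‖) / 8 →
      (1 - ‖z‖) ^ 2 * ‖cauchyT f (z + s) - cauchyT f z - fderiv ℝ (cauchyT f) z s‖ ≤
        12 * C * B * ‖s‖ * (‖s‖ / (1 - ‖z‖)) ^ α := by
    intro z hz
    obtain ⟨b1, b2⟩ := hB z hz
    have hp : 0 < 1 - ‖z‖ := by linarith
    have hd1 : 1 - ‖z‖ ≤ 1 := by linarith [norm_nonneg z]
    set d := 1 - ‖z‖ with hd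
    obtain ⟨k1, k2, k3⟩ := hT f hf z (d / 2) (B / d ^ 2) (by positivity) (fun s hs => by
      have := b2 s hs
      rw [div_mul_eq_mul_div, le_div_iff₀ (by positivity), mul_comm]
      refine this.trans ?_
      gcongr
      linarith)
    set S := B / d ^ 2 + ‖f z‖ + ((d / 2) ^ 2)⁻¹ * ∫ w, ‖f w‖ with hS
    have hS6 : d ^ 2 * S ≤ 6 * B := by
      have : d ^ 2 * S = B + d ^ 2 * ‖f z‖ + 4 * ∫ w, ‖f w‖ := by
        rw [hS]; field_simp; ring
      rw [this]; linarith
    have hCS : d ^ 2 * (C * S) ≤ 6 * C * B := by nlinarith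
    have hS0 : 0 ≤ S := by
      have : 0 ≤ ∫ w, ‖f w‖ := integral_nonneg fun _ => norm_nonneg _
      positivity
    refine ⟨?_, ?_, fun s hs => ?_⟩
    · calc d ^ 2 * ‖cauchyT f z‖ ≤ d ^ 2 * (d / 2 * (C * S)) := by gcongr
        _ = d / 2 * (d ^ 2 * (C * S)) := by ring
        _ ≤ 1 * (6 * C * B) := by gcongr; linarith
        _ ≤ _ := by nlinarith [mul_nonneg hC.le hB0]
    · calc _ ≤ d ^ 2 * (C * S) := by gcongr
        _ ≤ _ := by nlinarith [mul_nonneg hC.le hB0]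
    · have := k3 s (by linarith)
      have e : (‖s‖ / (d / 2)) ^ α ≤ 2 * (‖s‖ / d) ^ α := by
        have : ‖s‖ / (d / 2) = 2 * (‖s‖ / d) := by field_simp
        rw [this, Real.mul_rpow (by norm_num) (by positivity)]
        gcongr
        exact Real.rpow_le_self_of_one_le (by norm_num) h1.le
      calc _ ≤ d ^ 2 * (C * S * ‖s‖ * (‖s‖ / (d / 2)) ^ α) := by gcongr
        _ ≤ d ^ 2 * (C * S * ‖s‖ * (2 * (‖s‖ / d) ^ α)) := by gcongr
        _ = d ^ 2 * (C * S) * (2 * (‖s‖ * (‖s‖ / d) ^ α)) := by ring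
        _ ≤ 6 * C * B * (2 * (‖s‖ * (‖s‖ / d) ^ α)) := by gcongr
        _ = _ := by ring
  have hTay : InnerTaylor α (cauchyT f) (fderiv ℝ (cauchyT f)) (12 * C * B) :=
    fun z hz => (main z hz).2.2
  refine ⟨?_, ?_, fun z hz s hs => (hTay z hz s hs).trans ?_⟩
  · exact (innerBd_of_taylor h0 h1 (fun z hz => (main z hz).1) (fun z hz => (main z hz).2.1)
      hTay).mono (le_of_eq (by ring))
  · exact (innerBd_deriv_of_taylor h0 h1 (fun z hz => (main z hz).2.1)
      hTay).mono (le_of_eq (by ring))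
  · have hp : 0 < 1 - ‖z‖ := by linarith
    have : 12 * C * B ≤ 240 * (13 * (12 * C)) * B := by nlinarith [mul_nonneg hC.le hB0]
    exact mul_le_mul_of_nonneg_right (mul_le_mul_of_nonneg_right this (norm_nonneg _))
      (by positivity)

end CauchyInner

section Neumann

variable {n : ℕ}

/-- Test functions supported in the disk of radius three, with an interior Hölder bound and
an `L²` bound. -/
structure IsAdm (α B : ℝ) (f : ℂ → Fin n → ℂ) : Prop where
  test : IsTest f
  supp : ∀ z, 3 < ‖z‖ → f z = 0
  inner : InnerBd α f B
  l2 : eLpNorm f 2 volume ≤ ENNReal.ofReal B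

/-- Smooth coefficients with support in the disk of radius three and a Hölder bound. -/
structure IsCoef (α κ : ℝ) (Q : ℂ → ((Fin n → ℂ) →L[ℝ] (Fin n → ℂ))) : Prop where
  smooth : ContDiff ℝ ∞ Q
  supp : ∀ z, 3 < ‖z‖ → Q z = 0
  bound : ∀ z, ‖Q z‖ ≤ κ
  holder : ∀ z z', ‖Q z - Q z'‖ ≤ κ * ‖z - z'‖ ^ α

/-- The first order perturbation `Q ∂_y + R` applied to the Cauchy transform. -/
noncomputable def perturb (Q R : ℂ → ((Fin n → ℂ) →L[ℝ] (Fin n → ℂ))) (f : ℂ → Fin n → ℂ)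
    (z : ℂ) : Fin n → ℂ :=
  Q z (fderiv ℝ (cauchyT f) z Complex.I) + R z (cauchyT f z)

lemma IsCoef.nonneg {α κ : ℝ} {Q : ℂ → ((Fin n → ℂ) →L[ℝ] (Fin n → ℂ))} (h : IsCoef α κ Q) :
    0 ≤ κ := (norm_nonneg _).trans (h.bound 0)

lemma integral_norm_le_of_eLpNorm_two {f : ℂ → Fin n → ℂ} (hf : IsTest f)
    (h3 : ∀ z, 3 < ‖z‖ → f z = 0) {B : ℝ} (hB : 0 ≤ B)
    (h : eLpNorm f 2 volume ≤ ENNReal.ofReal B) : (∫ z, ‖f z‖) ≤ 6 * B := by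
  have hs : Function.support f ⊆ Metric.closedBall 0 3 := fun z hz => by
    by_contra hc
    exact hz (h3 z (by simpa using hc))
  have h1 := eLpNorm_le_eLpNorm_mul_rpow_measure_univ (p := 1) (q := 2)
    (μ := volume.restrict (Metric.closedBall (0:ℂ) 3)) (f := f) (by norm_num)
    hf.smooth.continuous.aestronglyMeasurable
  rw [eLpNorm_restrict_eq_of_support_subset hs, eLpNorm_restrict_eq_of_support_subset hs,
    eLpNorm_one_eq_lintegral_enorm, ← ofReal_integral_norm_eq_lintegral_enorm hf.integrable,
    Measure.restrict_apply_univ, Complex.volume_closedBall] at h1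
  have h2 : (ENNReal.ofReal 3 ^ 2 * (NNReal.pi : ENNReal)) ^
      (1 / (1:ENNReal).toReal - 1 / (2:ENNReal).toReal) ≤ ENNReal.ofReal 6 := by
    have e : ENNReal.ofReal 6 = (ENNReal.ofReal 36) ^ (1 / (1:ENNReal).toReal -
        1 / (2:ENNReal).toReal) := by
      rw [ENNReal.ofReal_rpow_of_pos (by norm_num)]
      congr 1
      rw [show (36:ℝ) = 6 ^ (2:ℝ) by norm_num, ← Real.rpow_mul (by norm_num)]
      norm_num
    rw [e]
    refine ENNReal.rpow_le_rpow ?_ (by norm_num)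
    have : (NNReal.pi : ENNReal) = ENNReal.ofReal Real.pi := by
      rw [← NNReal.coe_real_pi, ENNReal.ofReal_coe_nnreal]
    rw [this, ← ENNReal.ofReal_pow (by norm_num), ← ENNReal.ofReal_mul (by norm_num)]
    refine ENNReal.ofReal_le_ofReal ?_
    nlinarith [Real.pi_le_four]
  have h3 := h1.trans (mul_le_mul' h h2)
  rw [← ENNReal.ofReal_mul hB, ENNReal.ofReal_le_ofReal_iff (by positivity)] at h3
  linarith

lemma IsCoef.perturb_test {α κ : ℝ} {Q R : ℂ → ((Fin n → ℂ) →L[ℝ] (Fin n → ℂ))}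
    (hQ : IsCoef α κ Q) (hR : IsCoef α κ R) {f : ℂ → Fin n → ℂ} (hf : IsTest f) :
    IsTest (perturb Q R f) ∧ ∀ z, 3 < ‖z‖ → perturb Q R f z = 0 := by
  have h0 : ∀ z, 3 < ‖z‖ → perturb Q R f z = 0 := fun z hz => by
    simp [perturb, hQ.supp z hz, hR.supp z hz]
  refine ⟨⟨?_, HasCompactSupport.intro (isCompact_closedBall 0 3) fun z hz => h0 z ?_⟩, h0⟩
  · have hc := cauchyT_contDiff hf.smooth hf.supp
    exact (hQ.smooth.clm_apply ((hc.fderiv_right (m := ∞) (by simp)).clm_apply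
      contDiff_const)).add (hR.smooth.clm_apply hc)
  · simpa using hz

lemma perturb_sub {Q R : ℂ → ((Fin n → ℂ) →L[ℝ] (Fin n → ℂ))} {f g : ℂ → Fin n → ℂ}
    (hf : IsTest f) (hg : IsTest g) (z : ℂ) :
    perturb Q R (fun x => f x - g x) z = perturb Q R f z - perturb Q R g z := by
  have e : cauchyT (fun x => f x - g x) = fun z => cauchyT f z - cauchyT g z :=
    funext (cauchyT_sub hf hg)
  have hfd := (cauchyT_contDiff hf.smooth hf.supp).differentiable (by simp) z
  have hgd := (cauchyT_contDiff hg.smooth hg.supp).differentiable (by simp) z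
  simp only [perturb, e]
  rw [fderiv_fun_sub hfd hgd]
  simp only [_root_.sub_apply, map_sub]
  abel

lemma exists_eLpNorm_perturb_le (n : ℕ) : ∃ C : ℝ, 0 < C ∧ ∀ (α κ : ℝ)
    (Q R : ℂ → ((Fin n → ℂ) →L[ℝ] (Fin n → ℂ))) (f : ℂ → Fin n → ℂ), IsCoef α κ Q →
    IsCoef α κ R → IsTest f → (∀ z, 3 < ‖z‖ → f z = 0) →
    eLpNorm (perturb Q R f) 2 volume ≤ ENNReal.ofReal (C * κ) * eLpNorm f 2 volume := by
  obtain ⟨C, hC, hd⟩ := exists_eLpNorm_fderiv_cauchyT_le n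
  refine ⟨C + 16 * Real.pi, by positivity, fun α κ Q R f hQ hR hf h3 => ?_⟩
  obtain ⟨ht, h0⟩ := hQ.perturb_test hR hf
  have hκ := hQ.nonneg
  have hs : Function.support (perturb Q R f) ⊆ Metric.closedBall 0 3 := fun z hz => by
    by_contra hc
    exact hz (h0 z (by simpa using hc))
  rw [← eLpNorm_restrict_eq_of_support_subset hs]
  have hc := cauchyT_contDiff hf.smooth hf.supp
  have c1 : Continuous fun z => Q z (fderiv ℝ (cauchyT f) z Complex.I) :=
    (hQ.smooth.clm_apply ((hc.fderiv_right (m := ∞) (by simp)).clm_apply contDiff_const)).continuous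
  have c2 : Continuous fun z => R z (cauchyT f z) := (hR.smooth.clm_apply hc).continuous
  have key : ∀ {P : ℂ → ((Fin n → ℂ) →L[ℝ] (Fin n → ℂ))}, IsCoef α κ P → ∀ v : ℂ → Fin n → ℂ,
      eLpNorm (fun z => P z (v z)) 2 (volume.restrict (Metric.closedBall 0 3)) ≤
        ENNReal.ofReal κ * eLpNorm v 2 (volume.restrict (Metric.closedBall 0 3)) := fun hP v =>
    eLpNorm_le_mul_eLpNorm_of_ae_le_mul (Filter.Eventually.of_forall fun z =>
      (hP.bound z |> (ContinuousLinearMap.le_of_opNorm_le _ · _))) _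
  calc _ ≤ _ := eLpNorm_add_le c1.aestronglyMeasurable c2.aestronglyMeasurable (by norm_num)
    _ ≤ ENNReal.ofReal κ * (ENNReal.ofReal C * eLpNorm f 2 volume) +
        ENNReal.ofReal κ * (ENNReal.ofReal (16 * Real.pi) * eLpNorm f 2 volume) := by
        refine add_le_add ((key hQ _).trans ?_) ((key hR _).trans ?_)
        · exact mul_le_mul' le_rfl (hd f hf h3)
        · refine mul_le_mul' le_rfl (le_trans (eLpNorm_mono_measure _ ?_) (eLpNorm_cauchyT_le hf h3))
          exact Measure.restrict_mono (Metric.closedBall_subset_closedBall (by norm_num)) le_rfl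
    _ = _ := by
        rw [mul_comm (C + 16 * Real.pi), ENNReal.ofReal_mul hκ,
          ENNReal.ofReal_add hC.le (by positivity)]
        ring

lemma exists_perturb_adm (n : ℕ) {α : ℝ} (h0 : 0 < α) (h1 : α < 1) : ∃ C : ℝ, 0 < C ∧
    ∀ (κ B : ℝ) (Q R : ℂ → ((Fin n → ℂ) →L[ℝ] (Fin n → ℂ))) (f : ℂ → Fin n → ℂ), IsCoef α κ Q →
    IsCoef α κ R → IsAdm α B f → IsAdm α (C * κ * B) (perturb Q R f) := by
  obtain ⟨C, hC, hL⟩ := exists_eLpNorm_perturb_le n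
  obtain ⟨K, hK, hI⟩ := exists_innerBd_cauchyT (Fin n → ℂ) h0 h1
  refine ⟨C + 24 * K, by positivity, fun κ B Q R f hQ hR hf => ?_⟩
  have hB := hf.inner.nonneg
  have hκ := hQ.nonneg
  obtain ⟨ht, hz⟩ := hQ.perturb_test hR hf.test
  have a1 : 0 ≤ C * κ * B := by positivity
  have a2 : 0 ≤ K * κ * B := by positivity
  refine ⟨ht, hz, ?_, ?_⟩
  · obtain ⟨i1, i2, -⟩ := hI f hf.test (6 * B) (hf.inner.mono (by linarith))
      (integral_norm_le_of_eLpNorm_two hf.test hf.supp hB hf.l2)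
    refine (((i2.clm_apply (e := Complex.I) (by simp)).mul h0 hQ.bound hQ.holder).add
      (i1.mul h0 hR.bound hR.holder)).mono ?_
    linarith
  · refine (hL α κ Q R f hQ hR hf.test hf.supp).trans ((mul_le_mul' le_rfl hf.l2).trans ?_)
    rw [← ENNReal.ofReal_mul (by positivity)]
    exact ENNReal.ofReal_le_ofReal (by linarith)

lemma IsAdm.add {α B B' : ℝ} {f g : ℂ → Fin n → ℂ} (hf : IsAdm α B f) (hg : IsAdm α B' g) :
    IsAdm α (B + B') (fun z => f z + g z) where
  test := ⟨hf.test.smooth.add hg.test.smooth, hf.test.supp.add hg.test.supp⟩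
  supp z hz := by simp [hf.supp z hz, hg.supp z hz]
  inner := hf.inner.add hg.inner
  l2 := by
    rw [ENNReal.ofReal_add hf.inner.nonneg hg.inner.nonneg]
    exact (eLpNorm_add_le hf.test.smooth.continuous.aestronglyMeasurable
      hg.test.smooth.continuous.aestronglyMeasurable (by norm_num)).trans (add_le_add hf.l2 hg.l2)

lemma IsAdm.mono {α B B' : ℝ} {f : ℂ → Fin n → ℂ} (hf : IsAdm α B f) (h : B ≤ B') :
    IsAdm α B' f :=
  ⟨hf.test, hf.supp, hf.inner.mono h, hf.l2.trans (ENNReal.ofReal_le_ofReal h)⟩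

/-- Approximate solutions of `h = perturb Q R h + g` are `L²`-close to functions with the same
interior Hölder bounds as the right hand side, when the coefficients are small. -/
lemma exists_adm_near (n : ℕ) {α : ℝ} (h0 : 0 < α) (h1 : α < 1) : ∃ κ : ℝ, 0 < κ ∧
    ∀ (Q R : ℂ → ((Fin n → ℂ) →L[ℝ] (Fin n → ℂ))) (g h : ℂ → Fin n → ℂ) (B ε : ℝ),
    IsCoef α κ Q → IsCoef α κ R → IsAdm α B g → IsTest h → (∀ z, 3 < ‖z‖ → h z = 0) → 0 < ε →
    eLpNorm (fun z => h z - perturb Q R h z - g z) 2 volume ≤ ENNReal.ofReal ε →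
    ∃ F, IsAdm α (2 * B) F ∧ eLpNorm (fun z => h z - F z) 2 volume ≤ ENNReal.ofReal (3 * ε) := by
  obtain ⟨C, hC, hL⟩ := exists_eLpNorm_perturb_le n
  obtain ⟨K, hK, hA⟩ := exists_perturb_adm n h0 h1
  refine ⟨(2 * (C + K))⁻¹, by positivity, fun Q R g h B ε hQ hR hg hh h3 hε hr => ?_⟩
  have hB := hg.inner.nonneg
  have hCκ : C * (2 * (C + K))⁻¹ ≤ 1 / 2 := by
    rw [← div_eq_mul_inv, div_le_div_iff₀ (by positivity) (by norm_num)]; linarith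
  have hKκ : K * (2 * (C + K))⁻¹ ≤ 1 / 2 := by
    rw [← div_eq_mul_inv, div_le_div_iff₀ (by positivity) (by norm_num)]; linarith
  set D := (eLpNorm (fun z => h z - g z) 2 volume).toReal with hD
  have hDfin : eLpNorm (fun z => h z - g z) 2 volume = ENNReal.ofReal D := by
    rw [hD, ENNReal.ofReal_toReal]
    exact ((hh.smooth.continuous.sub hg.test.smooth.continuous).memLp_of_hasCompactSupport
      (hh.supp.sub hg.test.supp)).2.ne
  have hD0 : 0 ≤ D := ENNReal.toReal_nonneg
  have main : ∀ k : ℕ, ∃ F, IsAdm α (2 * B) F ∧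
      eLpNorm (fun z => h z - F z) 2 volume ≤ ENNReal.ofReal (D / 2 ^ k + 2 * ε) := by
    intro k
    induction k with
    | zero =>
      refine ⟨g, hg.mono (by linarith), hDfin.le.trans (ENNReal.ofReal_le_ofReal ?_)⟩
      simp only [pow_zero, div_one]; linarith
    | succ k ih =>
      obtain ⟨F, hF, hFe⟩ := ih
      refine ⟨fun z => perturb Q R F z + g z, ((hA _ _ Q R F hQ hR hF).add hg).mono ?_, ?_⟩
      · nlinarith
      · have hhF : IsTest (fun z => h z - F z) :=
          ⟨hh.smooth.sub hF.test.smooth, hh.supp.sub hF.test.supp⟩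
        have e : (fun z => h z - (perturb Q R F z + g z)) =
            (fun z => perturb Q R (fun z => h z - F z) z) +
              fun z => h z - perturb Q R h z - g z := by
          funext z
          simp only [Pi.add_apply, perturb_sub hh hF.test]
          abel
        have t1 := (hQ.perturb_test hR hhF).1
        have t2 := (hQ.perturb_test hR hh).1
        rw [e]
        refine (eLpNorm_add_le t1.smooth.continuous.aestronglyMeasurable
          ((hh.smooth.continuous.sub t2.smooth.continuous).sub
            hg.test.smooth.continuous).aestronglyMeasurable (by norm_num)).trans ?_
        have l := (hL α _ Q R _ hQ hR hhF fun z hz => by simp [h3 z hz, hF.supp z hz]).trans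
          (mul_le_mul' (ENNReal.ofReal_le_ofReal hCκ) hFe)
        refine (add_le_add l hr).trans ?_
        rw [← ENNReal.ofReal_mul (by norm_num), ← ENNReal.ofReal_add (by positivity) hε.le]
        refine ENNReal.ofReal_le_ofReal (le_of_eq ?_)
        rw [pow_succ]; field_simp; ring
  obtain ⟨k, hk⟩ := pow_unbounded_of_one_lt (D / ε) (one_lt_two : (1:ℝ) < 2)
  obtain ⟨F, hF, hFe⟩ := main k
  refine ⟨F, hF, hFe.trans (ENNReal.ofReal_le_ofReal ?_)⟩
  have : D / 2 ^ k ≤ ε := by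
    rw [div_lt_iff₀ hε] at hk
    rw [div_le_iff₀ (by positivity)]; linarith
  linarith

end Neumann

section Limit

variable {n : ℕ} {α : ℝ}

lemma tendsto_of_ae_of_innerBd (h0 : 0 < α) {v : ℂ → Fin n → ℂ} (hv : Continuous v) {K : ℝ}
    {w : ℕ → ℂ → Fin n → ℂ} (hw : ∀ j, InnerBd α (w j) K)
    (hae : ∀ᵐ z ∂(volume.restrict (Metric.ball (0:ℂ) 1)),
      Filter.Tendsto (fun j => w j z) Filter.atTop (nhds (v z))) {z : ℂ} (hz : ‖z‖ < 1) :
    Filter.Tendsto (fun j => w j z) Filter.atTop (nhds (v z)) := by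
  rw [ae_restrict_iff' measurableSet_ball] at hae
  have hd := Measure.dense_of_ae hae
  have hp : 0 < 1 - ‖z‖ := by linarith
  set d := 1 - ‖z‖ with hdd
  have hK : 0 ≤ K := (hw 0).nonneg
  rw [Metric.tendsto_atTop]
  intro ε hε
  have lim : Filter.Tendsto (fun x => ‖v x - v z‖ + K / d ^ 2 * (‖x - z‖ / d) ^ α) (nhds z)
      (nhds (‖v z - v z‖ + K / d ^ 2 * (‖z - z‖ / d) ^ α)) := by
    have : ContinuousAt (fun x => ‖v x - v z‖ + K / d ^ 2 * (‖x - z‖ / d) ^ α) z := by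
      refine ContinuousAt.add (by fun_prop) (ContinuousAt.mul (by fun_prop) ?_)
      exact ContinuousAt.rpow_const (by fun_prop) (Or.inr h0.le)
    exact this
  simp only [sub_self, norm_zero, zero_div, Real.zero_rpow h0.ne', mul_zero, add_zero] at lim
  have ev := (lim.eventually (gt_mem_nhds (half_pos hε))).and
    (Metric.ball_mem_nhds z (half_pos hp))
  obtain ⟨x, hxd, hx⟩ := hd.exists_mem_open (isOpen_interior) ⟨z, mem_interior_iff_mem_nhds.2 ev⟩
  obtain ⟨hx1, hx2⟩ := interior_subset hx
  have hxz : ‖x - z‖ < d / 2 := by simpa [dist_eq_norm] using hx2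
  have hxb : ‖x‖ < 1 := by
    have := norm_add_le z (x - z)
    rw [add_sub_cancel] at this
    linarith
  obtain ⟨N, hN⟩ := Metric.tendsto_atTop.1 (hxd (by simpa using hxb)) (ε / 2) (half_pos hε)
  refine ⟨N, fun j hj => ?_⟩
  have hj1 := hN j hj
  have hj2 := ((hw j) z hz).2 (x - z) hxz.le
  rw [add_sub_cancel, ← hdd, mul_comm, ← le_div_iff₀ (by positivity), div_eq_mul_inv, mul_right_comm,
    ← div_eq_mul_inv] at hj2
  rw [dist_eq_norm] at hj1 ⊢
  have e : w j z - v z = (w j x - v x) + (v x - v z) - (w j x - w j z) := by abel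
  rw [e]
  have t1 := norm_sub_le ((w j x - v x) + (v x - v z)) (w j x - w j z)
  have t2 := norm_add_le (w j x - v x) (v x - v z)
  linarith

/-- `L²`-limits of functions with uniform interior `C^{1,α}` bounds satisfy the same bounds. -/
lemma exists_hasFDerivAt_of_approx (h0 : 0 < α) {v : ℂ → Fin n → ℂ} (hv : Continuous v) {K : ℝ}
    (h : ∀ ε : ℝ, 0 < ε → ∃ (w : ℂ → Fin n → ℂ) (D : ℂ → (ℂ →L[ℝ] (Fin n → ℂ))), Continuous w ∧
      InnerBd α w K ∧ InnerBd α D K ∧ InnerTaylor α w D K ∧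
      eLpNorm (fun z => w z - v z) 2 (volume.restrict (Metric.ball 0 1)) ≤ ENNReal.ofReal ε) :
    ∃ D : ℂ → (ℂ →L[ℝ] (Fin n → ℂ)), InnerBd α D K ∧
      ∀ z, ‖z‖ < 1 → HasFDerivAt v (D z) z := by
  choose w D hwc hw hD hT hL using fun j : ℕ => h (1 / (j + 1)) (by positivity)
  have hm : TendstoInMeasure (volume.restrict (Metric.ball (0:ℂ) 1)) w Filter.atTop v := by
    refine tendstoInMeasure_of_tendsto_eLpNorm (p := 2) (by norm_num)
      (fun j => (hwc j).aestronglyMeasurable) hv.aestronglyMeasurable ?_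
    refine tendsto_of_tendsto_of_tendsto_of_le_of_le tendsto_const_nhds ?_ (fun _ => zero_le) hL
    have := ENNReal.tendsto_ofReal (tendsto_one_div_add_atTop_nhds_zero_nat (𝕜 := ℝ))
    simpa using this
  obtain ⟨ns, -, hae⟩ := hm.exists_seq_tendsto_ae
  have hpt : ∀ z, ‖z‖ < 1 → Filter.Tendsto (fun j => w (ns j) z) Filter.atTop (nhds (v z)) :=
    fun z hz => tendsto_of_ae_of_innerBd h0 hv (fun j => hw (ns j)) hae hz
  have hlim : ∀ z : ℂ, ∃ L : ℂ →L[ℝ] (Fin n → ℂ), ‖z‖ < 1 →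
      Filter.Tendsto (fun j => D (ns j) z) (Filter.hyperfilter ℕ) (nhds L) := by
    intro z
    by_cases hz : ‖z‖ < 1
    · have hp : 0 < 1 - ‖z‖ := by linarith
      obtain ⟨L, -, hL⟩ := (isCompact_closedBall (0 : ℂ →L[ℝ] (Fin n → ℂ))
        (K / (1 - ‖z‖) ^ 2)).ultrafilter_le_nhds
        ((Filter.hyperfilter ℕ).map fun j => D (ns j) z) (by
          rw [Filter.le_principal_iff]
          refine Filter.mem_map.2 (Filter.univ_mem' fun j => ?_)
          have := (hD (ns j) z hz).1
          rw [Set.mem_preimage, mem_closedBall_zero_iff, le_div_iff₀ (by positivity)]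
          linarith)
      exact ⟨L, fun _ => hL⟩
    · exact ⟨0, fun h => absurd h hz⟩
  choose L hL using hlim
  have hpt' : ∀ z, ‖z‖ < 1 →
      Filter.Tendsto (fun j => w (ns j) z) (Filter.hyperfilter ℕ) (nhds (v z)) :=
    fun z hz => (hpt z hz).mono_left Nat.hyperfilter_le_atTop
  refine ⟨L, fun z hz => ⟨?_, fun s hs => ?_⟩, fun z hz => ?_⟩
  · exact le_of_tendsto' ((hL z hz).norm.const_mul _) fun j => (hD (ns j) z hz).1
  · have hzs : ‖z + s‖ < 1 := by linarith [norm_add_le z s]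
    exact le_of_tendsto' (((hL (z + s) hzs).sub (hL z hz)).norm.const_mul _)
      fun j => (hD (ns j) z hz).2 s hs
  · have hp : 0 < 1 - ‖z‖ := by linarith
    refine hasFDerivAt_of_taylor (ρ := (1 - ‖z‖) / 8) (K := K / (1 - ‖z‖) ^ 2 / (1 - ‖z‖) ^ α) h0
      (by positivity) fun t ht => ?_
    have hzs : ‖z + t‖ < 1 := by linarith [norm_add_le z t]
    have := le_of_tendsto' ((((hpt' (z + t) hzs).sub (hpt' z hz)).sub
      (((ContinuousLinearMap.apply ℝ (Fin n → ℂ) t).continuous.tendsto _).comp (hL z hz))).norm.const_mul _) fun j => hT (ns j) z hz t ht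
    rw [Real.div_rpow (norm_nonneg _) hp.le] at this
    rw [Real.rpow_one_add' (norm_nonneg _) (by linarith), div_div, div_mul_eq_mul_div,
      le_div_iff₀ (by positivity)]
    have hq : 0 < (1 - ‖z‖) ^ α := by positivity
    calc _ = (1 - ‖z‖) ^ 2 * ‖v (z + t) - v z - L z t‖ * (1 - ‖z‖) ^ α := by ring
      _ ≤ K * ‖t‖ * (‖t‖ ^ α / (1 - ‖z‖) ^ α) * (1 - ‖z‖) ^ α :=
          mul_le_mul_of_nonneg_right this hq.le
      _ = _ := by field_simp

end Limit

section IntegrationByParts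

variable {F : Type*} [NormedAddCommGroup F] [NormedSpace ℝ F] [CompleteSpace F]

lemma integral_deriv_eq_zero_off_countable {g g' : ℝ → F} {N : ℝ} (hg : Continuous g)
    (h0 : ∀ t, N < |t| → g t = 0) (h0' : ∀ t, N < |t| → g' t = 0) {s : Set ℝ} (hs : s.Countable)
    (hd : ∀ t, t ∉ s → HasDerivAt g (g' t) t) (hi : Integrable g') : ∫ t, g' t = 0 := by
  have hsub : Function.support g' ⊆ Set.Ioc (-(|N| + 1)) (|N| + 1) := by
    intro t ht
    have : |t| ≤ N := by
      by_contra hc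
      exact ht (h0' t (by linarith))
    have h2 := abs_le.1 (this.trans (le_abs_self N))
    exact ⟨by linarith, by linarith⟩
  rw [← intervalIntegral.integral_eq_integral_of_support_subset hsub,
    integral_eq_of_hasDerivAt_off_countable g g' hs hg.continuousOn (fun x hx => hd x hx.2)
      hi.intervalIntegrable]
  have hN : N < |(|N| + 1)| := by
    rw [abs_of_pos (by positivity)]; linarith [le_abs_self N]
  rw [h0 _ hN, h0 _ (by rwa [abs_neg]), sub_zero]

lemma integral_fderiv_eq_zero_off_line {G : ℂ → F} (hG : Continuous G) (hs : HasCompactSupport G)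
    {c : ℝ} (hd : ∀ z : ℂ, z.im ≠ c → DifferentiableAt ℝ G z) {e : ℂ}
    (he : e = 1 ∨ e = Complex.I) (hi : Integrable fun z => fderiv ℝ G z e) :
    ∫ z, fderiv ℝ G z e = 0 := by
  obtain ⟨N, hN⟩ := hs.isCompact.isBounded.subset_closedBall 0
  have hz : ∀ z : ℂ, N < ‖z‖ → z ∉ tsupport G := fun z h hc => by
    have := hN hc
    rw [mem_closedBall_zero_iff] at this
    linarith
  have hG0 : ∀ z : ℂ, N < ‖z‖ → G z = 0 := fun z h => image_eq_zero_of_notMem_tsupport (hz z h)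
  have hG0' : ∀ z : ℂ, N < ‖z‖ → fderiv ℝ G z e = 0 := fun z h => by
    have : fderiv ℝ G z = 0 := by
      by_contra hc
      exact hz z h (support_fderiv_subset ℝ hc)
    simp [this]
  have hmp := Complex.volume_preserving_equiv_real_prod.symm
  have hi2 : Integrable (fun p : ℝ × ℝ => fderiv ℝ G (Complex.measurableEquivRealProd.symm p) e)
      (volume.prod volume) :=
    (hmp.integrable_comp_emb (MeasurableEquiv.measurableEmbedding _)).2 hi
  rw [← hmp.integral_comp' (fun z => fderiv ℝ G z e), Measure.volume_eq_prod]
  have ex : ∀ x y : ℝ, Complex.measurableEquivRealProd.symm (x, y) = (⟨x, y⟩ : ℂ) := fun x y => rfl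
  rcases he with rfl | rfl
  · rw [integral_prod_symm _ hi2]
    refine integral_eq_zero_of_ae ?_
    have hne : ∀ᵐ y : ℝ, y ≠ c := by simp [ae_iff]
    filter_upwards [hi2.prod_left_ae, hne] with y hy hyc
    have h1 : ∀ t, HasDerivAt (fun x : ℝ => (⟨x, y⟩ : ℂ)) 1 t := fun t => by
      have : (fun x : ℝ => (⟨x, y⟩ : ℂ)) = fun x : ℝ => (x : ℂ) + y * Complex.I := by
        funext x; exact Complex.mk_eq_add_mul_I x y
      rw [this]
      simpa using (Complex.ofRealCLM.hasDerivAt (x := t)).add_const (y * Complex.I)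
    refine integral_deriv_eq_zero_off_countable (N := N) (g := fun x : ℝ => G ⟨x, y⟩) ?_ ?_ ?_
      Set.countable_empty ?_ hy
    · exact hG.comp (continuous_iff_continuousAt.2 fun t => (h1 t).continuousAt)
    · exact fun t ht => hG0 _ (ht.trans_le (Complex.abs_re_le_norm ⟨t, y⟩))
    · exact fun t ht => hG0' _ (ht.trans_le (Complex.abs_re_le_norm ⟨t, y⟩))
    · exact fun t _ => (hd ⟨t, y⟩ hyc).hasFDerivAt.comp_hasDerivAt t (h1 t)
  · rw [integral_prod _ hi2]
    refine integral_eq_zero_of_ae ?_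
    filter_upwards [hi2.prod_right_ae] with x hx
    have h1 : ∀ t, HasDerivAt (fun y : ℝ => (⟨x, y⟩ : ℂ)) Complex.I t := fun t => by
      have : (fun y : ℝ => (⟨x, y⟩ : ℂ)) = fun y : ℝ => (x : ℂ) + y * Complex.I := by
        funext y; exact Complex.mk_eq_add_mul_I x y
      rw [this]
      simpa using ((Complex.ofRealCLM.hasDerivAt (x := t)).mul_const Complex.I).const_add (x : ℂ)
    refine integral_deriv_eq_zero_off_countable (N := N) (g := fun y : ℝ => G ⟨x, y⟩) ?_ ?_ ?_
      (Set.countable_singleton c) ?_ hx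
    · exact hG.comp (continuous_iff_continuousAt.2 fun t => (h1 t).continuousAt)
    · exact fun t ht => hG0 _ (ht.trans_le (Complex.abs_im_le_norm ⟨x, t⟩))
    · exact fun t ht => hG0' _ (ht.trans_le (Complex.abs_im_le_norm ⟨x, t⟩))
    · exact fun t ht => (hd ⟨x, t⟩ ht).hasFDerivAt.comp_hasDerivAt t (h1 t)

end IntegrationByParts

section Mollifier

variable {E : Type*} [NormedAddCommGroup E] [NormedSpace ℝ E]

/-- Nonnegative test functions of integral one supported in the disk of radius `δ`. -/
structure IsMoll (δ : ℝ) (φ : ℂ → ℝ) : Prop where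
  test : IsTest φ
  nonneg : ∀ w, 0 ≤ φ w
  supp : ∀ w, δ ≤ ‖w‖ → φ w = 0
  integral : ∫ w, φ w = 1

lemma exists_isMoll {δ : ℝ} (hδ : 0 < δ) : ∃ φ, IsMoll δ φ := by
  let b : ContDiffBump (0 : ℂ) := ⟨δ / 2, δ, by positivity, by linarith⟩
  refine ⟨b.normed volume, ⟨b.contDiff_normed, b.hasCompactSupport_normed⟩,
    b.nonneg_normed, fun w hw => ?_, b.integral_normed⟩
  by_contra hc
  have : w ∈ Function.support (b.normed volume) := hc
  rw [b.support_normed_eq, mem_ball_zero_iff] at this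
  exact absurd hw (not_le.2 this)

/-- Convolution with a real valued kernel. -/
noncomputable def mollify (φ : ℂ → ℝ) (f : ℂ → E) (z : ℂ) : E := ∫ w, φ w • f (z - w)

variable {φ : ℂ → ℝ} {δ : ℝ}

lemma IsMoll.norm_integral_le (hφ : IsMoll δ φ) {f : ℂ → E} {ε : ℝ}
    (h : ∀ w, ‖w‖ < δ → ‖f w‖ ≤ ε) : ‖∫ w, φ w • f w‖ ≤ ε := by
  refine (norm_integral_le_of_norm_le (hφ.test.integrable.mul_const ε)
    (Filter.Eventually.of_forall fun w => ?_)).trans_eq ?_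
  · rw [norm_smul, Real.norm_of_nonneg (hφ.nonneg w)]
    by_cases hw : ‖w‖ < δ
    · exact mul_le_mul_of_nonneg_left (h w hw) (hφ.nonneg w)
    · simp [hφ.supp w (not_lt.1 hw)]
  · rw [integral_mul_const, hφ.integral, one_mul]

lemma IsTest.integrable_smul_sub (hφ : IsTest φ) {f : ℂ → E} (hf : Integrable f) (z : ℂ) :
    Integrable fun w => φ w • f (z - w) := by
  obtain ⟨C, hC⟩ := hφ.supp.exists_bound_of_continuous hφ.smooth.continuous
  exact (hf.comp_sub_left z).bdd_smul C hφ.smooth.continuous.aestronglyMeasurable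
    (Filter.Eventually.of_forall hC)

lemma mollify_eq_convolution (φ : ℂ → ℝ) (f : ℂ → E) :
    mollify φ f = convolution φ f (ContinuousLinearMap.lsmul ℝ ℝ) volume := by
  funext z; simp [mollify, convolution_def]

lemma mollify_contDiff (hφ : IsTest φ) {f : ℂ → E} (hf : Integrable f) :
    ContDiff ℝ ∞ (mollify φ f) := by
  rw [mollify_eq_convolution]
  exact hφ.supp.contDiff_convolution_left _ hφ.smooth hf.locallyIntegrable

lemma IsMoll.mollify_eq_zero (hφ : IsMoll δ φ) {f : ℂ → E} {z : ℂ}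
    (h : ∀ w, ‖w‖ < δ → f (z - w) = 0) : mollify φ f z = 0 := by
  rw [mollify, ← integral_zero ℂ E]
  congr 1
  funext w
  by_cases hw : ‖w‖ < δ
  · rw [h w hw, smul_zero]
  · rw [hφ.supp w (not_lt.1 hw), zero_smul]

lemma IsMoll.mollify_sub_const (hφ : IsMoll δ φ) [CompleteSpace E] {f : ℂ → E} (hf : Integrable f)
    (z : ℂ) (b : E) : mollify φ f z - b = ∫ w, φ w • (f (z - w) - b) := by
  simp only [smul_sub]
  rw [integral_sub (hφ.test.integrable_smul_sub hf z) (hφ.test.integrable.smul_const b),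
    integral_smul_const, hφ.integral, one_smul, mollify]

lemma ae_im_ne (c : ℝ) : ∀ᵐ w : ℂ, w.im ≠ c := by
  have hne : ∀ᵐ y : ℝ, y ≠ c := by simp [ae_iff]
  have h := Complex.volume_preserving_equiv_real_prod
  rw [Measure.volume_eq_prod] at h
  exact (Measure.quasiMeasurePreserving_snd.comp h.quasiMeasurePreserving).ae hne

lemma fderiv_mollify [CompleteSpace E] (hφ : IsTest φ) {v : ℂ → E} (hv : Continuous v)
    (hs : HasCompactSupport v) {c : ℝ} (hd : ∀ z : ℂ, z.im ≠ c → DifferentiableAt ℝ v z) {e : ℂ}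
    (he : e = 1 ∨ e = Complex.I) (hi : Integrable fun z => fderiv ℝ v z e) (z : ℂ) :
    fderiv ℝ (mollify φ v) z e = mollify φ (fun x => fderiv ℝ v x e) z := by
  have hvi : Integrable v := hv.integrable_of_hasCompactSupport hs
  have h1 := hφ.supp.hasFDerivAt_convolution_left (ContinuousLinearMap.lsmul ℝ ℝ : ℝ →L[ℝ] E →L[ℝ] E)
    (hφ.smooth.of_le (by exact_mod_cast le_top)) hvi.locallyIntegrable z
  have hinteg := (hφ.supp.fderiv ℝ).convolutionExists_left
    ((ContinuousLinearMap.lsmul ℝ ℝ : ℝ →L[ℝ] E →L[ℝ] E).precompL ℂ)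
    (hφ.smooth.continuous_fderiv (by simp)) hvi.locallyIntegrable z
  rw [mollify_eq_convolution, h1.fderiv, convolution_def,
    ContinuousLinearMap.integral_apply hinteg]
  simp only [ContinuousLinearMap.precompL_apply, ContinuousLinearMap.lsmul_apply]
  have hφe := hφ.fderiv_apply e
  have i1 := hφe.integrable_smul_sub hvi z
  have i2 := hφ.integrable_smul_sub hi z
  have hG : Continuous fun w => φ w • v (z - w) := hφ.smooth.continuous.smul (by fun_prop)
  have hfd : ∀ w : ℂ, w.im ≠ z.im - c → HasFDerivAt (fun w => φ w • v (z - w))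
      (φ w • ((fderiv ℝ v (z - w)).comp (-ContinuousLinearMap.id ℝ ℂ)) +
        (fderiv ℝ φ w).smulRight (v (z - w))) w := by
    intro w hw
    have hv' := (hd (z - w) (by rw [Complex.sub_im]; intro h; apply hw; linarith)).hasFDerivAt
    have hφ' := ((hφ.smooth.differentiable (by simp)) w).hasFDerivAt
    have hsub : HasFDerivAt (fun w => z - w) (-ContinuousLinearMap.id ℝ ℂ) w :=
      (hasFDerivAt_id w).const_sub z
    exact hφ'.smul (hv'.comp w hsub)
  have hline := ae_im_ne (z.im - c)
  have hae : (fun w => fderiv ℝ (fun w => φ w • v (z - w)) w e) =ᵐ[volume]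
      fun w => fderiv ℝ φ w e • v (z - w) - φ w • fderiv ℝ v (z - w) e := by
    filter_upwards [hline] with w hw
    rw [(hfd w hw).fderiv]
    simp [sub_eq_add_neg, add_comm]
  have h0 := integral_fderiv_eq_zero_off_line (c := z.im - c) hG
    (hφ.supp.smul_right) (fun w hw => (hfd w hw).differentiableAt) he
    ((i1.sub i2).congr hae.symm)
  rw [integral_congr_ae hae, integral_sub i1 i2, sub_eq_zero] at h0
  exact h0

lemma IsMoll.eLpNorm_integral_clm_le (hφ : IsMoll δ φ) {G : Type*} [NormedAddCommGroup G]
    [NormedSpace ℝ G] {P : ℂ → ℂ → (E →L[ℝ] G)} {f : ℂ → E} {ε : ℝ}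
    (hf : Measurable fun z => ‖f z‖ₑ) (h : ∀ z w, ‖w‖ < δ → ‖P z w‖ ≤ ε) :
    eLpNorm (fun z => ∫ w, φ w • P z w (f (z - w))) 2 volume ≤
      ENNReal.ofReal ε * eLpNorm f 2 volume := by
  have hk : Measurable fun w => ENNReal.ofReal ε * ‖φ w‖ₑ :=
    measurable_const.mul hφ.test.smooth.continuous.measurable.enorm
  have hone : ∫⁻ w, ENNReal.ofReal ε * ‖φ w‖ₑ = ENNReal.ofReal ε := by
    rw [lintegral_const_mul _ hφ.test.smooth.continuous.measurable.enorm,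
      ← ofReal_integral_norm_eq_lintegral_enorm hφ.test.integrable]
    simp_rw [Real.norm_of_nonneg (hφ.nonneg _)]
    rw [hφ.integral, ENNReal.ofReal_one, mul_one]
  have := eLpNorm_restrict_le_of_conv (f := fun z => ∫ w, φ w • P z w (f (z - w))) hk hf
    MeasurableSet.univ fun z _ => ?_
  · rwa [hone, Measure.restrict_univ] at this
  · refine (enorm_integral_le_lintegral_enorm _).trans (lintegral_mono fun w => ?_)
    rw [enorm_smul]
    by_cases hw : ‖w‖ < δ
    · rw [mul_comm (ENNReal.ofReal ε), mul_assoc]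
      refine mul_le_mul' le_rfl ?_
      rw [← ofReal_norm (P z w (f (z - w))), ← ofReal_norm (f (z - w)),
        ← ENNReal.ofReal_mul ((norm_nonneg _).trans (h z w hw))]
      exact ENNReal.ofReal_le_ofReal ((P z w).le_of_opNorm_le (h z w hw) _)
    · simp [hφ.supp w (not_lt.1 hw)]

end Mollifier

lemma continuousOn_of_holder {F : Type*} [NormedAddCommGroup F] {f : ℂ → F} {s : Set ℂ} {H α : ℝ}
    (h0 : 0 < α) (hf : ∀ x ∈ s, ∀ z ∈ s, ‖f x - f z‖ ≤ H * ‖x - z‖ ^ α) : ContinuousOn f s := by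
  intro z hz
  rw [ContinuousWithinAt, tendsto_iff_norm_sub_tendsto_zero]
  have h2 : Filter.Tendsto (fun x => H * ‖x - z‖ ^ α) (nhdsWithin z s)
      (nhds (H * ‖z - z‖ ^ α)) := by
    have : ContinuousAt (fun x => H * ‖x - z‖ ^ α) z :=
      continuousAt_const.mul (ContinuousAt.rpow_const (by fun_prop) (Or.inr h0.le))
    exact this.mono_left nhdsWithin_le_nhds
  refine squeeze_zero' (Filter.Eventually.of_forall fun _ => norm_nonneg _) ?_
    (by simpa [Real.zero_rpow h0.ne'] using h2)
  filter_upwards [self_mem_nhdsWithin] with x hx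
  exact hf x hx z hz

section System

variable {n : ℕ}

/-- Hölder continuous coefficients supported in a disk. -/
structure IsRoughCoef (α κ : ℝ) (Q : ℂ → ((Fin n → ℂ) →L[ℝ] (Fin n → ℂ))) : Prop where
  supp : ∀ z, 11 / 4 < ‖z‖ → Q z = 0
  bound : ∀ z, ‖Q z‖ ≤ κ
  holder : ∀ z z', ‖Q z - Q z'‖ ≤ κ * ‖z - z'‖ ^ α

variable {α κ δ : ℝ} {φ : ℂ → ℝ} {Q R : ℂ → ((Fin n → ℂ) →L[ℝ] (Fin n → ℂ))}

lemma IsRoughCoef.nonneg (hQ : IsRoughCoef α κ Q) : 0 ≤ κ := (norm_nonneg _).trans (hQ.bound 0)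

lemma IsRoughCoef.continuous (hQ : IsRoughCoef α κ Q) (h0 : 0 < α) : Continuous Q :=
  continuousOn_univ.1 (continuousOn_of_holder h0 fun z _ z' _ => hQ.holder z z')

lemma IsRoughCoef.integrable (hQ : IsRoughCoef α κ Q) (h0 : 0 < α) : Integrable Q :=
  (hQ.continuous h0).integrable_of_hasCompactSupport
    (HasCompactSupport.intro (isCompact_closedBall 0 (11 / 4)) fun z hz =>
      hQ.supp z (by simpa using hz))

lemma IsRoughCoef.isCoef_mollify (hQ : IsRoughCoef α κ Q) (h0 : 0 < α) (hφ : IsMoll δ φ)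
    (hδ : δ ≤ 1 / 4) : IsCoef α κ (mollify φ Q) where
  smooth := mollify_contDiff hφ.test (hQ.integrable h0)
  supp z hz := hφ.mollify_eq_zero fun w hw => hQ.supp _ (by
    have := norm_sub_norm_le z w
    linarith)
  bound z := hφ.norm_integral_le fun w _ => hQ.bound _
  holder z z' := by
    have hi := hQ.integrable h0
    rw [mollify, mollify, ← integral_sub (hφ.test.integrable_smul_sub hi z)
      (hφ.test.integrable_smul_sub hi z')]
    simp only [← smul_sub]
    refine hφ.norm_integral_le fun w _ => (hQ.holder _ _).trans_eq ?_
    rw [sub_sub_sub_cancel_right]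

lemma IsRoughCoef.norm_sub_mollify_le (hQ : IsRoughCoef α κ Q) (h0 : 0 < α) (hφ : IsMoll δ φ)
    {z w : ℂ} (hw : ‖w‖ < δ) : ‖Q (z - w) - mollify φ Q z‖ ≤ κ * (2 * δ) ^ α := by
  rw [norm_sub_rev, hφ.mollify_sub_const (hQ.integrable h0)]
  refine hφ.norm_integral_le fun w' hw' => (hQ.holder _ _).trans ?_
  refine mul_le_mul_of_nonneg_left (Real.rpow_le_rpow (norm_nonneg _) ?_ h0.le) hQ.nonneg
  rw [sub_sub_sub_cancel_left]
  linarith [norm_sub_le w w']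

lemma IsRoughCoef.integrable_apply (hQ : IsRoughCoef α κ Q) (h0 : 0 < α) {f : ℂ → Fin n → ℂ}
    (hf : Integrable f) : Integrable fun z => Q z (f z) := by
  refine Integrable.mono' (hf.norm.const_mul κ) ?_
    (Filter.Eventually.of_forall fun z => (Q z).le_of_opNorm_le (hQ.bound z) _)
  exact isBoundedBilinearMap_apply.continuous.comp_aestronglyMeasurable
    ((hQ.continuous h0).aestronglyMeasurable.prodMk hf.1)

lemma IsRoughCoef.eLpNorm_commutator_le (hQ : IsRoughCoef α κ Q) (h0 : 0 < α) (hφ : IsMoll δ φ)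
    {f : ℂ → Fin n → ℂ} (hf : Integrable f) (hfm : Measurable f) :
    eLpNorm (fun z => mollify φ (fun x => Q x (f x)) z - mollify φ Q z (mollify φ f z)) 2 volume ≤
      ENNReal.ofReal (κ * (2 * δ) ^ α) * eLpNorm f 2 volume := by
  have e : (fun z => mollify φ (fun x => Q x (f x)) z - mollify φ Q z (mollify φ f z)) =
      fun z => ∫ w, φ w • (Q (z - w) - mollify φ Q z) (f (z - w)) := by
    funext z
    have i1 := hφ.test.integrable_smul_sub (hQ.integrable_apply h0 hf) z
    have i2 := hφ.test.integrable_smul_sub hf z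
    simp only [_root_.sub_apply, smul_sub]
    rw [mollify, mollify.eq_def φ f, ← ContinuousLinearMap.integral_comp_comm _ i2]
    simp only [map_smul]
    rw [integral_sub i1]
    simpa only [map_smul] using (mollify φ Q z).integrable_comp i2
  rw [e]
  exact hφ.eLpNorm_integral_clm_le hfm.enorm fun z w hw => hQ.norm_sub_mollify_le h0 hφ hw

end System

section Regularity

variable {n : ℕ}

/-- A compactly supported finite energy solution `v`, regular off a horizontal line, of the
inhomogeneous first order system `∂̄v = Q ∂_y v + R v + g`. -/
structure IsSolution (α κ M c : ℝ) (Q R : ℂ → ((Fin n → ℂ) →L[ℝ] (Fin n → ℂ)))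
    (g v : ℂ → Fin n → ℂ) : Prop where
  coefQ : IsRoughCoef α κ Q
  coefR : IsRoughCoef α κ R
  cont : Continuous v
  supp : ∀ z, 2 < ‖z‖ → v z = 0
  diff : ∀ z : ℂ, z.im ≠ c → DifferentiableAt ℝ v z
  energy : Integrable fun z => ‖fderiv ℝ v z 1‖ ^ 2 + ‖fderiv ℝ v z Complex.I‖ ^ 2
  contg : Continuous g
  suppg : ∀ z, 2 < ‖z‖ → g z = 0
  suppg' : ∀ z, ‖z‖ < 3 / 2 → g z = 0
  boundg : ∀ z, ‖g z‖ ≤ M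
  eqn : ∀ z : ℂ, z.im ≠ c → dbar v z = Q z (fderiv ℝ v z Complex.I) + R z (v z) + g z

variable {α κ M c : ℝ} {Q R : ℂ → ((Fin n → ℂ) →L[ℝ] (Fin n → ℂ))} {g v : ℂ → Fin n → ℂ}

lemma IsSolution.hasCompactSupport (h : IsSolution α κ M c Q R g v) : HasCompactSupport v :=
  HasCompactSupport.intro (isCompact_closedBall 0 2) fun z hz => h.supp z (by simpa using hz)

lemma IsSolution.hasCompactSupport_rhs (h : IsSolution α κ M c Q R g v) : HasCompactSupport g :=
  HasCompactSupport.intro (isCompact_closedBall 0 2) fun z hz => h.suppg z (by simpa using hz)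

lemma IsSolution.memLp_fderiv (h : IsSolution α κ M c Q R g v) {e : ℂ}
    (he : e = 1 ∨ e = Complex.I) : MemLp (fun z => fderiv ℝ v z e) 2 := by
  have hm := measurable_fderiv_apply_const ℝ v e
  refine (memLp_two_iff_integrable_sq_norm hm.aestronglyMeasurable).2 ?_
  refine h.energy.mono' (hm.norm.pow_const 2).aestronglyMeasurable
    (Filter.Eventually.of_forall fun z => ?_)
  rw [Real.norm_of_nonneg (by positivity)]
  rcases he with rfl | rfl
  · exact le_add_of_nonneg_right (by positivity)
  · exact le_add_of_nonneg_left (by positivity)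

lemma IsSolution.integrable_fderiv (h : IsSolution α κ M c Q R g v) {e : ℂ}
    (he : e = 1 ∨ e = Complex.I) : Integrable fun z => fderiv ℝ v z e := by
  have hm := h.memLp_fderiv he
  have hs : Function.support (fun z => fderiv ℝ v z e) ⊆ Metric.closedBall 0 2 := by
    intro z hz
    have h1 : z ∈ tsupport v := support_fderiv_subset ℝ (fun hc => hz (by simp [hc]))
    refine closure_minimal (fun x hx => ?_) Metric.isClosed_closedBall h1
    by_contra hc
    exact hx (h.supp x (by simpa using hc))
  have hfin : IsFiniteMeasure (volume.restrict (Metric.closedBall (0:ℂ) 2)) :=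
    ⟨by rw [Measure.restrict_apply_univ]; exact measure_closedBall_lt_top⟩
  exact (integrableOn_iff_integrable_of_support_subset hs).1
    ((hm.restrict (Metric.closedBall (0:ℂ) 2)).integrable (by norm_num))

lemma IsSolution.dbar_mollify (h : IsSolution α κ M c Q R g v) (h0 : 0 < α) {δ : ℝ} {φ : ℂ → ℝ}
    (hφ : IsMoll δ φ) (z : ℂ) : dbar (mollify φ v) z =
      mollify φ (fun x => Q x (fderiv ℝ v x Complex.I)) z + mollify φ (fun x => R x (v x)) z +
        mollify φ g z := by
  have hv : Integrable v := h.cont.integrable_of_hasCompactSupport h.hasCompactSupport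
  have i1 := h.integrable_fderiv (Or.inl rfl)
  have i2 := h.integrable_fderiv (Or.inr rfl)
  have k1 := hφ.test.integrable_smul_sub i1 z
  have k2 := hφ.test.integrable_smul_sub
    (f := fun z => Complex.I • fderiv ℝ v z Complex.I) (i2.smul Complex.I) z
  have k3 := hφ.test.integrable_smul_sub (h.coefQ.integrable_apply h0 i2) z
  have k4 := hφ.test.integrable_smul_sub (h.coefR.integrable_apply h0 hv) z
  have k5 := hφ.test.integrable_smul_sub
    (h.contg.integrable_of_hasCompactSupport h.hasCompactSupport_rhs) z
  have k34 : Integrable fun w => φ w • Q (z - w) (fderiv ℝ v (z - w) Complex.I) +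
      φ w • R (z - w) (v (z - w)) := k3.add k4
  rw [dbar, fderiv_mollify hφ.test h.cont h.hasCompactSupport h.diff (Or.inl rfl) i1,
    fderiv_mollify hφ.test h.cont h.hasCompactSupport h.diff (Or.inr rfl) i2]
  have e : Complex.I • mollify φ (fun x => fderiv ℝ v x Complex.I) z =
      ∫ w, φ w • (Complex.I • fderiv ℝ v (z - w) Complex.I) := by
    rw [mollify, ← integral_smul]
    simp_rw [smul_comm Complex.I]
  rw [e, mollify, ← integral_add k1 k2, ← integral_smul, mollify, mollify, mollify,
    ← integral_add k3 k4, ← integral_add k34 k5]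
  refine integral_congr_ae ?_
  filter_upwards [ae_im_ne (z.im - c)] with w hw
  have := h.eqn (z - w) (by rw [Complex.sub_im]; intro h; apply hw; linarith)
  rw [← smul_add, ← smul_add, ← smul_add, ← this, dbar, smul_comm]

lemma IsSolution.isTest_mollify (h : IsSolution α κ M c Q R g v) {δ : ℝ} {φ : ℂ → ℝ}
    (hφ : IsMoll δ φ) : IsTest (mollify φ v) := by
  refine ⟨mollify_contDiff hφ.test (h.cont.integrable_of_hasCompactSupport h.hasCompactSupport), ?_⟩
  refine HasCompactSupport.intro (isCompact_closedBall 0 (2 + δ)) fun z hz => ?_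
  refine hφ.mollify_eq_zero fun w hw => h.supp _ ?_
  have := norm_sub_norm_le z w
  simp only [mem_closedBall_zero_iff, not_le] at hz
  linarith

lemma IsSolution.eLpNorm_residual_le (h : IsSolution α κ M c Q R g v) (h0 : 0 < α) {δ : ℝ}
    {φ : ℂ → ℝ} (hφ : IsMoll δ φ) :
    eLpNorm (fun z => dbar (mollify φ v) z -
      perturb (mollify φ Q) (mollify φ R) (dbar (mollify φ v)) z - mollify φ g z) 2 volume ≤
      ENNReal.ofReal (κ * (2 * δ) ^ α) * (eLpNorm (fun z => fderiv ℝ v z Complex.I) 2 volume +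
        eLpNorm v 2 volume) := by
  have hv : Integrable v := h.cont.integrable_of_hasCompactSupport h.hasCompactSupport
  have i2 := h.integrable_fderiv (Or.inr rfl)
  have e : cauchyT (dbar (mollify φ v)) = mollify φ v := funext (cauchyT_dbar (h.isTest_mollify hφ))
  have e2 : (fun z => dbar (mollify φ v) z -
      perturb (mollify φ Q) (mollify φ R) (dbar (mollify φ v)) z - mollify φ g z) =
      (fun z => mollify φ (fun x => Q x (fderiv ℝ v x Complex.I)) z -
        mollify φ Q z (mollify φ (fun x => fderiv ℝ v x Complex.I) z)) +
      (fun z => mollify φ (fun x => R x (v x)) z - mollify φ R z (mollify φ v z)) := by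
    funext z
    simp only [Pi.add_apply]
    rw [perturb, e, h.dbar_mollify h0 hφ, fderiv_mollify hφ.test h.cont h.hasCompactSupport h.diff
      (Or.inr rfl) i2]
    abel
  have hsm : ∀ {P : ℂ → ((Fin n → ℂ) →L[ℝ] (Fin n → ℂ))} {f : ℂ → Fin n → ℂ},
      IsRoughCoef α κ P → Integrable f → AEStronglyMeasurable
        (fun z => mollify φ (fun x => P x (f x)) z - mollify φ P z (mollify φ f z)) volume :=
    fun hP hf => ((mollify_contDiff hφ.test (hP.integrable_apply h0 hf)).sub
      ((mollify_contDiff hφ.test (hP.integrable h0)).clm_apply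
        (mollify_contDiff hφ.test hf))).continuous.aestronglyMeasurable
  rw [e2, mul_add]
  refine (eLpNorm_add_le (hsm h.coefQ i2) (hsm h.coefR hv) (by norm_num)).trans (add_le_add ?_ ?_)
  · exact h.coefQ.eLpNorm_commutator_le h0 hφ i2 (measurable_fderiv_apply_const ℝ v _)
  · exact h.coefR.eLpNorm_commutator_le h0 hφ hv h.cont.measurable

lemma eLpNorm_le_of_norm_le {f : ℂ → Fin n → ℂ} {r ε : ℝ} (hr : r ≤ 3) {s : Set ℂ}
    (hs : s ⊆ Metric.closedBall 0 r) (hf : ∀ z ∈ s, ‖f z‖ ≤ ε) (hms : MeasurableSet s)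
    (hε : 0 ≤ ε) : eLpNorm f 2 (volume.restrict s) ≤ ENNReal.ofReal (6 * ε) := by
  refine (eLpNorm_le_of_ae_bound ((ae_restrict_iff' hms).2 (Filter.Eventually.of_forall hf))).trans ?_
  rw [mul_comm 6 ε, ENNReal.ofReal_mul hε, mul_comm, Measure.restrict_apply_univ]
  refine mul_le_mul' le_rfl ?_
  have hvol : volume s ≤ ENNReal.ofReal 36 := by
    refine (measure_mono (hs.trans (Metric.closedBall_subset_closedBall hr))).trans ?_
    have : (NNReal.pi : ENNReal) = ENNReal.ofReal Real.pi := by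
      rw [← NNReal.coe_real_pi, ENNReal.ofReal_coe_nnreal]
    rw [Complex.volume_closedBall, this, ← ENNReal.ofReal_pow (by norm_num),
      ← ENNReal.ofReal_mul (by norm_num)]
    exact ENNReal.ofReal_le_ofReal (by nlinarith [Real.pi_le_four])
  refine (ENNReal.rpow_le_rpow hvol (by norm_num)).trans_eq ?_
  rw [ENNReal.ofReal_rpow_of_pos (by norm_num)]
  congr 1
  rw [show (36:ℝ) = 6 ^ (2:ℝ) by norm_num, ← Real.rpow_mul (by norm_num)]
  norm_num

lemma IsSolution.isAdm_mollify (h : IsSolution α κ M c Q R g v) {δ : ℝ}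
    (hδ : δ ≤ 1 / 4) {φ : ℂ → ℝ} (hφ : IsMoll δ φ) : IsAdm α (6 * M) (mollify φ g) := by
  have hM : 0 ≤ M := (norm_nonneg _).trans (h.boundg 0)
  have h3 : ∀ z, 3 < ‖z‖ → mollify φ g z = 0 := fun z hz =>
    hφ.mollify_eq_zero fun w hw => h.suppg _ (by linarith [norm_sub_norm_le z w])
  have hs : Function.support (mollify φ g) ⊆ Metric.closedBall 0 3 := fun z hz => by
    by_contra hc
    exact hz (h3 z (by simpa using hc))
  refine ⟨⟨mollify_contDiff hφ.test (h.contg.integrable_of_hasCompactSupport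
    h.hasCompactSupport_rhs), HasCompactSupport.intro (isCompact_closedBall 0 3) fun z hz =>
      h3 z (by simpa using hz)⟩, h3, innerBd_of_eq_zero (fun z hz => ?_) (by positivity), ?_⟩
  · exact hφ.mollify_eq_zero fun w hw => h.suppg' _ (by linarith [norm_sub_le z w])
  · rw [← eLpNorm_restrict_eq_of_support_subset hs]
    exact eLpNorm_le_of_norm_le le_rfl le_rfl
      (fun z _ => hφ.norm_integral_le fun w _ => h.boundg _) measurableSet_closedBall hM

/-- Interior `C^{1,α}` regularity for compactly supported solutions with small coefficients. -/
lemma exists_innerBd_fderiv_of_isSolution (n : ℕ) {α : ℝ} (h0 : 0 < α) (h1 : α < 1) :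
    ∃ κ : ℝ, 0 < κ ∧ ∃ C : ℝ, 0 < C ∧ ∀ (M c : ℝ) (Q R : ℂ → ((Fin n → ℂ) →L[ℝ] (Fin n → ℂ)))
      (g v : ℂ → Fin n → ℂ), IsSolution α κ M c Q R g v →
      ∃ D : ℂ → (ℂ →L[ℝ] (Fin n → ℂ)), InnerBd α D (C * M) ∧
        ∀ z, ‖z‖ < 1 → HasFDerivAt v (D z) z := by
  obtain ⟨κ, hκ, hadm⟩ := exists_adm_near n h0 h1
  obtain ⟨K, hK, hI⟩ := exists_innerBd_cauchyT (Fin n → ℂ) h0 h1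
  refine ⟨κ, hκ, K * 72, by positivity, fun M c Q R g v h => ?_⟩
  have hM : 0 ≤ M := (norm_nonneg _).trans (h.boundg 0)
  refine exists_hasFDerivAt_of_approx h0 h.cont fun ε hε => ?_
  set s := (eLpNorm (fun z => fderiv ℝ v z Complex.I) 2 volume + eLpNorm v 2 volume).toReal with hs
  have hsS : eLpNorm (fun z => fderiv ℝ v z Complex.I) 2 volume + eLpNorm v 2 volume =
      ENNReal.ofReal s := by
    rw [hs, ENNReal.ofReal_toReal]
    exact ENNReal.add_ne_top.2 ⟨(h.memLp_fderiv (Or.inr rfl)).2.ne,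
      (h.cont.memLp_of_hasCompactSupport h.hasCompactSupport).2.ne⟩
  set ε₁ := ε / (96 * Real.pi) with hε₁
  have hε₁0 : 0 < ε₁ := by positivity
  obtain ⟨δ₀, hδ₀, huc⟩ := Metric.uniformContinuous_iff.1
    (h.hasCompactSupport.uniformContinuous_of_continuous h.cont) (ε / 12) (by positivity)
  have lim : Filter.Tendsto (fun δ : ℝ => κ * (2 * δ) ^ α * s) (nhdsWithin 0 (Set.Ioi 0))
      (nhds 0) := by
    have hc : ContinuousAt (fun δ : ℝ => κ * (2 * δ) ^ α * s) 0 :=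
      (continuousAt_const.mul (ContinuousAt.rpow_const (by fun_prop) (Or.inr h0.le))).mul
        continuousAt_const
    have h2 : Filter.Tendsto (fun δ : ℝ => κ * (2 * δ) ^ α * s) (nhds 0)
      (nhds (κ * (2 * 0) ^ α * s)) := hc
    simp only [mul_zero, Real.zero_rpow h0.ne', zero_mul] at h2
    exact h2.mono_left nhdsWithin_le_nhds
  obtain ⟨δ, ⟨hδ1, hδ2⟩, hδpos⟩ := ((lim.eventually (gt_mem_nhds hε₁0)).and
    (nhdsWithin_le_nhds (gt_mem_nhds (lt_min hδ₀ (by norm_num : (0:ℝ) < 1 / 4))))).and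
    self_mem_nhdsWithin |>.exists
  replace hδpos : 0 < δ := hδpos
  have hδ3 : δ ≤ 1 / 4 := (hδ2.trans_le (min_le_right _ _)).le
  obtain ⟨φ, hφ⟩ := exists_isMoll hδpos
  have ht := h.isTest_mollify hφ
  have hh3 : ∀ z, 3 < ‖z‖ → dbar (mollify φ v) z = 0 := fun z hz => by
    have : fderiv ℝ (mollify φ v) z = 0 := by
      have hev : mollify φ v =ᶠ[nhds z] fun _ => 0 := by
        filter_upwards [(isOpen_lt continuous_const continuous_norm).mem_nhds hz] with x hx
        exact hφ.mollify_eq_zero fun w hw => h.supp _ (by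
          have : 3 < ‖x‖ := hx
          linarith [norm_sub_norm_le x w])
      rw [hev.fderiv_eq]; simp
    simp [dbar, this]
  obtain ⟨F, hF, hFe⟩ := hadm (mollify φ Q) (mollify φ R) (mollify φ g) (dbar (mollify φ v))
    (6 * M) ε₁ (h.coefQ.isCoef_mollify h0 hφ hδ3) (h.coefR.isCoef_mollify h0 hφ hδ3)
    (h.isAdm_mollify hδ3 hφ) ht.dbar hh3 hε₁0 (by
      refine (h.eLpNorm_residual_le h0 hφ).trans ?_
      rw [hsS, ← ENNReal.ofReal_mul (by positivity)]
      exact ENNReal.ofReal_le_ofReal hδ1.le)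
  have hFi := integral_norm_le_of_eLpNorm_two hF.test hF.supp (by positivity) hF.l2
  obtain ⟨b1, b2, b3⟩ := hI F hF.test (72 * M) (hF.inner.mono (by linarith)) (hFi.trans_eq (by ring))
  rw [← mul_assoc] at b1 b2 b3
  refine ⟨cauchyT F, fderiv ℝ (cauchyT F), (cauchyT_contDiff hF.test.smooth hF.test.supp).continuous,
    b1, b2, b3, ?_⟩
  have hd : IsTest (fun z => dbar (mollify φ v) z - F z) :=
    ⟨ht.dbar.smooth.sub hF.test.smooth, ht.dbar.supp.sub hF.test.supp⟩
  have e : (fun z => cauchyT F z - v z) = (fun z => mollify φ v z - v z) -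
      cauchyT (fun z => dbar (mollify φ v) z - F z) := by
    funext z
    simp only [Pi.sub_apply]
    rw [cauchyT_sub ht.dbar hF.test, cauchyT_dbar ht]
    abel
  rw [e]
  refine (eLpNorm_sub_le (ht.smooth.continuous.sub h.cont).aestronglyMeasurable
    (cauchyT_contDiff hd.smooth hd.supp).continuous.aestronglyMeasurable (by norm_num)).trans ?_
  have p1 : eLpNorm (fun z => mollify φ v z - v z) 2 (volume.restrict (Metric.ball 0 1)) ≤
      ENNReal.ofReal (6 * (ε / 12)) := by
    refine eLpNorm_le_of_norm_le (r := 1) (by norm_num) Metric.ball_subset_closedBall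
      (fun z _ => ?_) measurableSet_ball (by positivity)
    rw [hφ.mollify_sub_const (h.cont.integrable_of_hasCompactSupport h.hasCompactSupport)]
    refine hφ.norm_integral_le fun w hw => ?_
    rw [← dist_eq_norm]
    refine (huc ?_).le
    rw [dist_eq_norm, sub_sub_cancel_left, norm_neg]
    exact hw.trans (hδ2.trans_le (min_le_left _ _))
  have p2 : eLpNorm (cauchyT fun z => dbar (mollify φ v) z - F z) 2
      (volume.restrict (Metric.ball 0 1)) ≤ ENNReal.ofReal (16 * Real.pi * (3 * ε₁)) := by
    refine (eLpNorm_mono_measure _ (Measure.restrict_mono (Metric.ball_subset_closedBall.trans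
      (Metric.closedBall_subset_closedBall (by norm_num : (1:ℝ) ≤ 4))) le_rfl)).trans ?_
    refine (eLpNorm_cauchyT_le hd fun z hz => by simp [hh3 z hz, hF.supp z hz]).trans ?_
    rw [ENNReal.ofReal_mul (p := 16 * Real.pi) (q := 3 * ε₁) (by positivity)]
    exact mul_le_mul' le_rfl hFe
  refine (add_le_add p1 p2).trans ?_
  rw [← ENNReal.ofReal_add (by positivity) (by positivity)]
  refine ENNReal.ofReal_le_ofReal (le_of_eq ?_)
  rw [hε₁]; field_simp; ring

end Regularity

section Cutoff

lemma exists_contDiffBump_bounds (χ : ContDiffBump (0:ℂ)) {α : ℝ} (h0 : 0 < α) (h1 : α < 1) :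
    ∃ L : ℝ, 0 < L ∧ (∀ z, ‖fderiv ℝ χ z‖ ≤ L) ∧
      ∀ z z', |χ z - χ z'| ≤ L * ‖z - z'‖ ^ α := by
  obtain ⟨K, hK⟩ := (χ.contDiff (n := 1)).lipschitzWith_of_hasCompactSupport χ.hasCompactSupport
    (by simp)
  refine ⟨K + 1, by positivity, fun z => (norm_fderiv_le_of_lipschitz ℝ hK).trans (by simp),
    fun z z' => ?_⟩
  have hK' : |χ z - χ z'| ≤ K * ‖z - z'‖ := by
    have := hK.dist_le_mul z z'
    rwa [Real.dist_eq, dist_eq_norm] at this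
  rcases le_total ‖z - z'‖ 1 with h | h
  · have h2 : ‖z - z'‖ ≤ ‖z - z'‖ ^ α := by
      simpa using Real.rpow_le_rpow_of_exponent_ge_of_imp (norm_nonneg (z - z')) h h1.le (by simp)
    have h3 : 0 ≤ ‖z - z'‖ ^ α := by positivity
    nlinarith [mul_le_mul_of_nonneg_left h2 K.2]
  · have h2 : 1 ≤ ‖z - z'‖ ^ α := Real.one_le_rpow h h0.le
    have h3 : |χ z - χ z'| ≤ 1 := by
      rw [abs_le]
      constructor <;> linarith [χ.nonneg (x := z), χ.nonneg (x := z'), χ.le_one (x := z),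
        χ.le_one (x := z')]
    nlinarith [K.2, mul_nonneg K.2 (zero_le_one.trans h2)]

lemma exists_holder_smul (F : Type*) [NormedAddCommGroup F] [NormedSpace ℝ F]
    (χ : ContDiffBump (0:ℂ)) (hχ : χ.rOut = 11 / 4) {α : ℝ} (h0 : 0 < α) (h1 : α < 1) :
    ∃ L : ℝ, 0 < L ∧ ∀ (κ : ℝ) (P : ℂ → F), (∀ z, ‖z‖ ≤ 4 → ‖P z‖ ≤ κ) →
      (∀ z z', ‖z‖ ≤ 4 → ‖z'‖ ≤ 4 → ‖P z - P z'‖ ≤ κ * ‖z - z'‖ ^ α) →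
      (∀ z, 11 / 4 < ‖z‖ → (-(2⁻¹ : ℝ)) • χ z • P z = 0) ∧
      (∀ z, ‖(-(2⁻¹ : ℝ)) • χ z • P z‖ ≤ L * κ) ∧
      ∀ z z', ‖(-(2⁻¹ : ℝ)) • χ z • P z - (-(2⁻¹ : ℝ)) • χ z' • P z'‖ ≤
        L * κ * ‖z - z'‖ ^ α := by
  obtain ⟨L, hL, -, hχL⟩ := exists_contDiffBump_bounds χ h0 h1
  have hz : ∀ z, 11 / 4 < ‖z‖ → χ z = 0 := fun z hz =>
    χ.zero_of_le_dist (by rw [hχ, dist_zero_right]; exact hz.le)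
  refine ⟨1 + L, by positivity, fun κ P hP hPh => ?_⟩
  have hκ : 0 ≤ κ := (norm_nonneg _).trans (hP 0 (by simp))
  have hb : ∀ z, ‖χ z • P z‖ ≤ κ := fun z => by
    rw [norm_smul, Real.norm_of_nonneg χ.nonneg]
    by_cases h : ‖z‖ ≤ 4
    · exact (mul_le_of_le_one_left (norm_nonneg _) χ.le_one).trans (hP z h)
    · rw [hz z (by linarith), zero_mul]
      exact hκ
  have half : ∀ A : F, ‖(-(2⁻¹ : ℝ)) • A‖ ≤ ‖A‖ := fun A => by
    rw [norm_smul]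
    norm_num
    linarith [norm_nonneg A]
  have far : ∀ z z', ¬ ‖z‖ ≤ 4 → ‖χ z • P z - χ z' • P z'‖ ≤ (1 + L) * κ * ‖z - z'‖ ^ α := by
    intro z z' h
    rw [hz z (by linarith), zero_smul, zero_sub, norm_neg]
    by_cases h' : 11 / 4 < ‖z'‖
    · rw [hz z' h', zero_smul, norm_zero]
      positivity
    · have h2 : 1 ≤ ‖z - z'‖ ^ α := Real.one_le_rpow (by linarith [norm_sub_norm_le z z']) h0.le
      have := hb z'
      nlinarith [mul_nonneg hL.le hκ, mul_nonneg (mul_nonneg hL.le hκ) (zero_le_one.trans h2)]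
  refine ⟨fun z h => by simp [hz z h], fun z => ?_, fun z z' => ?_⟩
  · nlinarith [(half _).trans (hb z)]
  · rw [← smul_sub]
    refine (half _).trans ?_
    by_cases h : ‖z‖ ≤ 4
    · by_cases h' : ‖z'‖ ≤ 4
      · have e : χ z • P z - χ z' • P z' = χ z • (P z - P z') + (χ z - χ z') • P z' := by
          rw [smul_sub, sub_smul]; abel
        rw [e]
        refine (norm_add_le _ _).trans ?_
        rw [norm_smul, norm_smul, Real.norm_of_nonneg χ.nonneg, Real.norm_eq_abs]
        have a1 := mul_le_mul χ.le_one (hPh z z' h h') (norm_nonneg _) zero_le_one (a := χ z)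
        have a2 := mul_le_mul (hχL z z') (hP z' h') (norm_nonneg _) (by positivity)
        linarith
      · rw [norm_sub_rev, norm_sub_rev z]
        exact far z' z h'
    · exact far z z' h

lemma exists_isRoughCoef_smul {n : ℕ} (χ : ContDiffBump (0:ℂ)) (hχ : χ.rOut = 11 / 4) {α : ℝ}
    (h0 : 0 < α) (h1 : α < 1) :
    ∃ L : ℝ, 0 < L ∧ ∀ (κ : ℝ) (P : ℂ → ((Fin n → ℂ) →L[ℝ] (Fin n → ℂ))),
      (∀ z, ‖z‖ ≤ 4 → ‖P z‖ ≤ κ) →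
      (∀ z z', ‖z‖ ≤ 4 → ‖z'‖ ≤ 4 → ‖P z - P z'‖ ≤ κ * ‖z - z'‖ ^ α) →
      IsRoughCoef α (L * κ) (fun z => (-(2⁻¹ : ℝ)) • χ z • P z) := by
  obtain ⟨L, hL, h⟩ := exists_holder_smul ((Fin n → ℂ) →L[ℝ] (Fin n → ℂ)) χ hχ h0 h1
  exact ⟨L, hL, fun κ P hP hP' => ⟨(h κ P hP hP').1, (h κ P hP hP').2.1, (h κ P hP hP').2.2⟩⟩

end Cutoff

section Localization

variable {n : ℕ}

/-- A bounded finite energy solution `U`, regular off a horizontal line, of the system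
`U_x + J U_y + a U = 0` on the disk of radius four, with `J` and `a` Hölder close to `Jstd n`
and `0`. -/
structure IsLocalSolution (α κ M c : ℝ) (J a : ℂ → ((Fin n → ℂ) →L[ℝ] (Fin n → ℂ)))
    (U : ℂ → Fin n → ℂ) : Prop where
  boundJ : ∀ z, ‖z‖ ≤ 4 → ‖J z - Jstd n‖ ≤ κ
  holderJ : ∀ z z', ‖z‖ ≤ 4 → ‖z'‖ ≤ 4 → ‖J z - J z'‖ ≤ κ * ‖z - z'‖ ^ α
  bounda : ∀ z, ‖z‖ ≤ 4 → ‖a z‖ ≤ κ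
  holdera : ∀ z z', ‖z‖ ≤ 4 → ‖z'‖ ≤ 4 → ‖a z - a z'‖ ≤ κ * ‖z - z'‖ ^ α
  cont : ContinuousOn U (Metric.ball 0 4)
  bound : ∀ z, ‖z‖ < 4 → ‖U z‖ ≤ M
  diff : ∀ z : ℂ, ‖z‖ < 4 → z.im ≠ c → DifferentiableAt ℝ U z
  eqn : ∀ z : ℂ, ‖z‖ < 4 → z.im ≠ c →
    fderiv ℝ U z 1 + J z (fderiv ℝ U z Complex.I) + a z (U z) = 0
  energy : IntegrableOn (fun z => ‖fderiv ℝ U z 1‖ ^ 2 + ‖fderiv ℝ U z Complex.I‖ ^ 2)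
    (Metric.ball 0 4)

lemma Jstd_apply (v : Fin n → ℂ) : Jstd n v = Complex.I • v := rfl

lemma norm_Jstd_le : ‖Jstd n‖ ≤ 1 :=
  ContinuousLinearMap.opNorm_le_bound _ zero_le_one fun v => by simp [Jstd_apply, norm_smul]

variable {α κ κ' M c L : ℝ} {J a : ℂ → ((Fin n → ℂ) →L[ℝ] (Fin n → ℂ))} {U : ℂ → Fin n → ℂ}

lemma IsLocalSolution.continuousOn_J (h : IsLocalSolution α κ M c J a U) (h0 : 0 < α) :
    ContinuousOn J (Metric.ball 0 4) :=
  continuousOn_of_holder h0 fun z hz z' hz' => h.holderJ z z' (mem_ball_zero_iff.1 hz).le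
    (mem_ball_zero_iff.1 hz').le

lemma IsLocalSolution.isSolution (h : IsLocalSolution α κ M c J a U) (h0 : 0 < α)
    {χ χ' : ContDiffBump (0:ℂ)} (hi : χ.rIn = 3 / 2) (ho : χ.rOut = 2) (hi' : χ'.rIn = 5 / 2)
    (hL : ∀ z, ‖fderiv ℝ χ z‖ ≤ L)
    (hχ' : ∀ P : ℂ → ((Fin n → ℂ) →L[ℝ] (Fin n → ℂ)), (∀ z, ‖z‖ ≤ 4 → ‖P z‖ ≤ κ) →
      (∀ z z', ‖z‖ ≤ 4 → ‖z'‖ ≤ 4 → ‖P z - P z'‖ ≤ κ * ‖z - z'‖ ^ α) →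
      IsRoughCoef α κ' (fun z => (-(2⁻¹ : ℝ)) • χ' z • P z)) :
    IsSolution α κ' ((1 + κ) * L * M) c (fun z => (-(2⁻¹ : ℝ)) • χ' z • (J z - Jstd n))
      (fun z => (-(2⁻¹ : ℝ)) • χ' z • a z)
      (fun z => (2⁻¹ : ℝ) • (fderiv ℝ χ z 1 • U z + fderiv ℝ χ z Complex.I • J z (U z)))
      (fun z => χ z • U z) := by
  have hM : 0 ≤ M := (norm_nonneg _).trans (h.bound 0 (by simp))
  have hL0 : 0 ≤ L := (norm_nonneg _).trans (hL 0)
  have hκ : 0 ≤ κ := (norm_nonneg _).trans (h.bounda 0 (by simp))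
  have hsm : ContDiff ℝ ∞ χ := χ.contDiff
  have hχ : ∀ z : ℂ, DifferentiableAt ℝ χ z := hsm.differentiable (by simp)
  have z0 : ∀ z, 2 < ‖z‖ → χ z = 0 := fun z hz =>
    χ.zero_of_le_dist (by rw [ho, dist_zero_right]; exact hz.le)
  have z1 : ∀ z, 2 < ‖z‖ → fderiv ℝ χ z = 0 := fun z hz => by
    have : (χ : ℂ → ℝ) =ᶠ[nhds z] fun _ => 0 := by
      filter_upwards [(isOpen_lt continuous_const continuous_norm).mem_nhds hz] with x hx
      exact z0 x hx
    rw [this.fderiv_eq, fderiv_const_apply]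
  have z2 : ∀ z, ‖z‖ < 3 / 2 → fderiv ℝ χ z = 0 := fun z hz => by
    have : (χ : ℂ → ℝ) =ᶠ[nhds z] fun _ => 1 := by
      filter_upwards [(isOpen_lt continuous_norm continuous_const).mem_nhds hz] with x hx
      exact χ.one_of_mem_closedBall (by rw [hi]; simpa using (le_of_lt hx))
    rw [this.fderiv_eq, fderiv_const_apply]
  have z3 : ∀ z, 2 < ‖z‖ → (fun z => χ z • U z) =ᶠ[nhds z] fun _ => 0 := fun z hz => by
    filter_upwards [(isOpen_lt continuous_const continuous_norm).mem_nhds hz] with x hx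
    rw [z0 x hx, zero_smul]
  have hle : ∀ z (e : ℂ), ‖e‖ = 1 → ‖fderiv ℝ χ z e‖ ≤ L := fun z e he => by
    have := (fderiv ℝ χ z).le_opNorm e
    rw [he, mul_one] at this
    exact this.trans (hL z)
  have hts : ∀ {F : ℂ → Fin n → ℂ}, (∀ z, 2 < ‖z‖ → F z = 0) → tsupport F ⊆ Metric.ball 0 4 :=
    fun {F} hF => by
      refine (closure_minimal (t := Metric.closedBall 0 2) (fun z hz => ?_)
        Metric.isClosed_closedBall).trans (Metric.closedBall_subset_ball (by norm_num))
      by_contra hc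
      exact hz (hF z (by simpa using hc))
  have hfd : ∀ z : ℂ, ‖z‖ < 4 → z.im ≠ c → ∀ e, fderiv ℝ (fun z => χ z • U z) z e =
      χ z • fderiv ℝ U z e + fderiv ℝ χ z e • U z := fun z hz hc e => by
    rw [fderiv_fun_smul (hχ z) (h.diff z hz hc)]
    rfl
  have hcd : ∀ e : ℂ, Continuous fun z => fderiv ℝ χ z e := fun e =>
    (hsm.continuous_fderiv (by simp)).clm_apply continuous_const
  have hg0 : ∀ z, 2 < ‖z‖ → (2⁻¹ : ℝ) •
      (fderiv ℝ χ z 1 • U z + fderiv ℝ χ z Complex.I • J z (U z)) = 0 := fun z hz => by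
    simp [z1 z hz]
  refine ⟨hχ' _ h.boundJ fun z z' hz hz' => ?_, hχ' _ h.bounda h.holdera, ?_, fun z hz => ?_,
    fun z hz => ?_, ?_, ?_, hg0, fun z hz => ?_, fun z => ?_, fun z hz => ?_⟩
  · rw [sub_sub_sub_cancel_right]
    exact h.holderJ z z' hz hz'
  · exact (χ.continuous.continuousOn.smul h.cont).continuous_of_tsupport_subset
      Metric.isOpen_ball (hts fun z hz => by simp [z0 z hz])
  · simp [z0 z hz]
  · by_cases h4 : ‖z‖ < 4
    · exact (hχ z).smul (h.diff z h4 hz)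
    · exact (differentiableAt_const 0).congr_of_eventuallyEq (z3 z (by linarith))
  · have hm : ∀ e, Measurable fun z => fderiv ℝ (fun z => χ z • U z) z e := fun e =>
      measurable_fderiv_apply_const ℝ _ e
    refine (integrableOn_iff_integrable_of_support_subset (s := Metric.ball 0 4) fun z hz => ?_).1 ?_
    · by_contra hc
      have h4 : 4 ≤ ‖z‖ := by simpa using hc
      exact hz (by simp [(z3 z (by linarith)).fderiv_eq])
    · have hI : IntegrableOn (fun z => 2 * (‖fderiv ℝ U z 1‖ ^ 2 + ‖fderiv ℝ U z Complex.I‖ ^ 2) +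
          4 * (L * M) ^ 2) (Metric.ball 0 4) :=
        (h.energy.const_mul 2).add (integrableOn_const measure_ball_lt_top.ne)
      refine hI.mono' (((hm 1).norm.pow_const 2).add
        ((hm Complex.I).norm.pow_const 2)).aestronglyMeasurable ?_
      filter_upwards [ae_restrict_mem measurableSet_ball, ae_restrict_of_ae (ae_im_ne c)]
        with z hz hc
      have hz4 : ‖z‖ < 4 := by simpa using hz
      have key : ∀ e : ℂ, ‖e‖ = 1 → ‖fderiv ℝ (fun z => χ z • U z) z e‖ ^ 2 ≤
          2 * ‖fderiv ℝ U z e‖ ^ 2 + 2 * (L * M) ^ 2 := fun e he => by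
        have a1 : ‖fderiv ℝ (fun z => χ z • U z) z e‖ ≤ ‖fderiv ℝ U z e‖ + L * M := by
          rw [hfd z hz4 hc]
          refine (norm_add_le _ _).trans (add_le_add ?_ ?_)
          · rw [norm_smul, Real.norm_of_nonneg χ.nonneg]
            exact mul_le_of_le_one_left (norm_nonneg _) χ.le_one
          · rw [norm_smul]
            exact mul_le_mul (hle z e he) (h.bound z hz4) (norm_nonneg _) hL0
        have a2 := pow_le_pow_left₀ (norm_nonneg _) a1 2
        nlinarith [sq_nonneg (‖fderiv ℝ U z e‖ - L * M)]
      rw [Real.norm_of_nonneg (by positivity)]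
      linarith [key 1 (by simp), key Complex.I (by simp)]
  · refine ContinuousOn.continuous_of_tsupport_subset (s := Metric.ball 0 4) ?_
      Metric.isOpen_ball (hts hg0)
    exact (((hcd 1).continuousOn.smul h.cont).add ((hcd Complex.I).continuousOn.smul
      ((h.continuousOn_J h0).clm_apply h.cont))).const_smul (2⁻¹ : ℝ)
  · simp [z2 z hz]
  · by_cases h4 : ‖z‖ < 4
    · have b1 := h.bound z h4
      have b2 : ‖J z (U z)‖ ≤ (1 + κ) * M := by
        refine (ContinuousLinearMap.le_opNorm _ _).trans (mul_le_mul ?_ b1 (norm_nonneg _)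
          (by positivity))
        have := norm_add_le (Jstd n) (J z - Jstd n)
        rw [add_sub_cancel] at this
        linarith [h.boundJ z h4.le, norm_Jstd_le (n := n)]
      rw [norm_smul]
      have b3 := norm_add_le (fderiv ℝ χ z 1 • U z) (fderiv ℝ χ z Complex.I • J z (U z))
      rw [norm_smul, norm_smul] at b3
      have b4 := mul_le_mul (hle z 1 (by simp)) b1 (norm_nonneg _) hL0
      have b5 := mul_le_mul (hle z Complex.I (by simp)) b2 (norm_nonneg _) hL0
      rw [show ‖(2⁻¹ : ℝ)‖ = 2⁻¹ by norm_num]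
      nlinarith [mul_nonneg hκ (mul_nonneg hL0 hM)]
    · rw [hg0 z (by linarith), norm_zero]
      positivity
  · by_cases h4 : ‖z‖ ≤ 2
    · have h4' : ‖z‖ < 4 := by linarith
      have o : χ' z = 1 := χ'.one_of_mem_closedBall (by
        rw [hi']; simpa using h4.trans (by norm_num))
      have e := h.eqn z h4' hz
      rw [add_assoc, add_eq_zero_iff_eq_neg] at e
      rw [dbar, hfd z h4' hz, hfd z h4' hz, e, o]
      have hQ : ∀ w, ((-(2⁻¹ : ℝ)) • (1 : ℝ) • (J z - Jstd n)) w =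
          (-(2⁻¹ : ℝ)) • (1 : ℝ) • (J z w - Complex.I • w) := fun w => rfl
      have hR : ((-(2⁻¹ : ℝ)) • (1 : ℝ) • a z) (χ z • U z) =
          (-(2⁻¹ : ℝ)) • (1 : ℝ) • χ z • a z (U z) := by rw [← map_smul]; rfl
      rw [hQ, hR, map_add, map_smul, map_smul]
      ext i
      simp only [Pi.add_apply, Pi.sub_apply, Pi.smul_apply, Pi.neg_apply, Complex.real_smul,
        smul_eq_mul]
      push_cast
      ring
    · push Not at h4
      simp [dbar, (z3 z h4).fderiv_eq, z0 z h4, z1 z h4]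

/-- Interior `C^{1,α}` estimate for the system `U_x + J U_y + a U = 0`. -/
lemma exists_bound_of_isLocalSolution (n : ℕ) {α : ℝ} (h0 : 0 < α) (h1 : α < 1) :
    ∃ κ : ℝ, 0 < κ ∧ ∃ C : ℝ, 0 < C ∧ ∀ (M c : ℝ) (J a : ℂ → ((Fin n → ℂ) →L[ℝ] (Fin n → ℂ)))
      (U : ℂ → Fin n → ℂ), IsLocalSolution α κ M c J a U →
      ‖fderiv ℝ U 0‖ ≤ C * M ∧ ∀ s, ‖s‖ ≤ 1 / 2 → DifferentiableAt ℝ U s ∧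
        ‖fderiv ℝ U s - fderiv ℝ U 0‖ ≤ C * M * ‖s‖ ^ α := by
  obtain ⟨κ, hκ, C, hC, hsol⟩ := exists_innerBd_fderiv_of_isSolution n h0 h1
  let χ : ContDiffBump (0:ℂ) := ⟨3 / 2, 2, by norm_num, by norm_num⟩
  let χ' : ContDiffBump (0:ℂ) := ⟨5 / 2, 11 / 4, by norm_num, by norm_num⟩
  obtain ⟨L, hL, hχ, -⟩ := exists_contDiffBump_bounds χ h0 h1
  obtain ⟨L', hL', hχ'⟩ := exists_isRoughCoef_smul (n := n) χ' rfl h0 h1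
  refine ⟨κ / L', by positivity, C * ((1 + κ / L') * L), by positivity, fun M c J a U h => ?_⟩
  obtain ⟨D, hD, hd⟩ := hsol _ _ _ _ _ _ (h.isSolution (χ := χ) (χ' := χ') (κ' := κ) h0 rfl rfl rfl hχ
    fun P hP hP' => by
      have := hχ' _ P hP hP'
      rwa [mul_div_cancel₀ κ hL'.ne'] at this)
  have hU : ∀ s : ℂ, ‖s‖ < 1 → HasFDerivAt U (D s) s := fun s hs => by
    refine (hd s hs).congr_of_eventuallyEq ?_
    filter_upwards [(isOpen_lt continuous_norm continuous_const).mem_nhds hs] with x hx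
    have hx1 : ‖x‖ < 1 := hx
    rw [χ.one_of_mem_closedBall (mem_closedBall_zero_iff.2 (hx1.le.trans (by norm_num [χ]))),
      one_smul]
  have hD0 := hD 0 (by simp)
  simp only [norm_zero, sub_zero, one_pow, one_mul, zero_add, div_one] at hD0
  rw [(hU 0 (by simp)).fderiv]
  refine ⟨by linarith [hD0.1], fun s hs => ?_⟩
  have hs1 := hU s (by linarith)
  refine ⟨hs1.differentiableAt, ?_⟩
  rw [hs1.fderiv]
  exact (hD0.2 s hs).trans_eq (by ring)

end Localization

section Zoom

variable {n : ℕ}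

/-- A bounded finite energy solution `u`, regular off the real line, of the system
`u_x + J u_y + a u = 0` on the unit disk. -/
structure IsDiskSolution (α κ A M : ℝ) (J a : ℂ → ((Fin n → ℂ) →L[ℝ] (Fin n → ℂ)))
    (u : ℂ → Fin n → ℂ) : Prop where
  boundJ : ∀ z, ‖z‖ ≤ 1 → ‖J z - Jstd n‖ ≤ κ
  holderJ : ∀ z z', ‖z‖ ≤ 1 → ‖z'‖ ≤ 1 → ‖J z - J z'‖ ≤ κ * ‖z - z'‖ ^ α
  bounda : ∀ z, ‖z‖ ≤ 1 → ‖a z‖ ≤ A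
  holdera : ∀ z z', ‖z‖ ≤ 1 → ‖z'‖ ≤ 1 → ‖a z - a z'‖ ≤ A * ‖z - z'‖ ^ α
  cont : ContinuousOn u (Metric.ball 0 1)
  bound : ∀ z, ‖z‖ < 1 → ‖u z‖ ≤ M
  diff : ∀ z : ℂ, ‖z‖ < 1 → z.im ≠ 0 → DifferentiableAt ℝ u z
  eqn : ∀ z : ℂ, ‖z‖ < 1 → z.im ≠ 0 →
    fderiv ℝ u z 1 + J z (fderiv ℝ u z Complex.I) + a z (u z) = 0
  energy : IntegrableOn (fun z => ‖fderiv ℝ u z 1‖ ^ 2 + ‖fderiv ℝ u z Complex.I‖ ^ 2)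
    (Metric.ball 0 1)

lemma fderiv_comp_affine {E F : Type*} [NormedAddCommGroup E] [NormedSpace ℝ E]
    [NormedAddCommGroup F] [NormedSpace ℝ F] (f : E → F) (r : ℝ) (x₀ x : E) :
    fderiv ℝ (fun y => f (x₀ + r • y)) x = r • fderiv ℝ f (x₀ + r • x) := by
  rw [fderiv_comp_smul (f := fun y => f (x₀ + y)) r, fderiv_comp_add_left]

lemma fderiv_comp_affine_apply {E F : Type*} [NormedAddCommGroup E] [NormedSpace ℝ E]
    [NormedAddCommGroup F] [NormedSpace ℝ F] (f : E → F) (r : ℝ) (x₀ x e : E) :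
    fderiv ℝ (fun y => f (x₀ + r • y)) x e = r • fderiv ℝ f (x₀ + r • x) e := by
  rw [fderiv_comp_affine]; rfl

lemma norm_smul_le_of_nonneg {F : Type*} [NormedAddCommGroup F] [NormedSpace ℝ F] (r : ℝ)
    (hr : 0 ≤ r) (x : F) : ‖r • x‖ ≤ r * ‖x‖ := by
  rw [norm_smul, Real.norm_of_nonneg hr]

lemma norm_smul_sub_smul_le {F : Type*} [NormedAddCommGroup F] [NormedSpace ℝ F] (r : ℝ)
    (hr : 0 ≤ r) (x y : F) : ‖r • x - r • y‖ ≤ r * ‖x - y‖ := by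
  rw [← smul_sub, norm_smul, Real.norm_of_nonneg hr]

variable {α κ A M : ℝ} {J a : ℂ → ((Fin n → ℂ) →L[ℝ] (Fin n → ℂ))} {u : ℂ → Fin n → ℂ}

lemma IsDiskSolution.zoom (h : IsDiskSolution α κ A M J a u) (h0 : 0 < α) {r : ℝ} (hr : 0 < r)
    (hrA : r * A ≤ κ) {z₀ : ℂ} (hz₀ : ‖z₀‖ + 4 * r ≤ 1) :
    IsLocalSolution α κ M (-z₀.im / r) (fun z => J (z₀ + r • z)) (fun z => r • a (z₀ + r • z))
      (fun z => u (z₀ + r • z)) := by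
  have hκ : 0 ≤ κ := (norm_nonneg _).trans (h.boundJ 0 (by simp))
  have hn : ∀ z : ℂ, ‖z₀ + r • z‖ ≤ ‖z₀‖ + r * ‖z‖ := fun z => by
    refine (norm_add_le _ _).trans_eq ?_
    rw [norm_smul, Real.norm_of_nonneg hr.le]
  have hle : ∀ z : ℂ, ‖z‖ ≤ 4 → ‖z₀ + r • z‖ ≤ 1 := fun z hz => (hn z).trans (by nlinarith)
  have hlt : ∀ z : ℂ, ‖z‖ < 4 → ‖z₀ + r • z‖ < 1 := fun z hz => (hn z).trans_lt (by nlinarith)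
  have him : ∀ z : ℂ, z.im ≠ -z₀.im / r → (z₀ + r • z).im ≠ 0 := fun z hz hc => hz (by
    rw [Complex.add_im, Complex.smul_im, smul_eq_mul] at hc
    field_simp
    linarith)
  have hpow : ∀ z z' : ℂ, ‖z₀ + r • z - (z₀ + r • z')‖ ^ α ≤ ‖z - z'‖ ^ α := fun z z' => by
    have hr1 : r ≤ 1 := by linarith [norm_nonneg z₀]
    refine Real.rpow_le_rpow (norm_nonneg _) ?_ h0.le
    rw [add_sub_add_left_eq_sub]
    exact (norm_smul_sub_smul_le r hr.le z z').trans (mul_le_of_le_one_left (norm_nonneg _) hr1)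
  refine ⟨fun z hz => h.boundJ _ (hle z hz), fun z z' hz hz' => ?_, fun z hz => ?_,
    fun z z' hz hz' => ?_, ?_, fun z hz => h.bound _ (hlt z hz), fun z hz hc => ?_,
    fun z hz hc => ?_, ?_⟩
  · exact (h.holderJ _ _ (hle z hz) (hle z' hz')).trans (mul_le_mul_of_nonneg_left (hpow z z') hκ)
  · refine (norm_smul_le_of_nonneg r hr.le (a (z₀ + r • z))).trans ?_
    exact (mul_le_mul_of_nonneg_left (h.bounda _ (hle z hz)) hr.le).trans hrA
  · refine (norm_smul_sub_smul_le r hr.le _ _).trans ?_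
    refine (mul_le_mul_of_nonneg_left (h.holdera _ _ (hle z hz) (hle z' hz')) hr.le).trans ?_
    rw [← mul_assoc]
    exact mul_le_mul hrA (hpow z z') (by positivity) hκ
  · refine h.cont.comp (by fun_prop) fun z hz => ?_
    simpa using hlt z (by simpa using hz)
  · exact (h.diff _ (hlt z hz) (him z hc)).comp z (by fun_prop)
  · rw [fderiv_comp_affine_apply, fderiv_comp_affine_apply, map_smul]
    have e := congrArg (r • ·) (h.eqn _ (hlt z hz) (him z hc))
    simp only [smul_add, smul_zero] at e
    exact e
  · have h1 := (integrable_indicator_iff measurableSet_ball).2 h.energy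
    have h2 := ((h1.comp_add_left z₀).comp_smul hr.ne').const_mul (r ^ 2)
    refine h2.integrableOn.congr_fun (fun z hz => ?_) measurableSet_ball
    beta_reduce
    rw [Set.indicator_of_mem (by simpa using hlt z (by simpa using hz)), fderiv_comp_affine_apply,
      fderiv_comp_affine_apply, norm_smul, norm_smul, Real.norm_of_nonneg hr.le]
    ring

lemma exists_bound_of_isDiskSolution (n : ℕ) {α : ℝ} (h0 : 0 < α) (h1 : α < 1) {μ : ℝ} (hμ : μ < 1)
    {A : ℝ} (hA : 0 < A) :
    ∃ κ : ℝ, 0 < κ ∧ ∃ C : ℝ, 0 < C ∧ ∀ (M : ℝ) (J a : ℂ → ((Fin n → ℂ) →L[ℝ] (Fin n → ℂ)))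
      (u : ℂ → Fin n → ℂ), IsDiskSolution α κ A M J a u →
      (∀ z, ‖z‖ ≤ μ → DifferentiableAt ℝ u z ∧ ‖fderiv ℝ u z‖ ≤ C * M) ∧
      ∀ z z', ‖z‖ ≤ μ → ‖z'‖ ≤ μ → ‖fderiv ℝ u z - fderiv ℝ u z'‖ ≤ C * M * ‖z - z'‖ ^ α := by
  obtain ⟨κ, hκ, C, hC, hloc⟩ := exists_bound_of_isLocalSolution n h0 h1
  obtain ⟨r, hr, hr1, hr2⟩ : ∃ r : ℝ, 0 < r ∧ r ≤ (1 - μ) / 4 ∧ r ≤ κ / A :=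
    ⟨min ((1 - μ) / 4) (κ / A), lt_min (by linarith) (by positivity), min_le_left _ _,
      min_le_right _ _⟩
  have hrA : r * A ≤ κ := by rwa [le_div_iff₀ hA] at hr2
  refine ⟨κ, hκ, 2 * (C / r) * ((2 / r) ^ α + 1), by positivity, fun M J a u h => ?_⟩
  have hM : 0 ≤ M := (norm_nonneg _).trans (h.bound 0 (by simp))
  have inv : ∀ z₀ : ℂ, (fun y => (fun z => u (z₀ + r • z)) (-(r⁻¹ • z₀) + r⁻¹ • y)) = u :=
    fun z₀ => by
      funext y
      beta_reduce
      rw [smul_add, smul_neg, smul_inv_smul₀ hr.ne', smul_inv_smul₀ hr.ne', add_neg_cancel_left]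
  have hs : ∀ z₀ z : ℂ, -(r⁻¹ • z₀) + r⁻¹ • z = r⁻¹ • (z - z₀) := fun z₀ z => by
    rw [smul_sub]; abel
  have hfd : ∀ z₀ z : ℂ, fderiv ℝ u z =
      r⁻¹ • fderiv ℝ (fun z => u (z₀ + r • z)) (r⁻¹ • (z - z₀)) := fun z₀ z => by
    have := fderiv_comp_affine (fun z => u (z₀ + r • z)) r⁻¹ (-(r⁻¹ • z₀)) z
    rwa [inv z₀, hs] at this
  have hz : ∀ z₀ : ℂ, ‖z₀‖ ≤ μ → _ := fun z₀ hz₀ =>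
    hloc _ _ _ _ _ (h.zoom h0 hr hrA (z₀ := z₀) (by linarith))
  have hbd : ∀ z, ‖z‖ ≤ μ → ‖fderiv ℝ u z‖ ≤ C / r * M := fun z hzμ => by
    rw [hfd z z, sub_self, smul_zero]
    refine (norm_smul_le_of_nonneg r⁻¹ (by positivity) 
      (fderiv ℝ (fun y => u (z + r • y)) 0)).trans ?_
    refine (mul_le_mul_of_nonneg_left (hz z hzμ).1 (by positivity)).trans_eq ?_
    field_simp
  have hX : 0 ≤ C / r * M := by positivity
  have hY : 0 ≤ (2 / r) ^ α := by positivity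
  refine ⟨fun z hzμ => ⟨?_, (hbd z hzμ).trans ?_⟩, fun z z' hzμ hzμ' => ?_⟩
  · have := ((hz z hzμ).2 0 (by simp)).1
    rw [← inv z]
    refine DifferentiableAt.comp z (g := fun w => u (z + r • w)) ?_ (by fun_prop)
    rwa [neg_add_cancel]
  · nlinarith [mul_nonneg hX hY]
  · have hP : 0 ≤ ‖z - z'‖ ^ α := by positivity
    have key : ‖fderiv ℝ u z - fderiv ℝ u z'‖ ≤ 2 * (C / r * M) * ((2 / r) ^ α * ‖z - z'‖ ^ α) := by
      rw [← Real.mul_rpow (by positivity) (norm_nonneg _)]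
      by_cases hd : ‖z - z'‖ ≤ r / 2
      · have hns : ‖r⁻¹ • (z - z')‖ = r⁻¹ * ‖z - z'‖ := by
          rw [norm_smul, Real.norm_of_nonneg (by positivity)]
        have k := ((hz z' hzμ').2 (r⁻¹ • (z - z')) (by
          rw [hns, inv_mul_le_iff₀ hr]; linarith)).2
        rw [hns] at k
        rw [hfd z' z, hfd z' z', sub_self, smul_zero]
        refine (norm_smul_sub_smul_le _ (by positivity) _ _).trans ?_
        have k2 : (r⁻¹ * ‖z - z'‖) ^ α ≤ (2 / r * ‖z - z'‖) ^ α := by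
          refine Real.rpow_le_rpow (by positivity) ?_ h0.le
          rw [div_eq_mul_inv]
          nlinarith [mul_nonneg (inv_nonneg.2 hr.le) (norm_nonneg (z - z'))]
        have k3 : 0 ≤ (2 / r * ‖z - z'‖) ^ α := by positivity
        calc r⁻¹ * _ ≤ r⁻¹ * (C * M * (r⁻¹ * ‖z - z'‖) ^ α) := by gcongr
          _ ≤ r⁻¹ * (C * M * (2 / r * ‖z - z'‖) ^ α) := by gcongr
          _ = (C / r * M) * (2 / r * ‖z - z'‖) ^ α := by field_simp
          _ ≤ _ := by nlinarith [mul_nonneg hX k3]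
      · have k1 : 1 ≤ (2 / r * ‖z - z'‖) ^ α := by
          refine Real.one_le_rpow ?_ h0.le
          rw [div_mul_eq_mul_div, le_div_iff₀ hr]
          linarith
        refine (norm_sub_le _ _).trans ?_
        nlinarith [hbd z hzμ, hbd z' hzμ']
    nlinarith [mul_nonneg hX hP]

end Zoom

section Reflection

open scoped ComplexConjugate

/-- Extension of a function on the upper half plane to the lower half plane by reflection,
with values transformed by `T`. -/
noncomputable def reflect {F : Type*} (T : F → F) (f : ℂ → F) (z : ℂ) : F :=
  if 0 ≤ z.im then f z else T (f (conj z))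

lemma reflect_of_nonneg {F : Type*} (T : F → F) (f : ℂ → F) {z : ℂ} (hz : 0 ≤ z.im) :
    reflect T f z = f z := if_pos hz

lemma reflect_of_neg {F : Type*} (T : F → F) (f : ℂ → F) {z : ℂ} (hz : z.im < 0) :
    reflect T f z = T (f (conj z)) := if_neg hz.not_ge

lemma mem_closedHalfDisk_conj {μ : ℝ} {z : ℂ} (h : ‖z‖ ≤ μ) (hz : z.im < 0) :
    conj z ∈ closedHalfDisk μ := ⟨by simpa using h, by simpa using hz.le⟩

variable {F : Type*} [NormedAddCommGroup F] {T : F → F} {f : ℂ → F} {α H B : ℝ}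

lemma norm_reflect_sub_le (hT : ∀ x y, ‖T x - T y‖ ≤ ‖x - y‖) {c : F} (hc : T c = c)
    (hf : ∀ z ∈ closedHalfDisk 1, ‖f z - c‖ ≤ B) {z : ℂ} (hz : ‖z‖ ≤ 1) :
    ‖reflect T f z - c‖ ≤ B := by
  rcases le_or_gt 0 z.im with h | h
  · rw [reflect_of_nonneg T f h]
    exact hf z ⟨hz, h⟩
  · rw [reflect_of_neg T f h]
    nth_rw 1 [← hc]
    exact (hT _ _).trans (hf _ (mem_closedHalfDisk_conj hz h))

lemma norm_reflect_sub_reflect_le (hT : ∀ x y, ‖T x - T y‖ ≤ ‖x - y‖) (h0 : 0 < α) (hH : 0 ≤ H)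
    (hf : ∀ z ∈ closedHalfDisk 1, ∀ z' ∈ closedHalfDisk 1, ‖f z - f z'‖ ≤ H * ‖z - z'‖ ^ α)
    (hfix : ∀ z ∈ closedHalfDisk 1, z.im = 0 → T (f z) = f z) {z z' : ℂ} (hz : ‖z‖ ≤ 1)
    (hz' : ‖z'‖ ≤ 1) : ‖reflect T f z - reflect T f z'‖ ≤ 2 * H * ‖z - z'‖ ^ α := by
  have mixed : ∀ z z' : ℂ, ‖z‖ ≤ 1 → ‖z'‖ ≤ 1 → 0 ≤ z.im → z'.im < 0 →
      ‖reflect T f z - reflect T f z'‖ ≤ 2 * H * ‖z - z'‖ ^ α := by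
    intro z z' hz hz' h h'
    have hx : ((z.re : ℝ) : ℂ) ∈ closedHalfDisk 1 := ⟨by
      rw [Complex.norm_real]; exact (Complex.abs_re_le_norm z).trans hz, by simp⟩
    have d1 : ‖z - (z.re : ℝ)‖ ≤ ‖z - z'‖ := by
      rw [← sq_le_sq₀ (norm_nonneg _) (norm_nonneg _), ← Complex.normSq_eq_norm_sq,
        ← Complex.normSq_eq_norm_sq, Complex.normSq_apply, Complex.normSq_apply]
      simp
      nlinarith [sq_nonneg (z.re - z'.re)]
    have d2 : ‖((z.re : ℝ) : ℂ) - conj z'‖ ≤ ‖z - z'‖ := by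
      rw [← sq_le_sq₀ (norm_nonneg _) (norm_nonneg _), ← Complex.normSq_eq_norm_sq,
        ← Complex.normSq_eq_norm_sq, Complex.normSq_apply, Complex.normSq_apply]
      simp
      nlinarith
    have e := hfix _ hx (by simp)
    rw [reflect_of_nonneg T f h, reflect_of_neg T f h', ← sub_add_sub_cancel _ (f (z.re : ℝ))]
    refine (norm_add_le _ _).trans ?_
    have a1 := (hf z ⟨hz, h⟩ _ hx).trans
      (mul_le_mul_of_nonneg_left (Real.rpow_le_rpow (norm_nonneg _) d1 h0.le) hH)
    have a2 := ((hT (f (z.re : ℝ)) (f (conj z'))).trans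
      (hf _ hx _ (mem_closedHalfDisk_conj hz' h'))).trans
      (mul_le_mul_of_nonneg_left (Real.rpow_le_rpow (norm_nonneg _) d2 h0.le) hH)
    rw [e] at a2
    linarith
  have hX : 0 ≤ H * ‖z - z'‖ ^ α := by positivity
  rcases le_or_gt 0 z.im with h | h <;> rcases le_or_gt 0 z'.im with h' | h'
  · rw [reflect_of_nonneg T f h, reflect_of_nonneg T f h']
    linarith [hf z ⟨hz, h⟩ z' ⟨hz', h'⟩]
  · exact mixed z z' hz hz' h h'
  · rw [norm_sub_rev, norm_sub_rev z]
    exact mixed z' z hz' hz h' h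
  · rw [reflect_of_neg T f h, reflect_of_neg T f h']
    have := (hT _ _).trans (hf _ (mem_closedHalfDisk_conj hz h) _ (mem_closedHalfDisk_conj hz' h'))
    rw [← map_sub, RCLike.norm_conj] at this
    linarith

lemma continuousOn_reflect (hT : Continuous T) (hf : ContinuousOn f (closedHalfDisk 1))
    (hfix : ∀ z ∈ closedHalfDisk 1, z.im = 0 → T (f z) = f z) :
    ContinuousOn (reflect T f) (Metric.ball 0 1) := by
  have hcl : IsClosed {z : ℂ | ‖z‖ ≤ 1 ∧ z.im ≤ 0} :=
    (isClosed_le continuous_norm continuous_const).inter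
      (isClosed_le Complex.continuous_im continuous_const)
  have hcl' : IsClosed (closedHalfDisk 1) :=
    (isClosed_le continuous_norm continuous_const).inter
      (isClosed_le continuous_const Complex.continuous_im)
  have h1 : ContinuousOn (reflect T f) (closedHalfDisk 1) :=
    hf.congr fun z hz => reflect_of_nonneg T f hz.2
  have h2 : ContinuousOn (reflect T f) {z : ℂ | ‖z‖ ≤ 1 ∧ z.im ≤ 0} := by
    have hm : Set.MapsTo conj {z : ℂ | ‖z‖ ≤ 1 ∧ z.im ≤ 0} (closedHalfDisk 1) :=
      fun z hz => ⟨by simpa using hz.1, by simpa using hz.2⟩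
    refine (hT.comp_continuousOn (hf.comp Complex.continuous_conj.continuousOn hm)).congr
      fun z hz => ?_
    rcases hz.2.lt_or_eq with h | h
    · exact reflect_of_neg T f h
    · rw [reflect_of_nonneg T f h.ge]
      simp only [Function.comp_apply, Complex.conj_eq_iff_im.2 h]
      exact (hfix z ⟨hz.1, h.ge⟩ h).symm
  refine (h1.union_of_isClosed h2 hcl' hcl).mono fun z hz => ?_
  have hz1 : ‖z‖ ≤ 1 := by simpa using Metric.ball_subset_closedBall hz
  exact (le_total 0 z.im).imp (fun h => ⟨hz1, h⟩) fun h => ⟨hz1, h⟩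

end Reflection

section Conjugation

open scoped ComplexConjugate

variable {n : ℕ}

/-- The involution `tauInv` as a continuous real linear map. -/
noncomputable def tauCLM (n : ℕ) : (Fin n → ℂ) →L[ℝ] (Fin n → ℂ) :=
  ContinuousLinearMap.pi fun i =>
    (Complex.conjCLE : ℂ →L[ℝ] ℂ).comp (ContinuousLinearMap.proj i)

lemma tauCLM_apply (v : Fin n → ℂ) : tauCLM n v = tauInv n v := rfl

@[simp]
lemma tauCLM_tauCLM (v : Fin n → ℂ) : tauCLM n (tauCLM n v) = v := by
  ext i
  simp [tauCLM_apply, tauInv]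

@[simp]
lemma norm_tauCLM (v : Fin n → ℂ) : ‖tauCLM n v‖ = ‖v‖ := by
  simp [tauCLM_apply, tauInv, Pi.norm_def]

lemma tauCLM_I_smul (v : Fin n → ℂ) : tauCLM n (Complex.I • v) = -(Complex.I • tauCLM n v) := by
  ext i
  simp [tauCLM_apply, tauInv]

lemma tauCLM_of_mem_realSlice {v : Fin n → ℂ} (hv : v ∈ realSlice n) : tauCLM n v = v := by
  ext i
  exact Complex.conj_eq_iff_im.2 (hv i)

/-- Conjugation of an endomorphism by `tauCLM`. -/
noncomputable def tauConj (A : (Fin n → ℂ) →L[ℝ] (Fin n → ℂ)) : (Fin n → ℂ) →L[ℝ] (Fin n → ℂ) :=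
  (tauCLM n).comp (A.comp (tauCLM n))

lemma tauConj_apply (A : (Fin n → ℂ) →L[ℝ] (Fin n → ℂ)) (v : Fin n → ℂ) :
    tauConj A v = tauCLM n (A (tauCLM n v)) := rfl

lemma norm_tauConj_le (A : (Fin n → ℂ) →L[ℝ] (Fin n → ℂ)) : ‖tauConj A‖ ≤ ‖A‖ :=
  ContinuousLinearMap.opNorm_le_bound _ (norm_nonneg _) fun v => by
    rw [tauConj_apply, norm_tauCLM]
    simpa using A.le_opNorm (tauCLM n v)

lemma norm_tauConj_sub_le (A A' : (Fin n → ℂ) →L[ℝ] (Fin n → ℂ)) :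
    ‖tauConj A - tauConj A'‖ ≤ ‖A - A'‖ := by
  have : tauConj A - tauConj A' = tauConj (A - A') := by
    ext1 v
    simp [tauConj_apply]
  rw [this]
  exact norm_tauConj_le _

lemma norm_neg_tauConj_sub_le (A A' : (Fin n → ℂ) →L[ℝ] (Fin n → ℂ)) :
    ‖-tauConj A - -tauConj A'‖ ≤ ‖A - A'‖ := by
  rw [neg_sub_neg, norm_sub_rev]
  exact norm_tauConj_sub_le A A'

lemma neg_tauConj_Jstd : -tauConj (Jstd n) = Jstd n := by
  ext1 v
  rw [_root_.neg_apply, tauConj_apply, Jstd_apply, tauCLM_I_smul, tauCLM_tauCLM, neg_neg,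
    Jstd_apply]

lemma hasFDerivAt_tauCLM_comp_conj {u : ℂ → Fin n → ℂ} {z : ℂ}
    (h : DifferentiableAt ℝ u (conj z)) : HasFDerivAt (fun w => tauCLM n (u (conj w)))
      ((tauCLM n).comp ((fderiv ℝ u (conj z)).comp (Complex.conjCLE : ℂ →L[ℝ] ℂ))) z :=
  (tauCLM n).hasFDerivAt.comp z (h.hasFDerivAt.comp z Complex.conjCLE.hasFDerivAt)

lemma hasFDerivAt_reflect_of_pos {u : ℂ → Fin n → ℂ} {z : ℂ} (hz : 0 < z.im)
    (h : DifferentiableAt ℝ u z) : HasFDerivAt (reflect (tauCLM n) u) (fderiv ℝ u z) z := by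
  refine h.hasFDerivAt.congr_of_eventuallyEq ?_
  filter_upwards [(isOpen_lt continuous_const Complex.continuous_im).mem_nhds hz] with w hw
  exact reflect_of_nonneg _ _ (le_of_lt hw)

lemma hasFDerivAt_reflect_of_neg {u : ℂ → Fin n → ℂ} {z : ℂ} (hz : z.im < 0)
    (h : DifferentiableAt ℝ u (conj z)) : HasFDerivAt (reflect (tauCLM n) u)
      ((tauCLM n).comp ((fderiv ℝ u (conj z)).comp (Complex.conjCLE : ℂ →L[ℝ] ℂ))) z := by
  refine (hasFDerivAt_tauCLM_comp_conj h).congr_of_eventuallyEq ?_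
  filter_upwards [(isOpen_lt Complex.continuous_im continuous_const).mem_nhds hz] with w hw
  exact reflect_of_neg _ _ hw

lemma integrableOn_reflect_energy {u : ℂ → Fin n → ℂ} (hd : ∀ z ∈ halfDisk, DifferentiableAt ℝ u z)
    (he : IntegrableOn (fun z => ‖fderiv ℝ u z 1‖ ^ 2 + ‖fderiv ℝ u z Complex.I‖ ^ 2) halfDisk) :
    IntegrableOn (fun z => ‖fderiv ℝ (reflect (tauCLM n) u) z 1‖ ^ 2 +
      ‖fderiv ℝ (reflect (tauCLM n) u) z Complex.I‖ ^ 2) (Metric.ball 0 1) := by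
  have hmeas : MeasurableSet halfDisk :=
    ((isOpen_lt continuous_norm continuous_const).inter
      (isOpen_lt continuous_const Complex.continuous_im)).measurableSet
  have h1 := he.congr_fun (g := fun z => ‖fderiv ℝ (reflect (tauCLM n) u) z 1‖ ^ 2 +
      ‖fderiv ℝ (reflect (tauCLM n) u) z Complex.I‖ ^ 2) (fun z hz => by
    beta_reduce
    rw [(hasFDerivAt_reflect_of_pos hz.2 (hd z hz)).fderiv]) hmeas
  have hc := (Complex.conjLIE.measurePreserving.integrableOn_comp_preimage
    Complex.conjLIE.toHomeomorph.measurableEmbedding).2 he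
  have h2 := hc.congr_fun (g := fun z => ‖fderiv ℝ (reflect (tauCLM n) u) z 1‖ ^ 2 +
      ‖fderiv ℝ (reflect (tauCLM n) u) z Complex.I‖ ^ 2) (fun z hz => by
    have hz' : conj z ∈ halfDisk := hz
    have hzi : z.im < 0 := by simpa using hz'.2
    beta_reduce
    rw [(hasFDerivAt_reflect_of_neg hzi (hd _ hz')).fderiv]
    simp) (Complex.conjLIE.continuous.measurable hmeas)
  refine (h1.union h2).mono_set_ae ?_
  filter_upwards [ae_im_ne 0] with z hz hzb
  have hz1 : ‖z‖ < 1 := mem_ball_zero_iff.1 hzb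
  rcases lt_or_gt_of_ne hz with h | h
  · exact Or.inr ⟨by simpa using hz1, by simpa using h⟩
  · exact Or.inl ⟨hz1, h⟩

end Conjugation

section Conclusion

open scoped ComplexConjugate

variable {n : ℕ}

lemma holder_const_nonneg {F : Type*} [NormedAddCommGroup F] {f : ℂ → F} {H α : ℝ}
    (h : ∀ z ∈ closedHalfDisk 1, ∀ z' ∈ closedHalfDisk 1, ‖f z - f z'‖ ≤ H * ‖z - z'‖ ^ α) :
    0 ≤ H := by
  have := (norm_nonneg _).trans (h 0 (by simp [closedHalfDisk]) 1 (by simp [closedHalfDisk]))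
  simpa using this

lemma isDiskSolution_reflect {J a : ℂ → ((Fin n → ℂ) →L[ℝ] (Fin n → ℂ))} {u : ℂ → (Fin n → ℂ)}
    {M MJ HJ Ma Ha α κ A : ℝ} (h0 : 0 < α)
    (hJb : ∀ z ∈ closedHalfDisk 1, ‖J z - Jstd n‖ ≤ MJ)
    (hJh : ∀ z ∈ closedHalfDisk 1, ∀ z' ∈ closedHalfDisk 1, ‖J z - J z'‖ ≤ HJ * ‖z - z'‖ ^ α)
    (hκ : MJ + HJ < κ / 2)
    (hJr : ∀ z ∈ closedHalfDisk 1, z.im = 0 → J z = Jstd n)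
    (hab : ∀ z ∈ closedHalfDisk 1, ‖a z‖ ≤ Ma)
    (hah : ∀ z ∈ closedHalfDisk 1, ∀ z' ∈ closedHalfDisk 1, ‖a z - a z'‖ ≤ Ha * ‖z - z'‖ ^ α)
    (hA : Ma + Ha < A / 2)
    (har : ∀ z ∈ closedHalfDisk 1, z.im = 0 → ∀ v, tauInv n (a z (tauInv n v)) = a z v)
    (hc : ContinuousOn u (closedHalfDisk 1))
    (hb : ∀ z ∈ closedHalfDisk 1, ‖u z‖ ≤ M)
    (hd : ∀ z ∈ halfDisk, DifferentiableAt ℝ u z)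
    (he : ∀ z ∈ halfDisk, fderiv ℝ u z 1 + J z (fderiv ℝ u z Complex.I) + a z (u z) = 0)
    (hE : IntegrableOn (fun z => ‖fderiv ℝ u z 1‖ ^ 2 + ‖fderiv ℝ u z Complex.I‖ ^ 2) halfDisk)
    (hur : ∀ z ∈ closedHalfDisk 1, z.im = 0 → u z ∈ realSlice n) :
    IsDiskSolution α κ A M (reflect (fun B => -tauConj B) J) (reflect tauConj a)
      (reflect (tauCLM n) u) := by
  have m0 : (0:ℂ) ∈ closedHalfDisk 1 := by simp [closedHalfDisk]
  have hHJ := holder_const_nonneg hJh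
  have hHa := holder_const_nonneg hah
  have hMJ := (norm_nonneg _).trans (hJb 0 m0)
  have hMa := (norm_nonneg _).trans (hab 0 m0)
  have hτ : ∀ x y : Fin n → ℂ, ‖tauCLM n x - tauCLM n y‖ ≤ ‖x - y‖ := fun x y => by
    rw [← map_sub, norm_tauCLM]
  refine ⟨fun z hz => ?_, fun z z' hz hz' => ?_, fun z hz => ?_, fun z z' hz hz' => ?_,
    continuousOn_reflect (tauCLM n).continuous hc fun z hz hi =>
      tauCLM_of_mem_realSlice (hur z hz hi), fun z hz => ?_, fun z hz hi => ?_, fun z hz hi => ?_,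
    integrableOn_reflect_energy hd hE⟩
  · have := norm_reflect_sub_le (T := fun B => -tauConj B) norm_neg_tauConj_sub_le
      neg_tauConj_Jstd hJb hz
    linarith
  · refine (norm_reflect_sub_reflect_le (T := fun B => -tauConj B) norm_neg_tauConj_sub_le h0 hHJ
      hJh (fun w hw hi => ?_) hz hz').trans ?_
    · rw [hJr w hw hi, neg_tauConj_Jstd]
    · gcongr
      linarith
  · have := norm_reflect_sub_le (T := tauConj) (f := a) (c := 0) (B := Ma) norm_tauConj_sub_le
      (by ext1 v; simp [tauConj_apply]) (by simpa using hab) hz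
    rw [sub_zero] at this
    linarith
  · refine (norm_reflect_sub_reflect_le (T := tauConj) norm_tauConj_sub_le h0 hHa
      hah (fun w hw hi => ?_) hz hz').trans ?_
    · ext1 v
      exact har w hw hi v
    · gcongr
      linarith
  · have := norm_reflect_sub_le (T := tauCLM n) (f := u) (c := 0) (B := M) hτ (map_zero _)
      (by simpa using hb) hz.le
    rwa [sub_zero] at this
  · rcases lt_or_gt_of_ne hi with h | h
    · exact (hasFDerivAt_reflect_of_neg h
        (hd (conj z) ⟨by simpa using hz, by simpa using h⟩)).differentiableAt
    · exact (hasFDerivAt_reflect_of_pos h (hd z ⟨hz, h⟩)).differentiableAt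
  · rcases lt_or_gt_of_ne hi with h | h
    · have hz' : conj z ∈ halfDisk := ⟨by simpa using hz, by simpa using h⟩
      rw [(hasFDerivAt_reflect_of_neg h (hd (conj z) hz')).fderiv, reflect_of_neg _ _ h,
        reflect_of_neg _ _ h, reflect_of_neg _ _ h]
      have e := congrArg (tauCLM n) (he _ hz')
      rw [map_zero, map_add, map_add] at e
      rw [← e]
      simp [tauConj_apply]
    · rw [(hasFDerivAt_reflect_of_pos h (hd z ⟨hz, h⟩)).fderiv, reflect_of_nonneg _ _ h.le,
        reflect_of_nonneg _ _ h.le, reflect_of_nonneg _ _ h.le]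
      exact he z ⟨hz, h⟩

lemma convex_closedHalfDisk (μ : ℝ) : Convex ℝ (closedHalfDisk μ) := by
  have h1 : Convex ℝ {z : ℂ | ‖z‖ ≤ μ} := by simpa using convexOn_univ_norm.convex_le (E := ℂ) μ
  exact h1.inter (convex_halfSpace_im_ge 0)

end Conclusion

/-- boundary `C^{1,α}` estimate for holomorphic sections of a
complex vector bundle over the half-disk with a complex linear connection
(the reformulation in Step 7 of the proof of Theorem 2.3).  Hölder norms on
`D̄₊` are encoded by a sup bound and a Hölder constant. -/
theorem C1alpha_boundary_estimate_sections (n : ℕ) (hn : 1 ≤ n)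
    (α : ℝ) (hα : α ∈ Set.Ioo (0 : ℝ) 1) (μ' : ℝ) (hμ : μ' ∈ Set.Ioo (0 : ℝ) 1)
    (Cnab : ℝ) (hCnab : 0 < Cnab) :
    ∃ ε > 0, ∃ Ctil > 0,
      ∀ (J a : ℂ → ((Fin n → ℂ) →L[ℝ] (Fin n → ℂ)))
        (u : ℂ → (Fin n → ℂ)) (M MJ HJ Ma Ha : ℝ),
        (∀ z ∈ closedHalfDisk 1, ∀ v, J z (J z v) = -v) →
        (∀ z ∈ closedHalfDisk 1, ‖J z - Jstd n‖ ≤ MJ) →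
        (∀ z ∈ closedHalfDisk 1, ∀ z' ∈ closedHalfDisk 1,
          ‖J z - J z'‖ ≤ HJ * ‖z - z'‖ ^ α) →
        MJ + HJ < ε →
        (∀ z ∈ closedHalfDisk 1, z.im = 0 → J z = Jstd n) →
        (∀ z ∈ closedHalfDisk 1, ‖a z‖ ≤ Ma) →
        (∀ z ∈ closedHalfDisk 1, ∀ z' ∈ closedHalfDisk 1,
          ‖a z - a z'‖ ≤ Ha * ‖z - z'‖ ^ α) →
        Ma + Ha < Cnab →
        (∀ z ∈ closedHalfDisk 1, ∀ v, J z (a z v) = a z (J z v)) →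
        (∀ z ∈ closedHalfDisk 1, z.im = 0 → ∀ v, tauInv n (a z (tauInv n v)) = a z v) →
        ContinuousOn u (closedHalfDisk 1) →
        (∀ z ∈ closedHalfDisk 1, ‖u z‖ ≤ M) →
        (∀ z ∈ halfDisk, DifferentiableAt ℝ u z) →
        (∀ z ∈ halfDisk,
          fderiv ℝ u z 1 + J z (fderiv ℝ u z Complex.I) + a z (u z) = 0) →
        IntegrableOn
          (fun z => ‖fderiv ℝ u z 1‖ ^ 2 + ‖fderiv ℝ u z Complex.I‖ ^ 2) halfDisk →
        (∀ z ∈ closedHalfDisk 1, z.im = 0 → u z ∈ realSlice n) →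
        ∃ du : ℂ → (ℂ →L[ℝ] (Fin n → ℂ)),
          (∀ z ∈ closedHalfDisk μ',
            HasFDerivWithinAt u (du z) (closedHalfDisk μ') z) ∧
          ContinuousOn du (closedHalfDisk μ') ∧
          (∀ z ∈ closedHalfDisk μ', ‖u z‖ ≤ Ctil * M) ∧
          (∀ z ∈ closedHalfDisk μ', ∀ z' ∈ closedHalfDisk μ',
            ‖u z - u z'‖ ≤ Ctil * M * ‖z - z'‖ ^ α) ∧
          (∀ z ∈ closedHalfDisk μ', ‖du z‖ ≤ Ctil * M) ∧
          (∀ z ∈ closedHalfDisk μ', ∀ z' ∈ closedHalfDisk μ',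
            ‖du z - du z'‖ ≤ Ctil * M * ‖z - z'‖ ^ α) := by
  obtain ⟨h0, h1⟩ := hα
  obtain ⟨κ, hκ, C, hC, hreg⟩ := exists_bound_of_isDiskSolution n h0 h1 hμ.2
    (A := 2 * Cnab) (by positivity)
  refine ⟨κ / 2, by positivity, 2 * C + 1, by positivity, ?_⟩
  intro J a u M MJ HJ Ma Ha _ hJb hJh hJε hJr hab hah haC _ har hc hb hd he hE hur
  have hM : 0 ≤ M := (norm_nonneg _).trans (hb 0 (by simp [closedHalfDisk]))
  have hsol := isDiskSolution_reflect h0 hJb hJh hJε hJr hab hah (A := 2 * Cnab) (by linarith) har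
    hc hb hd he hE hur
  obtain ⟨hD, hH⟩ := hreg M _ _ _ hsol
  set w := reflect (tauCLM n) u with hw
  have hmono : closedHalfDisk μ' ⊆ closedHalfDisk 1 := fun z hz => ⟨hz.1.trans hμ.2.le, hz.2⟩
  have hdu : ∀ z ∈ closedHalfDisk μ', HasFDerivWithinAt u (fderiv ℝ w z) (closedHalfDisk μ') z :=
    fun z hz => (hD z hz.1).1.hasFDerivAt.hasFDerivWithinAt.congr
      (fun y hy => (reflect_of_nonneg _ _ hy.2).symm) (reflect_of_nonneg _ _ hz.2).symm
  have hCM : 0 ≤ C * M := by positivity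
  have hH' : ∀ z ∈ closedHalfDisk μ', ∀ z' ∈ closedHalfDisk μ',
      ‖fderiv ℝ w z - fderiv ℝ w z'‖ ≤ (2 * C + 1) * M * ‖z - z'‖ ^ α := fun z hz z' hz' =>
    (hH z z' hz.1 hz'.1).trans (mul_le_mul_of_nonneg_right (by linarith) (by positivity))
  refine ⟨fderiv ℝ w, hdu, continuousOn_of_holder h0 hH', fun z hz => ?_, fun z hz z' hz' => ?_,
    fun z hz => ?_, hH'⟩
  · linarith [hb z (hmono hz)]
  · have hl := (convex_closedHalfDisk μ').norm_image_sub_le_of_norm_hasFDerivWithin_le hdu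
      (fun x hx => (hD x hx.1).2) hz' hz
    have hd2 : ‖z - z'‖ ≤ 2 := (norm_sub_le _ _).trans (by linarith [hz.1, hz'.1, hμ.2])
    have hp : ‖z - z'‖ ≤ 2 * ‖z - z'‖ ^ α := by
      have e1 : ‖z - z'‖ / 2 ≤ (‖z - z'‖ / 2) ^ α := by
        simpa using Real.rpow_le_rpow_of_exponent_ge_of_imp (x := ‖z - z'‖ / 2) (by positivity)
          (by linarith) h1.le (by simp)
      have e2 : (‖z - z'‖ / 2) ^ α ≤ ‖z - z'‖ ^ α :=
        Real.rpow_le_rpow (by positivity) (by linarith [norm_nonneg (z - z')]) h0.le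
      linarith
    have hq : 0 ≤ M * ‖z - z'‖ ^ α := by positivity
    nlinarith [mul_le_mul_of_nonneg_left hp hCM]
  · linarith [(hD z hz.1).2]
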